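/- There exists a finitely generated perfect group G whose normal rank is greater than one; that is, G is finitely generated, G equals its own commutator subgroup, and for every element w ∈ G the normal closure ⟨⟨w⟩⟩ of w in G is a proper subgroup of G. -/

import Mathlib

theorem exists_leftInvariant_linearOrder_orderIso (Ω : Type) [LinearOrder Ω] [Countable Ω]
    [Nonempty Ω] :
    ∃ _ : LinearOrder (Ω ≃o Ω), ∀ a b c : Ω ≃o Ω, a ≤ b → c * a ≤ c * b := by
  obtain ⟨f, hf⟩ := exists_surjective_nat Ω
  let φ : (Ω ≃o Ω) → Lex (ℕ → Ω) := fun g => toLex fun n => g (f n)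
  have hφ : Function.Injective φ := by
    intro g h hgh
    ext x
    obtain ⟨n, rfl⟩ := hf x
    exact congrFun hgh n
  refine ⟨LinearOrder.lift' φ hφ, fun a b c hab => ?_⟩
  change φ a ≤ φ b at hab
  change φ (c * a) ≤ φ (c * b)
  rcases hab.eq_or_lt with h | h
  · rw [hφ h]
  · apply le_of_lt
    obtain ⟨n, hn, hlt⟩ := h
    refine ⟨n, fun j hj => ?_, ?_⟩
    · exact congrArg c (hn j hj)
    · exact c.lt_iff_lt.2 hlt

/-- A countable linear order: the integers times the rational projective line, the point at
infinity of each fibre preceding the finite points. -/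
inductive ProjLine : Type
  | inf (n : ℤ)
  | pt (n : ℤ) (q : ℚ)

namespace ProjLine

def key : ProjLine → ℤ ×ₗ WithBot ℚ
  | inf n => toLex (n, ⊥)
  | pt n q => toLex (n, (q : WithBot ℚ))

theorem key_injective : Function.Injective key := by
  intro x y h
  cases x <;> cases y <;> simp_all [key]

instance : Countable ProjLine :=
  have : Countable (ℤ ×ₗ WithBot ℚ) := inferInstanceAs (Countable (ℤ × Option ℚ))
  key_injective.countable

noncomputable instance : LinearOrder ProjLine := LinearOrder.lift' key key_injective

instance : Nonempty ProjLine := ⟨inf 0⟩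

theorem lt_iff_key {x y : ProjLine} : x < y ↔ key x < key y := Iff.rfl

@[simp] theorem inf_lt_inf {n m : ℤ} : inf n < inf m ↔ n < m := by
  simp [lt_iff_key, key, Prod.Lex.toLex_lt_toLex]

@[simp] theorem inf_lt_pt {n m : ℤ} {q : ℚ} : inf n < pt m q ↔ n ≤ m := by
  simp [lt_iff_key, key, Prod.Lex.toLex_lt_toLex, le_iff_lt_or_eq]

@[simp] theorem pt_lt_inf {n m : ℤ} {q : ℚ} : pt n q < inf m ↔ n < m := by
  simp [lt_iff_key, key, Prod.Lex.toLex_lt_toLex]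

@[simp] theorem pt_lt_pt {n m : ℤ} {q r : ℚ} : pt n q < pt m r ↔ n < m ∨ n = m ∧ q < r := by
  simp [lt_iff_key, key, Prod.Lex.toLex_lt_toLex]

/-- Translation by `r` in every fibre. -/
noncomputable def trans (r : ℚ) : ProjLine ≃o ProjLine :=
  StrictMono.orderIsoOfRightInverse
    (fun | inf n => inf n | pt n q => pt n (q + r))
    (by intro x y h; cases x <;> cases y <;> simp_all)
    (fun | inf n => inf n | pt n q => pt n (q - r))
    (by intro x; cases x <;> simp)

/-- Multiplication by `c` in every fibre. -/
noncomputable def scale (c : ℚ) (hc : 0 < c) : ProjLine ≃o ProjLine :=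
  StrictMono.orderIsoOfRightInverse
    (fun | inf n => inf n | pt n q => pt n (c * q))
    (by intro x y h; cases x <;> cases y <;> simp_all)
    (fun | inf n => inf n | pt n q => pt n (q / c))
    (by intro x; cases x <;> simp [mul_div_cancel₀, hc.ne'])

def flipFun : ProjLine → ProjLine
  | inf n => pt n 0
  | pt n q => if q < 0 then pt n (-1 / q) else if q = 0 then inf (n + 1) else pt (n + 1) (-1 / q)

def flipInv : ProjLine → ProjLine
  | inf n => pt (n - 1) 0
  | pt n q => if 0 < q then pt n (-1 / q) else if q = 0 then inf n else pt (n - 1) (-1 / q)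

theorem flipFun_strictMono : StrictMono flipFun := by
  intro x y h
  have key : ∀ q r : ℚ, q < r → 0 < q * r → -1 / q < -1 / r := by
    intro q r h1 h2
    have hq : q ≠ 0 := by rintro rfl; simp at h2
    have hr : r ≠ 0 := by rintro rfl; simp at h2
    have : -1 / r - -1 / q = (r - q) / (q * r) := by field_simp; ring
    have : 0 < (r - q) / (q * r) := div_pos (by linarith) h2
    linarith
  cases x with
  | inf n =>
    cases y with
    | inf m => simpa [flipFun] using h
    | pt m q =>
      simp only [inf_lt_pt] at h
      simp only [flipFun]
      split_ifs with h1 h2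
      · have : 0 < -1 / q := div_pos_of_neg_of_neg (by norm_num) h1
        simp only [pt_lt_pt, this, and_true]; omega
      · simp only [pt_lt_inf]; omega
      · simp only [pt_lt_pt]; omega
  | pt n p =>
    cases y with
    | inf m =>
      simp only [pt_lt_inf] at h
      simp only [flipFun]
      split_ifs with h1 h2
      · simp only [pt_lt_pt]; omega
      · simp only [inf_lt_pt]; omega
      · have : -1 / p < 0 := div_neg_of_neg_of_pos (by norm_num)
          (lt_of_le_of_ne (not_lt.1 h1) (Ne.symm h2))
        simp only [pt_lt_pt, this, and_true]; omega
    | pt m q =>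
      simp only [pt_lt_pt] at h
      simp only [flipFun]
      have e1 : p < 0 → 0 < -1 / p := div_pos_of_neg_of_neg (by norm_num)
      have e2 : 0 < p → -1 / p < 0 := div_neg_of_neg_of_pos (by norm_num)
      have e3 : q < 0 → 0 < -1 / q := div_pos_of_neg_of_neg (by norm_num)
      have e4 : 0 < q → -1 / q < 0 := div_neg_of_neg_of_pos (by norm_num)
      have e0 : n ≤ m := by omega
      by_cases hnm : n = m
      · have hpq : p < q := by grind
        subst hnm
        split_ifs with h1 h2 h3 h4 h5 h6 h7 h8 <;>
          simp only [pt_lt_pt, inf_lt_pt, inf_lt_inf, pt_lt_inf] <;> try first | omega | linarith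
        · exact Or.inr ⟨trivial, key _ _ hpq (mul_pos_of_neg_of_neg h1 h2)⟩
        · exact Or.inr ⟨trivial, key _ _ hpq (mul_pos (by grind) (by grind))⟩
      · have e5 : n < m := lt_of_le_of_ne e0 hnm
        split_ifs with h1 h2 h3 h4 h5 h6 h7 h8 <;>
          simp only [pt_lt_pt, inf_lt_pt, inf_lt_inf, pt_lt_inf] <;> try omega
        rcases eq_or_lt_of_le (show n + 1 ≤ m by omega) with h9 | h9
        · exact Or.inr ⟨h9, (e2 (by grind)).trans (e3 (by assumption))⟩
        · exact Or.inl h9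

/-- A lift of `q ↦ -1 / q`. -/
noncomputable def flip : ProjLine ≃o ProjLine :=
  StrictMono.orderIsoOfRightInverse flipFun flipFun_strictMono flipInv (by
    intro x
    cases x with
    | inf n => simp [flipInv, flipFun]
    | pt n q =>
      simp only [flipInv]
      split_ifs with h1 h2
      · have : -1 / q < 0 := div_neg_of_neg_of_pos (by norm_num) h1
        simp only [flipFun, this, if_true]
        congr 1; field_simp
      · simp [flipFun, h2]
      · have : 0 < -1 / q :=
          div_pos_of_neg_of_neg (by norm_num) (lt_of_le_of_ne (not_lt.1 h1) h2)
        simp only [flipFun, this.not_gt, this.ne', if_false]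
        congr 1
        · ring
        · field_simp)

@[simp] theorem trans_inf (r n) : trans r (inf n) = inf n := rfl
@[simp] theorem trans_pt (r n q) : trans r (pt n q) = pt n (q + r) := rfl
@[simp] theorem scale_inf (c hc n) : scale c hc (inf n) = inf n := rfl
@[simp] theorem scale_pt (c hc n q) : scale c hc (pt n q) = pt n (c * q) := rfl
theorem flip_apply (x) : flip x = flipFun x := rfl

theorem trans_mul (r s : ℚ) : trans r * trans s = trans (r + s) := by
  ext x; cases x <;> simp [RelIso.mul_apply]; ring

theorem scale_mul_trans (c hc r) : scale c hc * trans r = trans (c * r) * scale c hc := by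
  ext x; cases x <;> simp [RelIso.mul_apply]; ring

theorem flip_inf (n) : flip (inf n) = pt n 0 := rfl

theorem flip_zero (n) : flip (pt n 0) = inf (n + 1) := by simp [flip_apply, flipFun]

theorem flip_neg (n) {q : ℚ} (hq : q < 0) : flip (pt n q) = pt n (-1 / q) := by
  simp [flip_apply, flipFun, hq]

theorem flip_pos (n) {q : ℚ} (hq : 0 < q) : flip (pt n q) = pt (n + 1) (-1 / q) := by
  simp [flip_apply, flipFun, hq.not_gt, hq.ne']

theorem trans_flip_trans (c : ℚ) (hc : 0 < c) :
    trans c * flip * trans (1 / c) = scale (c ^ 2) (by positivity) * flip * trans (-c) * flip := by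
  ext x
  simp only [RelIso.mul_apply]
  have hc' : 0 < 1 / c := by positivity
  cases x with
  | inf n =>
    rw [trans_inf, flip_inf, trans_pt, trans_pt, flip_neg n (by linarith), scale_pt]
    congr 1
    have := hc.ne'
    have h0 : -1 / (0 + -c) = 1 / c := by rw [zero_add, neg_div_neg_eq]
    rw [h0]
    field_simp
    ring
  | pt n q =>
    have alg : q ≠ 0 → q + 1 / c ≠ 0 → -1 / (q + 1 / c) + c = c ^ 2 * (-1 / (-1 / q + -c)) := by
      intro hq hu
      have e : -1 / q + -c = (q + 1 / c) * (c / -q) := by field_simp; ring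
      rw [e]
      obtain ⟨u, rfl⟩ : ∃ u, q = u - 1 / c := ⟨q + 1 / c, by ring⟩
      rw [sub_add_cancel] at hu ⊢
      field_simp; ring
    rcases lt_trichotomy q 0 with hq | rfl | hq
    · rw [flip_neg n hq, trans_pt, trans_pt]
      have e : -1 / q + -c = (q + 1 / c) * (c / -q) := by field_simp [hq.ne]; ring
      have e' : 0 < c / -q := div_pos hc (by linarith)
      rcases lt_trichotomy (q + 1 / c) 0 with h | h | h
      · have h2 := mul_neg_of_neg_of_pos h e'
        rw [← e] at h2
        rw [flip_neg n h, flip_neg n h2, trans_pt, scale_pt, alg hq.ne h.ne]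
      · rw [h, e, h, zero_mul, flip_zero]; simp
      · have h2 := mul_pos h e'
        rw [← e] at h2
        rw [flip_pos n h, flip_pos n h2, trans_pt, scale_pt, alg hq.ne h.ne']
    · rw [trans_pt, flip_zero, zero_add, flip_pos n hc', trans_inf, flip_inf, trans_pt, scale_pt]
      congr 1; field_simp; ring
    · have h2 : -1 / q < 0 := div_neg_of_neg_of_pos (by norm_num) hq
      rw [trans_pt, flip_pos n hq, flip_pos n (by linarith), trans_pt, trans_pt,
        flip_neg (n + 1) (by linarith), scale_pt]
      rw [alg hq.ne' (by positivity)]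

end ProjLine

theorem commutator_closure_eq_top {G : Type*} [Group G] {S : Set G}
    (h : ∀ s ∈ S, s ∈ ⁅Subgroup.closure S, Subgroup.closure S⁆) :
    commutator (Subgroup.closure S) = ⊤ := by
  apply Subgroup.map_injective (Subgroup.subtype_injective _)
  rw [Subgroup.map_subtype_commutator, ← MonoidHom.range_eq_map, Subgroup.range_subtype]
  exact le_antisymm (Subgroup.commutator_le_self _) ((Subgroup.closure_le _).2 h)

/-- There is a nontrivial countable finitely generated perfect left-orderable group. -/
theorem exists_perfect_leftOrdered : ∃ (A : Type) (_ : Group A), Countable A ∧ Nontrivial A ∧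
    Group.FG A ∧ commutator A = ⊤ ∧ ∃ _ : LinearOrder A, ∀ a b c : A, a ≤ b → c * a ≤ c * b := by
  classical
  let e : ProjLine ≃o ProjLine := ProjLine.trans 1
  let j : ProjLine ≃o ProjLine := ProjLine.flip
  let a : ProjLine ≃o ProjLine := ProjLine.scale 4 (by norm_num)
  let b : ProjLine ≃o ProjLine := ProjLine.scale 9 (by norm_num)
  let S : Set (ProjLine ≃o ProjLine) := {e, j, a, b}
  let A := Subgroup.closure S
  let D := ⁅A, A⁆
  have heA : e ∈ A := Subgroup.subset_closure (by simp [S])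
  have hjA : j ∈ A := Subgroup.subset_closure (by simp [S])
  have haA : a ∈ A := Subgroup.subset_closure (by simp [S])
  have hbA : b ∈ A := Subgroup.subset_closure (by simp [S])
  have hDA : D ≤ A := Subgroup.commutator_le_self A
  have conj : ∀ x ∈ A, ∀ y ∈ D, x * y * x⁻¹ ∈ D := by
    intro x hx y hy
    have := Subgroup.commutator_mem_commutator hx (hDA hy)
    rw [commutatorElement_def] at this
    simpa using D.mul_mem this hy
  have htr : ∀ (r s : ℚ), ProjLine.trans (r + s) = ProjLine.trans r * ProjLine.trans s :=
    fun r s => (ProjLine.trans_mul r s).symm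
  have tpow : ∀ n : ℕ, ProjLine.trans n = e ^ n := by
    intro n
    induction n with
    | zero => ext x; cases x <;> simp
    | succ n ih => rw [pow_succ, ← ih, Nat.cast_succ, htr]
  have hst : ∀ c hc r, ProjLine.trans (c * r) =
      ProjLine.scale c hc * ProjLine.trans r * (ProjLine.scale c hc)⁻¹ := by
    intro c hc r
    rw [ProjLine.scale_mul_trans, mul_inv_cancel_right]
  have h3 : e ^ 3 ∈ D := by
    have := Subgroup.commutator_mem_commutator haA heA
    rw [commutatorElement_def] at this
    have h4 : a * e * a⁻¹ = e ^ 4 := by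
      rw [← hst, ← tpow]; norm_num
    rw [h4] at this
    rwa [pow_succ, mul_inv_cancel_right] at this
  have h8 : e ^ 8 ∈ D := by
    have := Subgroup.commutator_mem_commutator hbA heA
    rw [commutatorElement_def] at this
    have h4 : b * e * b⁻¹ = e ^ 9 := by
      rw [← hst, ← tpow]; norm_num
    rw [h4] at this
    rwa [pow_succ, mul_inv_cancel_right] at this
  have he : e ∈ D := by
    have := D.mul_mem (D.pow_mem h3 3) (D.inv_mem h8)
    have h : (e ^ 3) ^ 3 * (e ^ 8)⁻¹ = e := by group
    rwa [h] at this
  have key : ∀ (c : ℚ) (hc : 0 < c), ProjLine.trans c ∈ D → ProjLine.trans (1 / c) ∈ D →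
      ProjLine.scale (c ^ 2) (by positivity) * j ∈ D := by
    intro c hc h1 h2
    have h : ProjLine.scale (c ^ 2) (by positivity) * j =
        ProjLine.trans c * (j * ProjLine.trans (1 / c) * j⁻¹) * ProjLine.trans c := by
      have := ProjLine.trans_flip_trans c hc
      have h0 : ProjLine.trans (-c) = (ProjLine.trans c)⁻¹ := by
        rw [eq_inv_iff_mul_eq_one, ← htr, neg_add_cancel]
        exact_mod_cast tpow 0
      rw [h0] at this
      change ProjLine.trans c * j * ProjLine.trans (1 / c) = _ * j * _ * j at this
      calc _ = (ProjLine.scale (c ^ 2) (by positivity) * j * (ProjLine.trans c)⁻¹ * j) * j⁻¹ *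
            ProjLine.trans c := by group
        _ = _ := by rw [← this]; group
    rw [h]
    exact D.mul_mem (D.mul_mem h1 (conj j hjA _ h2)) h1
  have hn : ∀ n : ℕ, ProjLine.trans n ∈ D := fun n => by rw [tpow]; exact D.pow_mem he n
  have hj : j ∈ D := by
    have := key 1 one_pos (by exact_mod_cast hn 1) (by simpa using hn 1)
    have h : ProjLine.scale (1 ^ 2) (by positivity) * j = j := by
      have : ProjLine.scale (1 ^ 2) (by positivity) = 1 := by ext x; cases x <;> simp
      rw [this, one_mul]
    rwa [h] at this
  have ha : a ∈ D := by
    have h1 : ProjLine.trans (1 / 2) ∈ D := by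
      have := conj a⁻¹ (A.inv_mem haA) _ (hn 2)
      have h : ProjLine.trans ((2 : ℕ) : ℚ) = a * ProjLine.trans (1 / 2) * a⁻¹ := by
        rw [← hst]; norm_num
      rw [h] at this
      convert this using 1; group
    have := key 2 two_pos (by exact_mod_cast hn 2) h1
    have h2 := D.mul_mem this (D.inv_mem hj)
    rw [mul_inv_cancel_right] at h2
    convert h2 using 2; norm_num
  have hb : b ∈ D := by
    have h1 : ProjLine.trans (1 / 3) ∈ D := by
      have := conj b⁻¹ (A.inv_mem hbA) _ (hn 3)
      have h : ProjLine.trans ((3 : ℕ) : ℚ) = b * ProjLine.trans (1 / 3) * b⁻¹ := by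
        rw [← hst]; norm_num
      rw [h] at this
      convert this using 1; group
    have := key 3 three_pos (by exact_mod_cast hn 3) h1
    have h2 := D.mul_mem this (D.inv_mem hj)
    rw [mul_inv_cancel_right] at h2
    convert h2 using 2; norm_num
  have hfg : Group.FG A := by
    rw [Group.fg_iff_subgroup_fg]
    exact ⟨{e, j, a, b}, by simp [A, S]⟩
  obtain ⟨o, ho⟩ := exists_leftInvariant_linearOrder_orderIso ProjLine
  refine ⟨A, inferInstance, ?_, ⟨⟨⟨e, heA⟩, 1, ?_⟩⟩, hfg, ?_, ?_⟩
  · obtain ⟨n, _, f, hf⟩ := Group.fg_iff_exists_freeGroup_hom_surjective_finite.1 hfg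
    have : Countable (FreeGroup n) := inferInstanceAs (Countable (Quot _))
    exact hf.countable
  · intro h
    have h' : e = 1 := congrArg Subtype.val h
    have := congrArg (fun f : ProjLine ≃o ProjLine => f (ProjLine.pt 0 0)) h'
    simp [e] at this
  · apply commutator_closure_eq_top
    rintro s (rfl | rfl | rfl | rfl)
    exacts [he, hj, ha, hb]
  · exact ⟨LinearOrder.lift' Subtype.val Subtype.val_injective, fun x y z h => ho _ _ _ h⟩

/-- The free product of two copies of a group. -/
abbrev FreeSquare (A : Type) [Group A] : Type := Monoid.CoprodI (fun _ : Bool => A)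

namespace FreeSquare

variable {A : Type} [Group A]

/-- The inclusion of the factor with index `i`. -/
abbrev inj (i : Bool) : A →* FreeSquare A := Monoid.CoprodI.of (M := fun _ : Bool => A) (i := i)

end FreeSquare

section Total

variable {G : Type*} [Group G]

/-- A submonoid meeting every pair `{g, g⁻¹}`. -/
def Submonoid.IsTotal (Q : Submonoid G) : Prop := ∀ g, g ∈ Q ∨ g⁻¹ ∈ Q

/-- The largest subgroup contained in a submonoid. -/
def Submonoid.unitSubgroup (Q : Submonoid G) : Subgroup G where
  carrier := {g | g ∈ Q ∧ g⁻¹ ∈ Q}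
  mul_mem' := fun {a b} ha hb => ⟨Q.mul_mem ha.1 hb.1, by
    rw [mul_inv_rev]; exact Q.mul_mem hb.2 ha.2⟩
  one_mem' := ⟨Q.one_mem, by rw [inv_one]; exact Q.one_mem⟩
  inv_mem' := fun {a} ha => ⟨ha.2, by rw [inv_inv]; exact ha.1⟩

theorem Submonoid.mem_unitSubgroup {Q : Submonoid G} {g : G} :
    g ∈ Q.unitSubgroup ↔ g ∈ Q ∧ g⁻¹ ∈ Q := Iff.rfl

/-- `Q` is minimal among the total submonoids whose unit subgroup contains `w`. -/
structure Submonoid.IsMinimalTotal (Q : Submonoid G) (w : G) : Prop where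
  total : Q.IsTotal
  mem : w ∈ Q.unitSubgroup
  le_of_total : ∀ R : Submonoid G, (∀ g ∈ R, g ∈ Q.unitSubgroup) →
    (∀ g ∈ Q.unitSubgroup, g ∈ R ∨ g⁻¹ ∈ R) → w ∈ R → w⁻¹ ∈ R → ∀ g ∈ Q.unitSubgroup, g ∈ R

theorem exists_isMinimalTotal (w : G) : ∃ Q : Submonoid G, Q.IsMinimalTotal w := by
  let S : Set (Set G) := {T | ∃ Q : Submonoid G, (Q : Set G) = T ∧ Q.IsTotal ∧ w ∈ Q ∧ w⁻¹ ∈ Q}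
  obtain ⟨T, hT⟩ := zorn_superset S (by
    intro c hc hchain
    by_cases hne : c.Nonempty
    · refine ⟨⋂₀ c, ⟨{ carrier := ⋂₀ c, mul_mem' := ?_, one_mem' := ?_ }, rfl, ?_, ?_, ?_⟩,
        fun s hs => Set.sInter_subset_of_mem hs⟩
      · intro a b ha hb s hs
        obtain ⟨Q, rfl, -⟩ := hc hs
        exact Q.mul_mem (ha _ hs) (hb _ hs)
      · intro s hs
        obtain ⟨Q, rfl, -⟩ := hc hs
        exact Q.one_mem
      · intro g
        by_contra! h
        obtain ⟨h1, h2⟩ := h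
        change ¬ g ∈ ⋂₀ c at h1
        change ¬ g⁻¹ ∈ ⋂₀ c at h2
        simp only [Set.mem_sInter, not_forall] at h1 h2
        obtain ⟨s, hs, hgs⟩ := h1
        obtain ⟨t, ht, hgt⟩ := h2
        rcases hchain.total hs ht with h | h
        · obtain ⟨Q, rfl, hQ, -⟩ := hc hs
          exact (hQ g).elim hgs fun h' => hgt (h h')
        · obtain ⟨Q, rfl, hQ, -⟩ := hc ht
          exact (hQ g).elim (fun h' => hgs (h h')) hgt
      · intro s hs
        obtain ⟨Q, rfl, -, h, -⟩ := hc hs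
        exact h
      · intro s hs
        obtain ⟨Q, rfl, -, -, h⟩ := hc hs
        exact h
    · refine ⟨Set.univ, ⟨⊤, rfl, fun g => Or.inl trivial, trivial, trivial⟩,
        fun s hs => (hne ⟨s, hs⟩).elim⟩)
  obtain ⟨⟨Q, rfl, hQ, hw, hw'⟩, hmin⟩ := hT
  refine ⟨Q, hQ, ⟨hw, hw'⟩, fun R hRQ hRt hwR hwR' => ?_⟩
  let R' : Submonoid G :=
    { carrier := {g | g ∈ R ∨ g ∈ Q ∧ g⁻¹ ∉ Q}
      one_mem' := Or.inl R.one_mem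
      mul_mem' := by
        rintro a b (ha | ⟨ha, ha'⟩) (hb | ⟨hb, hb'⟩)
        · exact Or.inl (R.mul_mem ha hb)
        · refine Or.inr ⟨Q.mul_mem (hRQ a ha).1 hb, fun h => hb' ?_⟩
          have := Q.mul_mem h (hRQ a ha).1
          rwa [mul_inv_rev, inv_mul_cancel_right] at this
        · refine Or.inr ⟨Q.mul_mem ha (hRQ b hb).1, fun h => ha' ?_⟩
          have := Q.mul_mem (hRQ b hb).1 h
          rwa [mul_inv_rev, mul_inv_cancel_left] at this
        · refine Or.inr ⟨Q.mul_mem ha hb, fun h => ha' ?_⟩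
          have := Q.mul_mem hb h
          rwa [mul_inv_rev, mul_inv_cancel_left] at this }
  have hR'Q : (R' : Set G) ⊆ Q := by
    rintro g (hg | hg)
    · exact (hRQ g hg).1
    · exact hg.1
  have hQR' := hmin (y := (R' : Set G)) ⟨R', rfl, fun g => by
    by_cases hg : g ∈ Q
    · by_cases hg' : g⁻¹ ∈ Q
      · exact (hRt g ⟨hg, hg'⟩).imp Or.inl Or.inl
      · exact Or.inl (Or.inr ⟨hg, hg'⟩)
    · exact Or.inr (Or.inr ⟨(hQ g).resolve_left hg, by rwa [inv_inv]⟩),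
      Or.inl hwR, Or.inl hwR'⟩ hR'Q
  rintro g ⟨hg, hg'⟩
  rcases hQR' hg with h | h
  · exact h
  · exact absurd hg' h.2

end Total

section Skew

variable {A : Type} [Group A] {X Y : Type*} [MulAction (FreeSquare A) X]

open FreeSquare

/-- Cocycles on the factors define an action of the free product on `X × Y`. -/
theorem exists_skew_action (c : Bool → A → X → Equiv.Perm Y)
    (hc : ∀ i a b x, c i (a * b) x = c i a (inj i b • x) * c i b x) :
    ∃ ρ : FreeSquare A →* Equiv.Perm (X × Y),
      (∀ i a x y, ρ (inj i a) (x, y) = (inj i a • x, c i a x y)) ∧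
      ∀ g p, (ρ g p).1 = g • p.1 := by
  have hc1 : ∀ i x, c i 1 x = 1 := by
    intro i x
    have := hc i 1 1 x
    rw [mul_one, map_one, one_smul] at this
    exact left_eq_mul.1 this
  let T (i : Bool) (a : A) : X × Y → X × Y := fun p => (inj i a • p.1, c i a p.1 p.2)
  have hT1 : ∀ i, T i 1 = id := by
    intro i
    funext p
    simp [T, hc1]
  have hTm : ∀ i a b, T i (a * b) = T i a ∘ T i b := by
    intro i a b
    funext p
    simp [T, hc, mul_smul]
  let f (i : Bool) : A →* Equiv.Perm (X × Y) :=
    { toFun := fun a => ⟨T i a, T i a⁻¹, fun p => by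
          have := congrFun (hTm i a⁻¹ a) p
          rw [inv_mul_cancel, hT1] at this
          exact this.symm, fun p => by
          have := congrFun (hTm i a a⁻¹) p
          rw [mul_inv_cancel, hT1] at this
          exact this.symm⟩
      map_one' := Equiv.ext fun p => congrFun (hT1 i) p
      map_mul' := fun a b => Equiv.ext fun p => congrFun (hTm i a b) p }
  have hf : ∀ i a p, Monoid.CoprodI.lift f (inj i a) p = (inj i a • p.1, c i a p.1 p.2) := by
    intro i a p
    rw [Monoid.CoprodI.lift_of]
    rfl
  refine ⟨Monoid.CoprodI.lift f, fun i a x y => hf i a (x, y), fun g => ?_⟩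
  induction g using Monoid.CoprodI.induction_on with
  | one => intro p; simp
  | of i a => intro p; exact congrArg Prod.fst (hf i a p)
  | mul g h hg hh =>
    intro p
    rw [map_mul, Equiv.Perm.mul_apply, hg, hh, mul_smul]

variable [Preorder Y]

theorem skew_action_monotone {ρ : FreeSquare A →* Equiv.Perm (X × Y)}
    (h1 : ∀ g p, (ρ g p).1 = g • p.1)
    (h2 : ∀ i a x y y', y ≤ y' → (ρ (inj i a) (x, y)).2 ≤ (ρ (inj i a) (x, y')).2) :
    ∀ g x y y', y ≤ y' → (ρ g (x, y)).2 ≤ (ρ g (x, y')).2 := by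
  intro g
  induction g using Monoid.CoprodI.induction_on with
  | one => intro x y y' h; simpa using h
  | of i a => exact h2 i a
  | mul g h hg hh =>
    intro x y y' hy
    rw [map_mul, Equiv.Perm.mul_apply, Equiv.Perm.mul_apply]
    have := hg (h • x) _ _ (hh x y y' hy)
    rwa [← h1 h (x, y), Prod.mk.eta, h1 h (x, y), ← h1 h (x, y'), Prod.mk.eta] at this

end Skew

section Section

variable {G : Type*} [Group G] {X Y : Type*} [MulAction G X] [LinearOrder Y]

theorem exists_invariant_set {Q : Submonoid G} {w : G} (hQ : Q.IsMinimalTotal w) {x₀ : X}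
    (hx₀ : MulAction.stabilizer G x₀ = Q.unitSubgroup) {ρ : G →* Equiv.Perm (X × Y)}
    (h1 : ∀ g p, (ρ g p).1 = g • p.1)
    (h2 : ∀ g x y y', y ≤ y' → (ρ g (x, y)).2 ≤ (ρ g (x, y')).2)
    {I : Set Y} (hI : IsLowerSet I) (hwI : ∀ y, (ρ w (x₀, y)).2 ∈ I ↔ y ∈ I) :
    ∃ S : Set (X × Y), (∀ g p, ρ g p ∈ S ↔ p ∈ S) ∧ (∀ y, (x₀, y) ∈ S ↔ y ∈ I) ∧
      ∀ x y y', y ≤ y' → (x, y') ∈ S → (x, y) ∈ S := by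
  have hfix : ∀ g ∈ Q.unitSubgroup, ∀ y, ρ g (x₀, y) = (x₀, (ρ g (x₀, y)).2) := by
    intro g hg y
    rw [← hx₀] at hg
    refine Prod.ext ?_ rfl
    rw [h1]
    exact hg
  have hinv : ∀ g ∈ Q.unitSubgroup, ∀ y, (ρ g (x₀, (ρ g⁻¹ (x₀, y)).2)).2 = y := by
    intro g hg y
    rw [← hfix g⁻¹ (inv_mem hg), ← Equiv.Perm.mul_apply, ← map_mul, mul_inv_cancel, map_one]
    rfl
  let R : Submonoid G :=
    { carrier := {g | g ∈ Q.unitSubgroup ∧ ∀ y ∈ I, (ρ g (x₀, y)).2 ∈ I}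
      one_mem' := ⟨one_mem _, fun y hy => by simpa using hy⟩
      mul_mem' := by
        rintro a b ⟨ha, ha'⟩ ⟨hb, hb'⟩
        refine ⟨mul_mem ha hb, fun y hy => ?_⟩
        rw [map_mul, Equiv.Perm.mul_apply, hfix b hb]
        exact ha' _ (hb' _ hy) }
  have hR : ∀ g ∈ Q.unitSubgroup, g ∈ R := by
    apply hQ.le_of_total R (fun g hg => hg.1)
    · intro g hg
      by_contra! h
      obtain ⟨h3, h4⟩ := h
      obtain ⟨y, hy, hy'⟩ : ∃ y ∈ I, (ρ g (x₀, y)).2 ∉ I := by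
        by_contra! h; exact h3 ⟨hg, h⟩
      obtain ⟨u, hu, hu'⟩ : ∃ y ∈ I, (ρ g⁻¹ (x₀, y)).2 ∉ I := by
        by_contra! h; exact h4 ⟨inv_mem hg, h⟩
      have hlt : y ≤ (ρ g⁻¹ (x₀, u)).2 := by
        by_contra! h
        exact hu' (hI h.le hy)
      have := h2 g x₀ _ _ hlt
      rw [hinv g hg] at this
      exact hy' (hI this hu)
    · exact ⟨hQ.mem, fun y hy => (hwI y).2 hy⟩
    · refine ⟨inv_mem hQ.mem, fun y hy => ?_⟩
      rw [← hwI, hinv w hQ.mem]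
      exact hy
  refine ⟨{p | ∃ g : G, ∃ y ∈ I, ρ g (x₀, y) = p}, ?_, ?_, ?_⟩
  · have key : ∀ g p, (∃ h : G, ∃ y ∈ I, ρ h (x₀, y) = p) →
        ∃ h : G, ∃ y ∈ I, ρ h (x₀, y) = ρ g p := by
      rintro g p ⟨h, y, hy, rfl⟩
      exact ⟨g * h, y, hy, by rw [map_mul, Equiv.Perm.mul_apply]⟩
    intro g p
    refine ⟨fun h => ?_, fun h => key g p h⟩
    have := key g⁻¹ _ h
    rwa [← Equiv.Perm.mul_apply, ← map_mul, inv_mul_cancel, map_one] at this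
  · intro y
    constructor
    · rintro ⟨g, u, hu, hgu⟩
      have hg : g ∈ Q.unitSubgroup := by
        rw [← hx₀, MulAction.mem_stabilizer_iff]
        rw [← h1 g (x₀, u), hgu]
      have := (hR g hg).2 u hu
      rwa [hgu] at this
    · intro hy
      exact ⟨1, y, hy, by simp⟩
  · rintro x y y' hyy ⟨g, u, hu, hgu⟩
    have e : ρ g⁻¹ (x, y') = (x₀, u) := by
      rw [← hgu, ← Equiv.Perm.mul_apply, ← map_mul, inv_mul_cancel, map_one]; rfl
    have h3 := h2 g⁻¹ x _ _ hyy
    rw [e] at h3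
    have h4 : (ρ g⁻¹ (x, y)).1 = x₀ := by
      have := congrArg Prod.fst e
      rw [h1] at this ⊢
      exact this
    refine ⟨g, (ρ g⁻¹ (x, y)).2, hI h3 hu, ?_⟩
    rw [← h4, Prod.mk.eta, ← Equiv.Perm.mul_apply, ← map_mul, mul_inv_cancel, map_one]
    rfl

/-- An order automorphism moving two points in opposite directions fixes a cut between them. -/
theorem exists_fixed_lowerSet (f : Y ≃o Y) {u v : Y} (huv : u < v)
    (h : u < f u ∧ f v < v ∨ f u < u ∧ v < f v) :
    ∃ I : Set Y, IsLowerSet I ∧ (∀ y, f y ∈ I ↔ y ∈ I) ∧ u ∈ I ∧ v ∉ I := by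
  have main : ∀ f : Y ≃o Y, u < f u → f v < v →
      ∃ I : Set Y, IsLowerSet I ∧ (∀ y, f y ∈ I ↔ y ∈ I) ∧ u ∈ I ∧ v ∉ I := by
    intro f hu hv
    have hlt : ∀ n : ℕ, (f ^ n) u < v := by
      intro n
      induction n with
      | zero => simpa using huv
      | succ n ih =>
        rw [pow_succ', RelIso.mul_apply]
        exact (f.lt_iff_lt.2 ih).trans hv
    refine ⟨{y | ∃ n : ℕ, y ≤ (f ^ n) u}, ?_, ?_, ⟨0, le_rfl⟩, ?_⟩
    · rintro a b hba ⟨n, hn⟩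
      exact ⟨n, hba.trans hn⟩
    · intro y
      constructor
      · rintro ⟨n, hn⟩
        refine ⟨n, ?_⟩
        rw [← f.le_iff_le]
        refine hn.trans ?_
        rw [← RelIso.mul_apply, ← pow_succ', pow_succ, RelIso.mul_apply]
        exact (f ^ n).monotone hu.le
      · rintro ⟨n, hn⟩
        refine ⟨n + 1, ?_⟩
        rw [pow_succ', RelIso.mul_apply]
        exact f.monotone hn
    · rintro ⟨n, hn⟩
      exact absurd hn (hlt n).not_ge
  rcases h with ⟨h1, h2⟩ | ⟨h1, h2⟩
  · exact main f h1 h2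
  · obtain ⟨I, hI, hf, hu, hv⟩ := main f.symm (by
      rw [← f.lt_iff_lt, f.apply_symm_apply]; exact h1) (by
      rw [← f.lt_iff_lt, f.apply_symm_apply]; exact h2)
    refine ⟨I, hI, fun y => ?_, hu, hv⟩
    rw [← hf, f.symm_apply_apply]

end Section

section LeftOrdered

variable (D : Type) [Group D]

/-- Left multiplication on the first coordinate of a product. -/
def leftMulFst (β : Type) : D →* Equiv.Perm (D ×ₗ β) where
  toFun d := ⟨fun p => toLex (d * (ofLex p).1, (ofLex p).2),
    fun p => toLex (d⁻¹ * (ofLex p).1, (ofLex p).2), fun p => by simp, fun p => by simp⟩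
  map_one' := by ext1 p; simp
  map_mul' a b := by ext1 p; simp [mul_assoc]

theorem leftMulFst_apply {β : Type} (d e : D) (q : β) :
    leftMulFst D β d (toLex (e, q)) = toLex (d * e, q) := rfl

variable [LinearOrder D] [MulLeftMono D]

theorem exists_lt_mul_of_nontrivial [Nontrivial D] (d e : D) : ∃ t, e < t * d := by
  obtain ⟨u, hu⟩ : ∃ u : D, 1 < u := by
    obtain ⟨u, hu⟩ := exists_ne (1 : D)
    rcases lt_or_gt_of_ne hu with h | h
    · exact ⟨u⁻¹, by simpa using mul_lt_mul_right h u⁻¹⟩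
    · exact ⟨u, h⟩
  refine ⟨e * u * d⁻¹, ?_⟩
  rw [inv_mul_cancel_right]
  simpa using mul_lt_mul_right hu e

theorem exists_mul_lt_of_nontrivial [Nontrivial D] (d e : D) : ∃ t, t * d < e := by
  obtain ⟨t, ht⟩ := exists_lt_mul_of_nontrivial D e d
  exact ⟨t⁻¹, by simpa using mul_lt_mul_right ht t⁻¹⟩

theorem leftMulFst_monotone {β : Type} [Preorder β] (d : D) : Monotone (leftMulFst D β d) := by
  intro p q h
  obtain ⟨p, rfl⟩ := toLex.surjective p
  obtain ⟨q, rfl⟩ := toLex.surjective q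
  obtain ⟨a, b⟩ := p
  obtain ⟨a', b'⟩ := q
  rw [leftMulFst_apply, leftMulFst_apply, Prod.Lex.toLex_le_toLex]
  rw [Prod.Lex.toLex_le_toLex] at h
  exact h.imp (fun h => mul_lt_mul_right h d) (fun h => ⟨congrArg (fun t => d * t) h.1, h.2⟩)

/-- A countable left-ordered group acts on an interval moving a given cut. -/
theorem exists_interval_action [Nontrivial D] [Countable D] {Y : Type} [LinearOrder Y]
    [Countable Y] [DenselyOrdered Y] {a b u v : Y} {I : Set Y}
    (hI : IsLowerSet I) (hau : a < u) (hub : u < b) (hav : a < v) (hvb : v < b) (hu : u ∈ I)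
    (hv : v ∉ I) :
    ∃ ρ : D →* Equiv.Perm Y, (∀ d, Monotone (ρ d)) ∧ (∀ d y, y ∉ Set.Ioo a b → ρ d y = y) ∧
      ∃ d y, ¬ (ρ d y ∈ I ↔ y ∈ I) := by
  classical
  have : Countable (D ×ₗ ℚ) := inferInstanceAs (Countable (D × ℚ))
  have : Nonempty (Set.Ioo a b) := ⟨⟨u, hau, hub⟩⟩
  obtain ⟨θ⟩ := Order.iso_of_countable_dense (D ×ₗ ℚ) (Set.Ioo a b)
  let ρ : D →* Equiv.Perm Y := Equiv.Perm.ofSubtype.comp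
    ((Equiv.permCongrHom θ.toEquiv).toMonoidHom.comp (leftMulFst D ℚ))
  have hin : ∀ d y (hy : y ∈ Set.Ioo a b), ρ d y = θ (leftMulFst D ℚ d (θ.symm ⟨y, hy⟩)) :=
    fun d y hy => Equiv.Perm.ofSubtype_apply_of_mem _ hy
  have hout : ∀ d y, y ∉ Set.Ioo a b → ρ d y = y :=
    fun d y hy => Equiv.Perm.ofSubtype_apply_of_not_mem _ hy
  refine ⟨ρ, fun d x y hxy => ?_, hout, ?_⟩
  · by_cases hx : x ∈ Set.Ioo a b
    · by_cases hy : y ∈ Set.Ioo a b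
      · rw [hin d x hx, hin d y hy]
        exact θ.monotone (leftMulFst_monotone D d (θ.symm.monotone hxy))
      · rw [hin d x hx, hout d y hy]
        have : b ≤ y := by
          by_contra! h
          exact hy ⟨hx.1.trans_le hxy, h⟩
        exact (Subtype.prop (θ _)).2.le.trans this
    · by_cases hy : y ∈ Set.Ioo a b
      · rw [hin d y hy, hout d x hx]
        have : x ≤ a := by
          by_contra! h
          exact hx ⟨h, hxy.trans_lt hy.2⟩
        exact this.trans (Subtype.prop (θ _)).1.le
      · rwa [hout d x hx, hout d y hy]
  · obtain ⟨⟨d, q⟩, hp⟩ := toLex.surjective (θ.symm ⟨u, hau, hub⟩)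
    obtain ⟨⟨e, r⟩, hq⟩ := toLex.surjective (θ.symm ⟨v, hav, hvb⟩)
    obtain ⟨t, ht⟩ := exists_lt_mul_of_nontrivial D d e
    refine ⟨t, u, fun h => hv (hI ?_ (h.2 hu))⟩
    rw [hin t u ⟨hau, hub⟩, ← hp, leftMulFst_apply]
    have : θ.symm ⟨v, hav, hvb⟩ ≤ toLex (t * d, q) := by
      rw [← hq, Prod.Lex.toLex_le_toLex]
      exact Or.inl ht
    have := θ.monotone this
    rwa [OrderIso.apply_symm_apply, ← Subtype.coe_le_coe] at this

/-- Two copies of `D`, the second one reversed, glued along a cut that is the only proper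
`D`-invariant one. -/
theorem exists_doubled_line [Nontrivial D] [Countable D] :
    ∃ (Y : Type) (_ : LinearOrder Y) (_ : Countable Y) (_ : DenselyOrdered Y)
      (m : D →* Equiv.Perm Y) (lo hi : D → Y) (I : Set Y),
      (∀ d, Monotone (m d)) ∧ (∀ d e, m d (lo e) = lo (d * e)) ∧ (∀ d e, m d (hi e) = hi (d * e)) ∧
      StrictMono lo ∧ StrictAnti hi ∧ (∀ d e, lo d < hi e) ∧ IsLowerSet I ∧ (∀ d, lo d ∈ I) ∧
      (∀ d, hi d ∉ I) ∧ (∀ d y, m d y ∈ I ↔ y ∈ I) ∧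
      ∀ U : Set Y, IsLowerSet U → (∀ d, ∀ y ∈ U, m d y ∈ U) → U.Nonempty → U ≠ Set.univ →
        U = I := by
  have hc : Countable (D ×ₗ ℚ) := inferInstanceAs (Countable (D × ℚ))
  have hc' : Countable (D ×ₗ ℚ)ᵒᵈ := inferInstanceAs (Countable (D × ℚ))
  let Y := (D ×ₗ ℚ) ⊕ₗ (D ×ₗ ℚ)ᵒᵈ
  have hY : Countable Y := inferInstanceAs (Countable ((D ×ₗ ℚ) ⊕ (D ×ₗ ℚ)ᵒᵈ))
  let lo' : D → ℚ → Y := fun d q => toLex (Sum.inl (toLex (d, q)))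
  let hi' : D → ℚ → Y := fun d q => toLex (Sum.inr (OrderDual.toDual (toLex (d, q))))
  have hcase : ∀ y : Y, (∃ d q, y = lo' d q) ∨ ∃ d q, y = hi' d q := by
    intro y
    rcases h : ofLex y with p | p
    · exact Or.inl ⟨(ofLex p).1, (ofLex p).2, h⟩
    · exact Or.inr ⟨(ofLex (OrderDual.ofDual p)).1, (ofLex (OrderDual.ofDual p)).2, h⟩
  have hll : ∀ d q e r, lo' d q ≤ lo' e r ↔ d < e ∨ d = e ∧ q ≤ r := by
    intro d q e r
    exact Sum.Lex.inl_le_inl_iff.trans Prod.Lex.toLex_le_toLex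
  have hhh : ∀ d q e r, hi' e r ≤ hi' d q ↔ d < e ∨ d = e ∧ q ≤ r := by
    intro d q e r
    exact Sum.Lex.inr_le_inr_iff.trans (OrderDual.toDual_le_toDual.trans Prod.Lex.toLex_le_toLex)
  have hlh : ∀ d q e r, lo' d q < hi' e r := fun d q e r => Sum.Lex.inl_lt_inr _ _
  let m : D →* Equiv.Perm Y :=
    { toFun := fun d => Equiv.sumCongr (leftMulFst D ℚ d) (leftMulFst D ℚ d)
      map_one' := by ext1 y; rcases y with y | y <;> simp only [map_one] <;> rfl
      map_mul' := fun a b => by ext1 y; rcases y with y | y <;> simp only [map_mul] <;> rfl }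
  have hml : ∀ d e q, m d (lo' e q) = lo' (d * e) q := fun d e q => rfl
  have hmh : ∀ d e q, m d (hi' e q) = hi' (d * e) q := fun d e q => rfl
  have mlt : ∀ {d e : D} (c : D), d < e → c * d < c * e := fun c h => mul_lt_mul_right h c
  refine ⟨Y, inferInstance, hY, inferInstance, m, fun d => lo' d 0, fun d => hi' d 0,
    {y | ∃ d q, y = lo' d q}, ?_, fun d e => hml d e 0, fun d e => hmh d e 0, ?_, ?_,
    fun d e => hlh d 0 e 0, ?_, fun d => ⟨d, 0, rfl⟩, ?_, ?_, ?_⟩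
  · intro d x y hxy
    rcases hcase x with ⟨e, q, rfl⟩ | ⟨e, q, rfl⟩ <;> rcases hcase y with ⟨f, r, rfl⟩ | ⟨f, r, rfl⟩
    · rw [hml, hml, hll]
      rw [hll] at hxy
      exact hxy.imp (mlt d) fun h => ⟨congrArg _ h.1, h.2⟩
    · rw [hml, hmh]; exact (hlh _ _ _ _).le
    · exact absurd hxy (hlh _ _ _ _).not_ge
    · rw [hmh, hmh, hhh]
      rw [hhh] at hxy
      exact hxy.imp (mlt d) fun h => ⟨congrArg _ h.1, h.2⟩
  · refine Monotone.strictMono_of_injective (fun d e h => ?_) (fun d e h => ?_)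
    · rcases h.lt_or_eq with h | rfl
      · exact (hll _ _ _ _).2 (Or.inl h)
      · exact le_rfl
    · have h1 := (hll _ _ _ _).1 (le_of_eq h)
      have h2 := (hll _ _ _ _).1 (ge_of_eq h)
      rcases h1 with h1 | h1
      · rcases h2 with h2 | h2
        · exact absurd h1 h2.not_gt
        · exact h2.1.symm
      · exact h1.1
  · intro d e h
    refine lt_of_le_not_ge ((hhh _ _ _ _).2 (Or.inl h)) fun h' => ?_
    rcases (hhh _ _ _ _).1 h' with h1 | h1
    · exact absurd h h1.not_gt
    · exact h.ne' h1.1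
  · rintro x y hyx ⟨d, q, rfl⟩
    rcases hcase y with h | ⟨f, r, rfl⟩
    · exact h
    · exact absurd hyx (hlh _ _ _ _).not_ge
  · rintro d ⟨e, q, h⟩
    exact absurd h.le (hlh _ _ _ _).not_ge
  · intro d y
    rcases hcase y with ⟨e, q, rfl⟩ | ⟨e, q, rfl⟩
    · exact iff_of_true ⟨_, _, hml d e q⟩ ⟨e, q, rfl⟩
    · refine iff_of_false ?_ ?_
      · rintro ⟨f, r, h⟩
        rw [hmh] at h
        exact absurd h.le (hlh _ _ _ _).not_ge
      · rintro ⟨f, r, h⟩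
        exact absurd h.le (hlh _ _ _ _).not_ge
  · intro U hU hinv hne huniv
    have hnohi : ∀ d q, hi' d q ∉ U := by
      intro d q hd
      apply huniv
      have h1 : ∀ e r, hi' e r ∈ U := by
        intro e r
        obtain ⟨t, ht⟩ := exists_mul_lt_of_nontrivial D d e
        exact hU ((hhh _ _ _ _).2 (Or.inl ht)) (hmh t d q ▸ hinv t _ hd)
      ext y
      refine iff_of_true ?_ trivial
      rcases hcase y with ⟨e, q, rfl⟩ | ⟨e, q, rfl⟩
      · exact hU (hlh e q 1 0).le (h1 1 0)
      · exact h1 e q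
    obtain ⟨y, hy⟩ := hne
    rcases hcase y with ⟨d, q, rfl⟩ | ⟨e, q, rfl⟩
    · ext z
      rcases hcase z with ⟨e, r, rfl⟩ | ⟨e, r, rfl⟩
      · refine iff_of_true ?_ ⟨e, r, rfl⟩
        obtain ⟨t, ht⟩ := exists_lt_mul_of_nontrivial D d e
        exact hU ((hll _ _ _ _).2 (Or.inl ht)) (hml t d q ▸ hinv t _ hy)
      · refine iff_of_false (hnohi e r) ?_
        rintro ⟨f, s, h⟩
        exact absurd h.le (hlh _ _ _ _).not_ge
    · exact absurd hy (hnohi e q)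

end LeftOrdered

/-- The cocycle describing the action on an orbit in terms of the stabilizer of a point. -/
theorem exists_orbit_cocycle {A G X : Type*} [Group A] [Group G] [MulAction G X] (φ : A →* G)
    (x₁ : X) : ∃ δ : A → X → (MulAction.stabilizer G x₁).comap φ,
      (∀ a b x, δ (a * b) x = δ a (φ b • x) * δ b x) ∧
      (∀ a x, (¬ ∃ b, x = φ b • x₁) → δ a x = 1) ∧ ∀ d, δ d.1 x₁ = d := by
  classical
  obtain ⟨σ, hσ, hσ1⟩ : ∃ σ : X → A, (∀ x, (∃ b, x = φ b • x₁) → φ (σ x) • x₁ = x) ∧ σ x₁ = 1 := by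
    refine ⟨fun x => if h : ∃ b, x = φ b • x₁ then if x = x₁ then 1 else h.choose else 1, ?_, ?_⟩
    · intro x h
      simp only [h, dite_true]
      split_ifs with h'
      · rw [map_one, one_smul, h']
      · exact h.choose_spec.symm
    · simp
  have hO : ∀ a x, (∃ b, x = φ b • x₁) → ∃ b, φ a • x = φ b • x₁ := by
    rintro a x ⟨b, rfl⟩
    exact ⟨a * b, by rw [map_mul, mul_smul]⟩
  have hO' : ∀ a x, (∃ b, φ a • x = φ b • x₁) → ∃ b, x = φ b • x₁ := by
    rintro a x ⟨b, h⟩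
    exact ⟨a⁻¹ * b, by rw [map_mul, mul_smul, ← h, map_inv, inv_smul_smul]⟩
  have hmem : ∀ a x, (∃ b, x = φ b • x₁) →
      (σ (φ a • x))⁻¹ * a * σ x ∈ (MulAction.stabilizer G x₁).comap φ := by
    intro a x hx
    rw [Subgroup.mem_comap, MulAction.mem_stabilizer_iff, map_mul, map_mul, mul_smul, mul_smul,
      hσ x hx, map_inv, inv_smul_eq_iff, hσ _ (hO a x hx)]
  refine ⟨fun a x => if h : ∃ b, x = φ b • x₁ then ⟨_, hmem a x h⟩ else 1, ?_, ?_, ?_⟩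
  · intro a b x
    by_cases hx : ∃ b, x = φ b • x₁
    · have hx' := hO b x hx
      dsimp only
      rw [dif_pos hx, dif_pos hx, dif_pos hx']
      apply Subtype.ext
      simp only [map_mul, mul_smul, Subgroup.coe_mul]
      group
    · have hx' : ¬ ∃ c, φ b • x = φ c • x₁ := fun h => hx (hO' b x h)
      dsimp only
      rw [dif_neg hx, dif_neg hx, dif_neg hx', one_mul]
  · intro a x hx
    exact dif_neg hx
  · rintro ⟨d, hd⟩
    have hx : ∃ b, x₁ = φ b • x₁ := ⟨1, by rw [map_one, one_smul]⟩
    dsimp only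
    rw [dif_pos hx]
    apply Subtype.ext
    have hd' : φ d • x₁ = x₁ := hd
    simp only [hd', hσ1]
    group

open FreeSquare

section Flip

variable {A : Type} [Group A] [LinearOrder A] [MulLeftMono A] [Countable A]
variable {X : Type} [MulAction (FreeSquare A) X] [MulAction.IsPretransitive (FreeSquare A) X]

instance Subgroup.instMulLeftMono (H : Subgroup A) : MulLeftMono H :=
  ⟨fun c _ _ h => mul_le_mul_right (α := A) h (c : A)⟩

open scoped Pointwise in
theorem exists_flip {Q : Submonoid (FreeSquare A)} {w : FreeSquare A} (hQ : Q.IsMinimalTotal w)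
    {x₀ : X} (hx₀ : MulAction.stabilizer (FreeSquare A) x₀ = Q.unitSubgroup) {i₀ : Bool} {x₁ : X}
    (hD : Nontrivial ((MulAction.stabilizer (FreeSquare A) x₁).comap (inj (A := A) i₀)))
    {D' : Type} [Group D'] [LinearOrder D'] [MulLeftMono D'] [Countable D'] [Nontrivial D']
    (δ' : Bool → A → X → D')
    (hδ' : ∀ (i : Bool) (a b : A) (x : X), δ' i (a * b) x = δ' i a (inj i b • x) * δ' i b x)
    (hδ'O : ∀ a b : A, δ' i₀ a (inj i₀ b • x₁) = 1) :
    ∃ (C : Type) (_ : MulAction D' C) (s : X → C) (I : C), (∀ b : A, s (inj i₀ b • x₁) = I) ∧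
      (∀ (i : Bool) (a : A) (x : X), s (inj i a • x) = δ' i a x • s x) ∧ ∃ d : D', d • I ≠ I := by
  classical
  set D := (MulAction.stabilizer (FreeSquare A) x₁).comap (inj (A := A) i₀) with hDdef
  obtain ⟨Y, _, _, _, m, lo, hi, I, hm, hmlo, hmhi, hlo, hhi, hlohi, hI, hloI, hhiI, hmI, huniq⟩ :=
    exists_doubled_line D
  obtain ⟨δ, hδ, hδO, hδx⟩ := exists_orbit_cocycle (inj (A := A) i₀) x₁
  let δf : Bool → A → X → D := fun i a x => if i = i₀ then δ a x else 1
  have hδf : ∀ (i : Bool) (a b : A) (x : X), δf i (a * b) x = δf i a (inj i b • x) * δf i b x := by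
    intro i a b x
    by_cases h : i = i₀
    · subst h; simp [δf, hδ]
    · simp [δf, h]
  -- the action on `X × D`
  obtain ⟨ρD, hρD, hρD1⟩ := exists_skew_action (X := X) (fun i a x => Equiv.mulLeft (δf i a x))
    (fun i a b x => by rw [hδf]; ext1 d; simp)
  have hρD2 := skew_action_monotone hρD1 (fun i a x y y' h => by
    rw [hρD, hρD]; exact mul_le_mul_right h _)
  have hpair : ∀ {Z : Type} {ρ : FreeSquare A →* Equiv.Perm (X × Z)},
      (∀ g p, (ρ g p).1 = g • p.1) → ∀ g x z, ρ g (x, z) = (g • x, (ρ g (x, z)).2) := by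
    intro Z ρ h g x z
    exact Prod.ext (h g (x, z)) rfl
  have hcancel : ∀ {Z : Type} (ρ : FreeSquare A →* Equiv.Perm (X × Z)) g p, ρ g (ρ g⁻¹ p) = p := by
    intro Z ρ g p
    rw [← Equiv.Perm.mul_apply, ← map_mul, mul_inv_cancel, map_one]; rfl
  have hright : ∀ g x d e, (ρD g (x, d * e)).2 = (ρD g (x, d)).2 * e := by
    intro g
    induction g using Monoid.CoprodI.induction_on with
    | one => intro x d e; simp
    | of i a => intro x d e; rw [hρD, hρD]; exact (mul_assoc _ _ _).symm
    | mul g h hg hh =>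
      intro x d e
      rw [map_mul, Equiv.Perm.mul_apply, Equiv.Perm.mul_apply, hpair hρD1 h x (d * e), hh, hg,
        ← hpair hρD1 h x d]
  have hwx : w • x₀ = x₀ := by
    have := hQ.mem
    rwa [← hx₀, MulAction.mem_stabilizer_iff] at this
  have hwx' : w⁻¹ • x₀ = x₀ := by rw [inv_smul_eq_iff, hwx]
  have hκ : (ρD w (x₀, 1)).2 ≠ 1 := by
    intro h
    have h1 : ρD w (x₀, 1) = (x₀, 1) := by rw [hpair hρD1, h, hwx]
    obtain ⟨S, hS1, hS2, -⟩ := exists_invariant_set hQ hx₀ hρD1 hρD2 (isLowerSet_Iic (1 : D)) (by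
      intro y
      have : (ρD w (x₀, y)).2 = y := by
        have := hright w x₀ 1 y
        rwa [one_mul, h, one_mul] at this
      rw [this])
    obtain ⟨g, hg⟩ := MulAction.exists_smul_eq (FreeSquare A) x₀ x₁
    obtain ⟨u, hu⟩ := exists_lt_mul_of_nontrivial D 1 1
    rw [mul_one] at hu
    have h2 : ρD g (x₀, 1) ∈ S := (hS1 g _).2 ((hS2 1).2 le_rfl)
    have h3 : ρD g (x₀, u) ∉ S := fun h => hu.not_ge ((hS2 u).1 ((hS1 g _).1 h))
    rw [hpair hρD1, hg] at h2 h3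
    generalize (ρD g (x₀, 1)).2 = d at h2
    generalize (ρD g (x₀, u)).2 = e at h3
    apply h3
    have h4 := (hS1 (inj i₀ (e * d⁻¹ : D)) (x₁, d)).2 h2
    rw [hρD] at h4
    have h5 : inj i₀ ((e * d⁻¹ : D) : A) • x₁ = x₁ := (e * d⁻¹).2
    rw [h5] at h4
    have h6 : δf i₀ ((e * d⁻¹ : D) : A) x₁ = e * d⁻¹ := by simp only [δf, if_true]; exact hδx _
    rw [h6] at h4
    simpa using h4
  -- far from the cut, the perturbed action agrees with the original one
  have hfar : ∀ g x d, ∃ c₁, ∀ c₀ ≥ c₁, ∀ ρ' : D' →* Equiv.Perm Y,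
      (∀ t y, y ∉ Set.Ioo (lo c₀) (hi c₀) → ρ' t y = y) → ∀ ρ : FreeSquare A →* Equiv.Perm (X × Y),
      (∀ (i : Bool) (a : A) (x : X) (y : Y),
        ρ (inj i a) (x, y) = (inj i a • x, m (δf i a x) (ρ' (δ' i a x) y))) →
      ρ g (x, lo d) = ((ρD g (x, d)).1, lo (ρD g (x, d)).2) ∧
      ρ g (x, hi d) = ((ρD g (x, d)).1, hi (ρD g (x, d)).2) := by
    intro g
    induction g using Monoid.CoprodI.induction_on with
    | one => intro x d; exact ⟨1, fun c₀ _ ρ' _ ρ _ => by simp⟩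
    | of i a =>
      intro x d
      refine ⟨d, fun c₀ hc₀ ρ' hρ' ρ hρ => ?_⟩
      rw [hρ, hρ, hρD, hρ' _ (lo d) fun h => (hlo.monotone hc₀).not_gt h.1,
        hρ' _ (hi d) fun h => (hhi.antitone hc₀).not_gt h.2, hmlo, hmhi]
      exact ⟨rfl, rfl⟩
    | mul g h hg hh =>
      intro x d
      obtain ⟨c₁, hc₁⟩ := hh x d
      obtain ⟨c₂, hc₂⟩ := hg (ρD h (x, d)).1 (ρD h (x, d)).2
      refine ⟨max c₁ c₂, fun c₀ hc₀ ρ' hρ' ρ hρ => ?_⟩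
      obtain ⟨h1, h2⟩ := hc₁ c₀ (le_of_max_le_left hc₀) ρ' hρ' ρ hρ
      obtain ⟨h3, h4⟩ := hc₂ c₀ (le_of_max_le_right hc₀) ρ' hρ' ρ hρ
      rw [map_mul, map_mul, Equiv.Perm.mul_apply, Equiv.Perm.mul_apply, Equiv.Perm.mul_apply, h1,
        h2, h3, h4]
      exact ⟨rfl, rfl⟩
  obtain ⟨c₀, hc₀⟩ := hfar w x₀ 1
  obtain ⟨c₂, hc₂⟩ := exists_lt_mul_of_nontrivial D 1 c₀
  rw [mul_one] at hc₂
  obtain ⟨ρ', hρ'mono, hρ'fix, t, y₀, hty⟩ := exists_interval_action D' hI (hlo hc₂)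
    (hlohi c₂ c₀) (hlohi c₀ c₂) (hhi hc₂) (hloI c₂) (hhiI c₂)
  obtain ⟨ρ, hρ, hρ1⟩ := exists_skew_action (X := X) (fun i a x => m (δf i a x) * ρ' (δ' i a x))
    (fun i a b x => by
      rw [hδf, hδ', map_mul, map_mul]
      by_cases h : i = i₀ ∧ ∃ c : A, x = inj i₀ c • x₁
      · obtain ⟨rfl, c, rfl⟩ := h
        have h1 := hδ'O b c
        have h2 := hδ'O a (b * c)
        rw [map_mul, mul_smul] at h2
        rw [h1, h2, map_one, mul_one, mul_one, mul_one, mul_one]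
      · have h1 : δf i b x = 1 := by
          by_cases h' : i = i₀
          · subst h'
            simp only [δf, if_true]
            exact hδO b x fun hx => h ⟨rfl, hx⟩
          · simp [δf, h']
        have h2 : δf i a (inj i b • x) = 1 := by
          by_cases h' : i = i₀
          · subst h'
            simp only [δf, if_true]
            refine hδO a _ ?_
            rintro ⟨c, hc⟩
            refine h ⟨rfl, b⁻¹ * c, ?_⟩
            rw [map_mul, mul_smul, ← hc, map_inv, inv_smul_smul]
          · simp [δf, h']
        rw [h1, h2, map_one, one_mul, one_mul, one_mul, one_mul])
  have hρ2 := skew_action_monotone hρ1 (fun i a x y y' h => by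
    rw [hρ, hρ]; exact hm _ (hρ'mono _ h))
  obtain ⟨hwlo, hwhi⟩ := hc₀ c₀ le_rfl ρ' hρ'fix ρ hρ
  let f : Y ≃o Y :=
    { toFun := fun y => (ρ w (x₀, y)).2
      invFun := fun y => (ρ w⁻¹ (x₀, y)).2
      left_inv := fun y => by
        have := hcancel ρ w⁻¹ (x₀, y)
        rw [inv_inv, hpair hρ1 w, hwx] at this
        exact congrArg Prod.snd this
      right_inv := fun y => by
        have := hcancel ρ w (x₀, y)
        rw [hpair hρ1 w⁻¹, hwx'] at this
        exact congrArg Prod.snd this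
      map_rel_iff' := fun {y y'} => by
        refine ⟨fun h => ?_, hρ2 w x₀ y y'⟩
        by_contra! h'
        have h2 := hρ2 w x₀ _ _ h'.le
        have h3 : ρ w (x₀, y) = ρ w (x₀, y') := by
          rw [hpair hρ1 w x₀ y, hpair hρ1 w x₀ y']
          exact Prod.ext rfl (le_antisymm h h2)
        have h4 := congrArg Prod.snd ((ρ w).injective h3)
        exact h'.ne' h4 }
  have hflo : f (lo 1) = lo (ρD w (x₀, 1)).2 := congrArg Prod.snd hwlo
  have hfhi : f (hi 1) = hi (ρD w (x₀, 1)).2 := congrArg Prod.snd hwhi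
  obtain ⟨J, hJ, hfJ, hloJ, hhiJ⟩ := exists_fixed_lowerSet f (hlohi 1 1) (by
    rw [hflo, hfhi]
    rcases lt_or_gt_of_ne hκ with h | h
    · exact Or.inr ⟨hlo h, hhi h⟩
    · exact Or.inl ⟨hlo h, hhi h⟩)
  obtain ⟨S, hS1, hS2, hS3⟩ := exists_invariant_set hQ hx₀ hρ1 hρ2 hJ hfJ
  have hne : ∀ x, ∃ y, (x, y) ∈ S := by
    intro x
    obtain ⟨g, rfl⟩ := MulAction.exists_smul_eq (FreeSquare A) x₀ x
    refine ⟨(ρ g (x₀, lo 1)).2, ?_⟩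
    rw [← hpair hρ1, hS1, hS2]
    exact hloJ
  have hne' : ∀ x, ∃ y, (x, y) ∉ S := by
    intro x
    obtain ⟨g, rfl⟩ := MulAction.exists_smul_eq (FreeSquare A) x₀ x
    refine ⟨(ρ g (x₀, hi 1)).2, ?_⟩
    rw [← hpair hρ1, hS1, hS2]
    exact hhiJ
  have hstep : ∀ (i : Bool) (a : A) (x : X) (y : Y),
      (inj i a • x, m (δf i a x) (ρ' (δ' i a x) y)) ∈ S ↔ (x, y) ∈ S := by
    intro i a x y
    have := hS1 (inj i a) (x, y)
    rw [hρ] at this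
    exact this
  have hx₁ : ∀ y, (x₁, y) ∈ S ↔ y ∈ I := by
    have : {y | (x₁, y) ∈ S} = I := by
      apply huniq
      · intro y y' h
        exact hS3 x₁ _ _ h
      · intro d y hy
        have h1 := (hstep i₀ d x₁ y).2 hy
        have h2 : inj i₀ (d : A) • x₁ = x₁ := d.2
        have h3 : δf i₀ d x₁ = d := by simp only [δf, if_true]; exact hδx d
        have h4 : δ' i₀ d x₁ = 1 := by simpa using hδ'O d 1
        rw [h2, h3, h4, map_one] at h1
        exact h1
      · exact hne x₁
      · obtain ⟨y, hy⟩ := hne' x₁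
        intro h
        exact hy (h.symm ▸ Set.mem_univ y : y ∈ {y | (x₁, y) ∈ S})
    intro y
    rw [← this]; rfl
  let _ : MulAction D' (Set Y) := MulAction.compHom (Set Y) ρ'
  have hsmul : ∀ (d : D') (U : Set Y) (y : Y), ρ' d y ∈ d • U ↔ y ∈ U := by
    intro d U y
    exact Set.smul_mem_smul_set_iff (a := ρ' d) (s := U) (x := y)
  have hOs : ∀ b : A, {y | (inj i₀ b • x₁, y) ∈ S} = I := by
    intro b
    ext y
    obtain ⟨z, rfl⟩ := (m (δf i₀ b x₁)).surjective y
    have h1 := hstep i₀ b x₁ z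
    have h4 : δ' i₀ b x₁ = 1 := by simpa using hδ'O b 1
    rw [h4, map_one, hx₁] at h1
    rw [hmI]
    exact h1
  refine ⟨Set Y, inferInstance, fun x => {y | (x, y) ∈ S}, I, hOs, ?_, t, ?_⟩
  · intro i a x
    by_cases h : i = i₀ ∧ ∃ c : A, x = inj i₀ c • x₁
    · obtain ⟨rfl, c, rfl⟩ := h
      have := hOs (a * c)
      rw [map_mul, mul_smul] at this
      dsimp only
      rw [this, hOs, hδ'O, one_smul]
    · have h1 : δf i a x = 1 := by
        by_cases h' : i = i₀
        · subst h'
          simp only [δf, if_true]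
          exact hδO a x fun hx => h ⟨rfl, hx⟩
        · simp [δf, h']
      ext y
      obtain ⟨z, rfl⟩ := (ρ' (δ' i a x)).surjective y
      rw [hsmul]
      have := hstep i a x z
      rw [h1, map_one] at this
      exact this
  · intro h
    apply hty
    have := hsmul t I y₀
    rwa [h] at this

end Flip

section Walls

variable {A : Type} [Group A]
variable {X : Type} [MulAction (FreeSquare A) X] [MulAction.IsPretransitive (FreeSquare A) X]

theorem FreeSquare.forall_of_invariant {p : X → Prop} {x : X} (hx : p x)
    (h : ∀ (i : Bool) (a : A) (x : X), p x → p (inj i a • x)) (y : X) : p y := by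
  obtain ⟨g, rfl⟩ := MulAction.exists_smul_eq (FreeSquare A) x y
  induction g using Monoid.CoprodI.induction_left with
  | one => rwa [one_smul]
  | mul a g hg =>
    rw [mul_smul]
    exact h _ _ _ hg

variable [LinearOrder A] [MulLeftMono A] [Countable A]

theorem factor_stabilizer_trivial {Q : Submonoid (FreeSquare A)} {w : FreeSquare A}
    (hQ : Q.IsMinimalTotal w) {x₀ : X}
    (hx₀ : MulAction.stabilizer (FreeSquare A) x₀ = Q.unitSubgroup) {i₀ : Bool} {x₁ : X}
    (hD : Nontrivial ((MulAction.stabilizer (FreeSquare A) x₁).comap (inj (A := A) i₀)))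
    {i : Bool} {x : X} {a : A} (ha : a ≠ 1) (hax : inj i a • x = x) :
    i = i₀ ∧ ∃ b : A, x = inj i₀ b • x₁ := by
  classical
  by_contra hne
  have : Nontrivial ((MulAction.stabilizer (FreeSquare A) x).comap (inj (A := A) i)) :=
    ⟨⟨a, hax⟩, 1, fun h => ha (congrArg Subtype.val h)⟩
  obtain ⟨δ, hδ, hδO, hδx⟩ := exists_orbit_cocycle (inj (A := A) i) x
  obtain ⟨C, _, s, I, hsI, hs, d, hd⟩ := exists_flip hQ hx₀ hD
    (fun j b y => if j = i then δ b y else 1) (by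
      intro j b c y
      by_cases h : j = i
      · subst h; simp [hδ]
      · simp [h]) (by
      intro b c
      by_cases h : i₀ = i
      · subst h
        simp only [if_true]
        refine hδO _ _ ?_
        rintro ⟨e, he⟩
        refine hne ⟨rfl, e⁻¹ * c, ?_⟩
        rw [map_mul, mul_smul, he, map_inv, inv_smul_smul]
      · simp [h])
  have key : ∀ c : A, s (inj i c • x) ≠ I := by
    intro c hc
    have h1 := hs i c⁻¹ (inj i c • x)
    rw [← mul_smul, ← map_mul, inv_mul_cancel, map_one, one_smul, hc] at h1
    simp only [if_true] at h1
    generalize δ c⁻¹ (inj i c • x) = u at h1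
    have h2 := hs i (u * d * u⁻¹ : _) x
    simp only [if_true, hδx] at h2
    have h3 : inj i ((u * d * u⁻¹ :
      (MulAction.stabilizer (FreeSquare A) x).comap (inj (A := A) i)) : A) • x = x :=
      (u * d * u⁻¹).2
    rw [h3, h1, mul_smul, mul_smul, inv_smul_smul, smul_left_cancel_iff] at h2
    exact hd h2.symm
  refine key 1 ?_
  rw [map_one, one_smul]
  refine FreeSquare.forall_of_invariant (A := A) (p := fun y => s y = I) (x := x₁) ?_ ?_ x
  · simpa using hsI 1
  · intro j b y hy
    rw [hs, hy]
    by_cases h : j = i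
    · subst h
      simp only [if_true]
      rw [hδO, one_smul]
      rintro ⟨c, rfl⟩
      exact key c hy
    · simp [h]

theorem exists_wall {Q : Submonoid (FreeSquare A)} {w : FreeSquare A}
    (hQ : Q.IsMinimalTotal w) {x₀ : X}
    (hx₀ : MulAction.stabilizer (FreeSquare A) x₀ = Q.unitSubgroup) {i₀ : Bool} {x₁ : X}
    (hD : Nontrivial ((MulAction.stabilizer (FreeSquare A) x₁).comap (inj (A := A) i₀)))
    (x₂ : X) :
    ∃ f : Bool → X → Prop, (∀ (i : Bool) (a : A) (x : X), f i (inj i a • x) ↔ f i x) ∧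
      (∀ i j x, x ≠ x₂ → (f i x ↔ f j x)) ∧ (∀ i, f i x₂ ↔ ¬ f (!i) x₂) ∧ f i₀ x₁ := by
  classical
  let τ : X → Multiplicative ℤ := fun x => if x = x₂ then Multiplicative.ofAdd 1 else 1
  obtain ⟨C, _, s, I, hsI, hs, d, hd⟩ := exists_flip hQ hx₀ hD
    (fun j b y => if j = i₀ then 1 else τ (inj j b • y) * (τ y)⁻¹) (by
      intro j b c y
      by_cases h : j = i₀
      · simp [h]
      · simp [h, mul_smul]) (by simp)
  have hx1 : s x₁ = I := by simpa using hsI 1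
  have hd' : (Multiplicative.ofAdd (1 : ℤ)) • I ≠ I := by
    intro h
    have : ∀ n : ℤ, (Multiplicative.ofAdd (1 : ℤ)) ^ n • I = I := by
      intro n
      have : Multiplicative.ofAdd (1 : ℤ) ∈ MulAction.stabilizer (Multiplicative ℤ) I := h
      exact Subgroup.zpow_mem _ this n
    refine hd ?_
    have h2 := this (Multiplicative.toAdd d)
    rwa [← ofAdd_zsmul, smul_eq_mul, mul_one, ofAdd_toAdd] at h2
  let f : Bool → X → Prop := fun i x => if i = i₀ then s x = I else (τ x)⁻¹ • s x = I
  have hf : ∀ (i : Bool) (a : A) (x : X), f i (inj i a • x) ↔ f i x := by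
    intro i a x
    by_cases h : i = i₀
    · simp [f, h, hs]
    · simp only [f, h, if_false, hs, mul_smul, inv_smul_smul]
  have hoff : ∀ i j x, x ≠ x₂ → (f i x ↔ f j x) := by
    intro i j x hx
    have : τ x = 1 := by simp [τ, hx]
    simp only [f, this, inv_one, one_smul, ite_self]
  have hne : ¬ (f i₀ x₂ ↔ f (!i₀) x₂) := by
    intro h
    have h1 : f i₀ x₂ := by
      refine FreeSquare.forall_of_invariant (A := A) (p := fun y => f i₀ y) (x := x₁) ?_ ?_ x₂
      · simp [f, hx1]
      · intro i a x hx
        have hall : ∀ i j x, f i x ↔ f j x := by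
          intro i j x
          by_cases hx : x = x₂
          · subst hx
            rcases Bool.eq_false_or_eq_true i with rfl | rfl <;>
            rcases Bool.eq_false_or_eq_true j with rfl | rfl <;>
            rcases Bool.eq_false_or_eq_true i₀ with rfl | rfl <;> simp_all
          · exact hoff i j x hx
        rw [hall i₀ i, hf, hall i i₀]
        exact hx
    have h2 := h.1 h1
    simp only [f, if_true] at h1
    simp [f, h1, τ] at h2
    rw [← ofAdd_neg, ofAdd_neg, inv_smul_eq_iff] at h2
    exact hd' h2.symm
  refine ⟨f, hf, hoff, ?_, by simp [f, hx1]⟩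
  intro i
  rcases Bool.eq_false_or_eq_true i with rfl | rfl <;>
  rcases Bool.eq_false_or_eq_true i₀ with rfl | rfl <;>
  simp only [Bool.not_true, Bool.not_false] at hne ⊢ <;> tauto

theorem no_periodic_walk {Q : Submonoid (FreeSquare A)} {w : FreeSquare A}
    (hQ : Q.IsMinimalTotal w) {x₀ : X}
    (hx₀ : MulAction.stabilizer (FreeSquare A) x₀ = Q.unitSubgroup) {i₀ : Bool} {x₁ : X}
    (hD : Nontrivial ((MulAction.stabilizer (FreeSquare A) x₁).comap (inj (A := A) i₀)))
    (y : ℕ → X) (ty : ℕ → Bool) (l : ℕ → A) (hty : ∀ j, ty (j + 1) = !ty j) (hl : ∀ j, l j ≠ 1)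
    (hy : ∀ j, y (j + 1) = inj (ty j) (l j) • y j) {n : ℕ} (hn : 0 < n)
    (hper : ∀ j, y (j + n) = y j) : False := by
  choose f hf hoff hdiff hf1 using exists_wall hQ hx₀ hD
  have hdiff' : ∀ p j, f p (ty (j + 1)) p ↔ ¬ f p (ty j) p := by
    intro p j
    rw [hty, hdiff p (ty j), not_not]
  have hinv : ∀ p j, f p (ty j) (y (j + 1)) ↔ f p (ty j) (y j) := by
    intro p j
    rw [hy, hf]
  have hstep : ∀ j, f (y (j + 1)) (ty j) (y (j + 1)) →
      f (y (j + 2)) (ty (j + 1)) (y (j + 2)) := by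
    intro j hj
    by_contra hj2
    have h1 : ¬ f (y (j + 1)) (ty (j + 1)) (y (j + 1)) := by rwa [hdiff', not_not]
    by_cases hpq : y (j + 2) = y (j + 1)
    · obtain ⟨h2, b, h3⟩ := factor_stabilizer_trivial hQ hx₀ hD (hl (j + 1))
        ((hy (j + 1)).symm.trans hpq)
      apply h1
      rw [h2]
      nth_rw 2 [h3]
      rw [hf]
      exact hf1 _
    · have h2 : ¬ f (y (j + 1)) (ty (j + 1)) (y (j + 2)) := by rwa [hinv]
      have h3 : ¬ f (y (j + 2)) (ty (j + 1)) (y (j + 1)) := by rwa [← hinv]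
      have hall : ∀ i x, f (y (j + 1)) i x ∧ f (y (j + 2)) i x ↔
          f (y (j + 1)) (ty (j + 1)) x ∧ f (y (j + 2)) (ty (j + 1)) x := by
        intro i x
        by_cases hx1 : x = y (j + 1)
        · rw [hx1, hoff (y (j + 2)) i (ty (j + 1)) _ (Ne.symm hpq)]
          tauto
        by_cases hx2 : x = y (j + 2)
        · rw [hx2, hoff (y (j + 1)) i (ty (j + 1)) _ hpq]
          tauto
        rw [hoff (y (j + 2)) i (ty (j + 1)) _ hx2, hoff (y (j + 1)) i (ty (j + 1)) _ hx1]
      have := FreeSquare.forall_of_invariant (A := A)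
        (p := fun x => f (y (j + 1)) i₀ x ∧ f (y (j + 2)) i₀ x) (x := x₁) ⟨hf1 _, hf1 _⟩ (by
          intro i a x hx
          rw [hall i₀, ← hall i, hf, hf, hall i, ← hall i₀]
          exact hx) (y (j + 1))
      rw [hall] at this
      exact h1 this.1
  by_cases haway : ∃ j, f (y (j + 1)) (ty j) (y (j + 1))
  · obtain ⟨j, hj⟩ := haway
    have haw : ∀ k, f (y (j + k + 1)) (ty (j + k)) (y (j + k + 1)) := by
      intro k
      induction k with
      | zero => exact hj
      | succ k ih => exact hstep _ ih
    have hclaim : ∀ k, ¬ f (y (j + 1)) (ty (j + 1 + k)) (y (j + 1 + k)) := by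
      intro k
      induction k with
      | zero => rw [add_zero, hdiff', not_not]; exact hj
      | succ k ih =>
        rw [← hinv] at ih
        by_cases h : y (j + 1 + k + 1) = y (j + 1)
        · have := haw (k + 1)
          rw [show j + (k + 1) = j + 1 + k by ring, h] at this
          rw [h] at ih
          exact absurd this ih
        · rwa [← add_assoc, hoff _ _ (ty (j + 1 + k)) _ h]
    obtain ⟨n, rfl⟩ := Nat.exists_eq_succ_of_ne_zero hn.ne'
    have h1 := hclaim n
    rw [← hinv] at h1
    have h2 := haw (n + 1)
    have h3 := hper (j + 1)
    rw [show j + 1 + n.succ = j + 1 + n + 1 by rfl] at h3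
    rw [show j + (n + 1) = j + 1 + n by ring, h3] at h2
    rw [h3] at h1
    exact h1 h2
  · have htow : ∀ j, ¬ f (y (j + 1)) (ty j) (y (j + 1)) := fun j h => haway ⟨j, h⟩
    have hclaim : ∀ k i, i + k = n → ¬ f (y (n + 1)) (ty i) (y (i + 1)) := by
      intro k
      induction k with
      | zero => rintro i rfl; exact htow i
      | succ k ih =>
        intro i hi
        have h1 := ih (i + 1) (by omega)
        rw [hinv] at h1
        by_cases h : y (i + 1) = y (n + 1)
        · rw [h, hdiff', not_not] at h1
          have := htow i
          rw [h] at this ⊢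
          exact this
        · rwa [hoff _ _ (ty (i + 1)) _ h]
    have h1 := hclaim (n - 1) 1 (by omega)
    rw [hinv] at h1
    have h2 := hper 1
    rw [add_comm 1 n] at h2
    rw [h2, hdiff', not_not] at h1
    exact htow 0 h1

end Walls

namespace FreeSquare

variable {A : Type} [Group A]

/-- The product of the first `n` letters of `x`, taken alternately in the two factors. -/
def altProd (x : ℕ → A) : ℕ → FreeSquare A
  | 0 => 1
  | n + 1 => altProd x n * inj n.bodd (x n)

theorem altProd_add {x : ℕ → A} {k : ℕ} (hx : ∀ j, x (2 * k + j) = x j) (n : ℕ) :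
    altProd x (2 * k + n) = altProd x (2 * k) * altProd x n := by
  induction n with
  | zero => simp [altProd]
  | succ n ih =>
    rw [← add_assoc, altProd, altProd, ih, hx, mul_assoc]
    simp

theorem list_prod_ne_one {l : List (Bool × A)} (hl : l ≠ [])
    (hc : l.IsChain (fun s t => s.1 ≠ t.1)) (h1 : ∀ s ∈ l, s.2 ≠ 1) :
    (l.map (fun s => inj s.1 s.2)).prod ≠ 1 := by
  classical
  let u : Monoid.CoprodI.Word (fun _ : Bool => A) :=
    { toList := l.map fun s => ⟨s.1, s.2⟩
      ne_one := by
        intro s hs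
        obtain ⟨t, ht, rfl⟩ := List.mem_map.1 hs
        exact h1 t ht
      chain_ne := by
        rw [List.isChain_map]
        exact hc }
  intro h
  have hu : u.prod = 1 := by
    rw [← h]
    simp [u, Monoid.CoprodI.Word.prod, List.map_map, Function.comp_def]
  have : u = Monoid.CoprodI.Word.empty :=
    Monoid.CoprodI.Word.equiv.symm.injective (hu.trans Monoid.CoprodI.Word.prod_empty.symm)
  have h2 := congrArg Monoid.CoprodI.Word.toList this
  exact hl (by simpa [u, Monoid.CoprodI.Word.empty] using h2)

theorem exists_reduced_list (g : FreeSquare A) : ∃ l : List (Bool × A),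
    l.IsChain (fun s t => s.1 ≠ t.1) ∧ (∀ s ∈ l, s.2 ≠ 1) ∧
      (l.map (fun s => inj s.1 s.2)).prod = g := by
  classical
  obtain ⟨u, rfl⟩ := Monoid.CoprodI.Word.equiv.symm.surjective g
  refine ⟨u.toList.map fun s => (s.1, s.2), ?_, ?_, ?_⟩
  · rw [List.isChain_map]
    exact u.chain_ne
  · intro s hs
    obtain ⟨t, ht, rfl⟩ := List.mem_map.1 hs
    exact u.ne_one t ht
  · rw [List.map_map]
    rfl

theorem altProd_injective {x : ℕ → A} (hx : ∀ j, x j ≠ 1) : Function.Injective (altProd x) := by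
  have key : ∀ m n, altProd x (m + (n + 1)) ≠ altProd x m := by
    intro m n
    have h : ∀ n, altProd x (m + n) = altProd x m *
        (((List.range' m n).map fun j => (j.bodd, x j)).map (fun s => inj s.1 s.2)).prod := by
      intro n
      induction n with
      | zero => simp
      | succ n ih =>
        rw [← add_assoc, altProd, ih, List.range'_concat]
        simp [mul_assoc]
    rw [h]
    intro h1
    rw [mul_eq_left] at h1
    refine list_prod_ne_one ?_ ?_ ?_ h1
    · simp
    · rw [List.isChain_map]
      refine (List.isChain_range' m (n + 1) 1).imp ?_
      rintro a b rfl
      simp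
    · intro s hs
      obtain ⟨j, -, rfl⟩ := List.mem_map.1 hs
      exact hx j
  intro m n h
  rcases lt_trichotomy m n with h1 | h1 | h1
  · obtain ⟨d, rfl⟩ := Nat.exists_eq_add_of_lt h1
    exact absurd h.symm (key m d)
  · exact h1
  · obtain ⟨d, rfl⟩ := Nat.exists_eq_add_of_lt h1
    exact absurd h (key n d)

theorem normalClosure_conj_inj_ne_top [Nontrivial A] (g : FreeSquare A) (i : Bool) (a : A) :
    Subgroup.normalClosure {g * inj i a * g⁻¹} ≠ ⊤ := by
  intro h
  let φ : FreeSquare A →* A := Monoid.CoprodI.lift fun j => if j = i then 1 else MonoidHom.id A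
  have h1 : Subgroup.normalClosure {g * inj i a * g⁻¹} ≤ φ.ker := by
    refine Subgroup.normalClosure_le_normal ?_
    rintro _ rfl
    simp [φ, MonoidHom.mem_ker]
  obtain ⟨b, hb⟩ := exists_ne (1 : A)
  have h2 : inj (!i) b ∈ φ.ker := h1 (h ▸ Subgroup.mem_top _)
  rw [MonoidHom.mem_ker] at h2
  simp [φ] at h2
  exact hb h2

theorem exists_conj_altProd [Nontrivial A] {z : FreeSquare A}
    (hz : Subgroup.normalClosure {z} = ⊤) :
    ∃ (c : FreeSquare A) (k : ℕ) (x : ℕ → A), 0 < k ∧ (∀ j, x (2 * k + j) = x j) ∧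
      (∀ j, x j ≠ 1) ∧ c * z * c⁻¹ = altProd x (2 * k) := by
  classical
  let pr : List (Bool × A) → FreeSquare A := fun l => (l.map (fun s => inj s.1 s.2)).prod
  have hpr : ∀ s l, pr (s :: l) = inj s.1 s.2 * pr l := fun s l => by simp [pr]
  have hpr2 : ∀ s l, pr (l ++ s) = pr l * pr s := fun s l => by simp [pr]
  have hex : ∃ n, ∃ l c, l.length = n ∧ c * z * c⁻¹ = pr l := by
    obtain ⟨l, -, -, hl⟩ := exists_reduced_list z
    exact ⟨_, l, 1, rfl, by simp [pr, hl]⟩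
  obtain ⟨n, ⟨l, c, hln, hc⟩, hmin⟩ : ∃ n, (∃ l c, l.length = n ∧ c * z * c⁻¹ = pr l) ∧
      ∀ l c, c * z * c⁻¹ = pr l → n ≤ l.length :=
    ⟨Nat.find hex, Nat.find_spec hex, fun l c h => Nat.find_min' hex ⟨l, c, rfl, h⟩⟩
  have hz' : ∀ g i a, z ≠ g * inj i a * g⁻¹ := fun g i a h =>
    normalClosure_conj_inj_ne_top g i a (h ▸ hz)
  have hn : 2 ≤ n := by
    by_contra! h
    match l, hln with
    | [], _ => exact hz' 1 false 1 (by simpa [pr] using hc)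
    | [s], _ =>
      refine hz' c⁻¹ s.1 s.2 ?_
      have : c * z * c⁻¹ = inj s.1 s.2 := by simpa [pr] using hc
      rw [← this]; group
    | s :: t :: l, h' => simp at h'; omega
  have hrot : ∀ j, ∃ c, c * z * c⁻¹ = pr (l.rotate j) := by
    intro j
    induction j with
    | zero => exact ⟨c, by simpa using hc⟩
    | succ j ih =>
      obtain ⟨c, hc⟩ := ih
      rw [← List.rotate_rotate]
      match l.rotate j, hc with
      | [], hc => exact ⟨c, by simpa using hc⟩
      | s :: r, hc =>
        refine ⟨(inj s.1 s.2)⁻¹ * c, ?_⟩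
        rw [hpr] at hc
        simp only [List.rotate_cons_succ, List.rotate_zero, hpr2]
        have : pr [s] = inj s.1 s.2 := by simp [pr]
        rw [this, mul_inv_rev, inv_inv]
        calc _ = (inj s.1 s.2)⁻¹ * (c * z * c⁻¹) * inj s.1 s.2 := by group
          _ = _ := by rw [hc]; group
  have hcyc : ∀ j, (l[j % n]'(by rw [hln]; exact Nat.mod_lt _ (by omega))).2 ≠ 1 ∧
      (l[j % n]'(by rw [hln]; exact Nat.mod_lt _ (by omega))).1 ≠
      (l[(j + 1) % n]'(by rw [hln]; exact Nat.mod_lt _ (by omega))).1 := by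
    intro j
    obtain ⟨c, hc⟩ := hrot j
    have hlen : (l.rotate j).length = n := by rw [List.length_rotate, hln]
    have h0 : (l.rotate j)[0]'(by omega) =
        l[j % n]'(by rw [hln]; exact Nat.mod_lt _ (by omega)) := by
      rw [List.getElem_rotate]; simp [hln]
    have h1 : (l.rotate j)[1]'(by omega) =
        l[(j + 1) % n]'(by rw [hln]; exact Nat.mod_lt _ (by omega)) := by
      rw [List.getElem_rotate]; simp [hln, add_comm]
    rw [← h0, ← h1]
    suffices hgen : ∀ l' : List (Bool × A), c * z * c⁻¹ = pr l' → ∀ hl' : 1 < l'.length,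
        l'.length = n → (l'[0]'(Nat.zero_lt_of_lt hl')).2 ≠ 1 ∧
          (l'[0]'(Nat.zero_lt_of_lt hl')).1 ≠ (l'[1]'hl').1 from
      hgen _ hc (by omega) hlen
    clear h0 h1 hlen hc
    intro l' hc hl' hlen
    match l', hl', hlen with
    | s :: t :: r, _, hlen =>
      simp only [List.length_cons] at hlen
      simp only [List.getElem_cons_zero, List.getElem_cons_succ]
      constructor
      · intro h
        rw [hpr, h, map_one, one_mul] at hc
        have := hmin _ _ hc
        simp only [List.length_cons] at this
        omega
      · intro h
        have h2 : pr (s :: t :: r) = pr ((t.1, s.2 * t.2) :: r) := by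
          rw [hpr, hpr, hpr, h, map_mul, mul_assoc]
        have := hmin _ _ (hc.trans h2)
        simp only [List.length_cons] at this
        omega
  have hlt : ∀ j, j % n < l.length := fun j => by rw [hln]; exact Nat.mod_lt _ (by omega)
  obtain ⟨s, hs⟩ : ∃ s, (l[s % n]'(hlt s)).1 = false := by
    by_contra! h
    have h0 := h 0
    have h1 := h 1
    have h2 := (hcyc 0).2
    simp only [ne_eq, Bool.not_eq_false] at h0 h1
    exact h2 (h0.trans h1.symm)
  have hpar : ∀ j, (l[(s + j) % n]'(hlt _)).1 = j.bodd := by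
    intro j
    induction j with
    | zero => simpa using hs
    | succ j ih =>
      have := (hcyc (s + j)).2
      rw [ih] at this
      rw [Nat.bodd_succ]
      have h2 := Bool.eq_not_of_ne this.symm
      simpa only [add_assoc] using h2
  have hev : n.bodd = false := by
    rw [← hpar n, ← hs]
    simp
  obtain ⟨k, rfl⟩ : ∃ k, n = 2 * k := by
    refine ⟨n.div2, ?_⟩
    have := Nat.bodd_add_div2 n
    rw [hev] at this
    simpa using this.symm
  obtain ⟨c, hc⟩ := hrot s
  refine ⟨c, k, fun j => (l[(s + j) % (2 * k)]'(hlt _)).2, by omega, ?_, fun j => (hcyc _).1, ?_⟩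
  · intro j
    simp [Nat.add_left_comm s]
  · rw [hc]
    have : ∀ m ≤ 2 * k, pr ((l.rotate s).take m) =
        altProd (fun j => (l[(s + j) % (2 * k)]'(hlt _)).2) m := by
      intro m
      induction m with
      | zero => intro _; simp [pr, altProd]
      | succ m ih =>
        intro hm
        rw [altProd, ← ih (by omega), ← hpar m]
        simp only [pr, List.map_take]
        rw [List.prod_take_succ _ _ (by simp [hln]; omega)]
        congr 1
        simp only [List.getElem_map, List.getElem_rotate, hln, add_comm]
    rw [← this _ le_rfl, List.take_of_length_le (by simp [hln])]

end FreeSquare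

section FreeCase

variable {A : Type} [Group A]
variable {X : Type} [MulAction (FreeSquare A) X]

theorem isFreeGroup_stabilizer (hfree : ∀ (i : Bool) (a : A) (x : X), inj i a • x = x → a = 1)
    (x₀ : X) : IsFreeGroup (MulAction.stabilizer (FreeSquare A) x₀) := by
  classical
  obtain ⟨ρ, hρ, hρ1⟩ := exists_skew_action (A := A) (X := X) (Y := FreeGroup X)
    (fun i b x => if i = true then
      Equiv.mulLeft (FreeGroup.of (inj i b • x) * (FreeGroup.of x)⁻¹) else 1) (by
      intro i a b x
      cases i
      · simp
      · ext1 y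
        simp [mul_smul, mul_assoc])
  have hright : ∀ g x d e, (ρ g (x, d * e)).2 = (ρ g (x, d)).2 * e := by
    intro g
    induction g using Monoid.CoprodI.induction_left with
    | one => intro x d e; simp
    | @mul i a g hg =>
      intro x d e
      have h1 : ∀ y, ρ g (x, y) = (g • x, (ρ g (x, y)).2) := fun y => Prod.ext (hρ1 g (x, y)) rfl
      rw [map_mul, Equiv.Perm.mul_apply, Equiv.Perm.mul_apply, h1, h1 d, hg]
      have := hρ i a (g • x)
      rw [this, this]
      cases i <;> simp [mul_assoc]
  let Φ : MulAction.stabilizer (FreeSquare A) x₀ →* FreeGroup X :=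
    { toFun := fun g => (ρ g (x₀, 1)).2
      map_one' := by simp
      map_mul' := by
        intro g h
        have h1 : ρ (h : FreeSquare A) (x₀, 1) = (x₀, (ρ h (x₀, 1)).2) :=
          Prod.ext ((hρ1 h (x₀, 1)).trans h.2) rfl
        rw [Subgroup.coe_mul, map_mul, Equiv.Perm.mul_apply, h1]
        have := hright g x₀ 1 (ρ h (x₀, 1)).2
        rw [one_mul] at this
        exact this }
  have hΦ : Function.Injective Φ := by
    rw [injective_iff_map_eq_one]
    rintro ⟨g, hg⟩ h1
    obtain ⟨l, hl, hl1, rfl⟩ := exists_reduced_list g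
    let pr : List (Bool × A) → FreeSquare A := fun l => (l.map (fun s => inj s.1 s.2)).prod
    have key : ∀ l : List (Bool × A), l.IsChain (fun s t => s.1 ≠ t.1) → (∀ s ∈ l, s.2 ≠ 1) →
        ∃ L, FreeGroup.IsReduced L ∧ (ρ (pr l) (x₀, 1)).2 = FreeGroup.mk L ∧
          (∀ b l', l = (true, b) :: l' → ∃ L', L = (pr l • x₀, true) :: L') ∧
          (∀ a l', l = (false, a) :: l' → l' ≠ [] → ∃ L', L = (pr l' • x₀, true) :: L') ∧
          (∀ a, l = [(false, a)] → L = []) ∧ (l = [] → L = []) := by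
      intro l
      induction l with
      | nil =>
        intro _ _
        exact ⟨[], by simp, by simp [pr, FreeGroup.one_eq_mk], by simp, by simp, by simp, by simp⟩
      | cons s l ih =>
        intro hc hs
        obtain ⟨L, hL, hρL, h1, h2, h3, h4⟩ := ih (List.IsChain.of_cons hc)
          fun s hs' => hs s (List.mem_cons_of_mem _ hs')
        have hpr : pr (s :: l) = inj s.1 s.2 * pr l := by simp [pr]
        have hstep : ρ (pr (s :: l)) (x₀, 1) = ρ (inj s.1 s.2) (pr l • x₀, FreeGroup.mk L) := by
          rw [hpr, map_mul, Equiv.Perm.mul_apply, ← hρL]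
          congr 1
          exact Prod.ext (hρ1 _ _) rfl
        rw [hρ] at hstep
        obtain ⟨i, a⟩ := s
        cases i
        · refine ⟨L, hL, by rw [hstep]; rfl, by simp, ?_, ?_, by simp⟩
          · rintro a' l' h hne
            obtain ⟨rfl, rfl⟩ : a = a' ∧ l = l' := by simpa using h
            match l, hne with
            | (true, b) :: l, _ => exact h1 b l rfl
            | (false, b) :: l, _ => simp at hc
          · rintro a' h
            obtain ⟨rfl, rfl⟩ : a = a' ∧ l = [] := by simpa using h
            exact h4 rfl
        · have ha : a ≠ 1 := hs (true, a) (by simp)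
          have hne : inj true a • pr l • x₀ ≠ pr l • x₀ := fun h => ha (hfree _ _ _ h)
          refine ⟨(inj true a • pr l • x₀, true) :: (pr l • x₀, false) :: L, ?_, ?_, ?_, by simp,
            by simp, by simp⟩
          · rw [FreeGroup.IsReduced, List.isChain_cons_cons, List.isChain_cons]
            refine ⟨fun h => absurd h hne, ?_, hL⟩
            match l with
            | [] => simp [h4]
            | (true, b) :: l => simp at hc
            | (false, b) :: l =>
              by_cases hl : l = []
              · subst hl
                simp [h3 b rfl]
              · obtain ⟨L', rfl⟩ := h2 b l rfl hl
                simp only [List.head?_cons, Option.mem_some_iff]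
                rintro _ rfl h
                have hb : b ≠ 1 := hs (false, b) (by simp)
                refine absurd (hfree false b (pr l • x₀) ?_) hb
                have : pr ((false, b) :: l) = inj false b * pr l := by simp [pr]
                rw [← mul_smul, ← this]
                exact h
          · rw [hstep]
            simp [FreeGroup.of, FreeGroup.invRev]
          · intro b l' h
            rw [hpr, mul_smul]
            exact ⟨_, rfl⟩
    obtain ⟨L, hL, hρL, h2, h3, -, -⟩ := key l hl hl1
    have hL0 : L = [] := by
      have : FreeGroup.mk L = 1 := hρL.symm.trans h1
      rw [FreeGroup.one_eq_mk] at this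
      have := congrArg FreeGroup.toWord this
      rw [FreeGroup.toWord_mk, FreeGroup.toWord_mk, hL.reduce_eq] at this
      simpa using this
    refine Subtype.ext ?_
    match l with
    | [] => simp
    | (true, b) :: l =>
      obtain ⟨L', h⟩ := h2 b l rfl
      simp [hL0] at h
    | [(false, a)] =>
      have h5 : inj false a • x₀ = x₀ := by simpa using hg
      simp [hfree _ _ _ h5]
    | (false, a) :: s :: l =>
      obtain ⟨L', h⟩ := h3 a (s :: l) rfl (by simp)
      simp [hL0] at h
  exact IsFreeGroup.ofMulEquiv (MonoidHom.ofInjective hΦ).symm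

end FreeCase

theorem IsFreeGroup.exists_zpowers_eq_top {K : Type} [Group K] [IsFreeGroup K] (w : K)
    (hw : ∀ χ : K →* Multiplicative ℤ, χ w = 1 → χ = 1) : ∃ z : K, Subgroup.zpowers z = ⊤ := by
  classical
  have hsub : Subsingleton (IsFreeGroup.Generators K) := by
    refine ⟨fun s t => ?_⟩
    by_contra hst
    let e : IsFreeGroup.Generators K → K →* Multiplicative ℤ := fun s =>
      IsFreeGroup.lift fun t => if t = s then Multiplicative.ofAdd 1 else 1
    have he : ∀ s, e s ≠ 1 := by
      intro s h
      have h1 := DFunLike.congr_fun h (IsFreeGroup.of s)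
      simp only [e, IsFreeGroup.lift_of, if_true, MonoidHom.one_apply] at h1
      exact absurd (congrArg Multiplicative.toAdd h1) (by simp)
    have he2 : ∀ s t, s ≠ t → e s (IsFreeGroup.of t) = 1 := by
      intro s t h
      simp [e, IsFreeGroup.lift_of, h.symm]
    have hes : ∀ s, e s (IsFreeGroup.of s) = Multiplicative.ofAdd 1 := by
      intro s
      simp [e, IsFreeGroup.lift_of]
    let m := Multiplicative.toAdd (e s w)
    let n := Multiplicative.toAdd (e t w)
    have h1 := hw (e s ^ n * (e t ^ m)⁻¹) (by
      apply Multiplicative.toAdd.injective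
      simp [m, n, mul_comm])
    have h2 := congrArg Multiplicative.toAdd (DFunLike.congr_fun h1 (IsFreeGroup.of s))
    have hn : n = 0 := by simpa [he2 t s (Ne.symm hst), hes] using h2
    exact he t (hw (e t) (Multiplicative.toAdd.injective hn))
  have hgen : Subgroup.closure (Set.range (IsFreeGroup.of (G := K))) = ⊤ := by
    rw [eq_top_iff]
    intro g _
    let φ : K →* Subgroup.closure (Set.range (IsFreeGroup.of (G := K))) :=
      IsFreeGroup.lift fun s => ⟨IsFreeGroup.of s, Subgroup.subset_closure ⟨s, rfl⟩⟩
    have h : (Subgroup.subtype _).comp φ = MonoidHom.id K := by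
      apply IsFreeGroup.ext_hom
      intro s
      simp [φ, IsFreeGroup.lift_of]
    have h2 := DFunLike.congr_fun h g
    rw [MonoidHom.comp_apply, MonoidHom.id_apply] at h2
    rw [← h2]
    exact (φ g).2
  rcases isEmpty_or_nonempty (IsFreeGroup.Generators K) with h | ⟨⟨s⟩⟩
  · refine ⟨1, ?_⟩
    rw [Set.range_eq_empty, Subgroup.closure_empty] at hgen
    rw [Subgroup.zpowers_one_eq_bot, hgen]
  · refine ⟨IsFreeGroup.of s, ?_⟩
    rw [Subgroup.zpowers_eq_closure, ← hgen]
    congr 1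
    ext x
    constructor
    · rintro rfl; exact ⟨s, rfl⟩
    · rintro ⟨t, rfl⟩; rw [Subsingleton.elim t s]; rfl

theorem exists_isTotal_zpowers {A : Type} [Group A] [LinearOrder A] [MulLeftMono A] [Countable A]
    [Nontrivial A] {w : FreeSquare A} (hw : Subgroup.normalClosure {w} = ⊤) :
    ∃ (k : ℕ) (x : ℕ → A) (Q : Submonoid (FreeSquare A)), 0 < k ∧
      Subgroup.normalClosure {altProd x (2 * k)} = ⊤ ∧ Q.IsTotal ∧
      (∀ g, g ∈ Q ∧ g⁻¹ ∈ Q ↔ g ∈ Subgroup.zpowers (altProd x (2 * k))) ∧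
      ∀ i j, 1 ≤ i → i < j → j ≤ 2 * k →
        altProd x j * (altProd x i)⁻¹ ∉ Subgroup.zpowers (altProd x (2 * k)) := by
  obtain ⟨Q, hQ⟩ := exists_isMinimalTotal w
  let X := FreeSquare A ⧸ Q.unitSubgroup
  let x₀ : X := QuotientGroup.mk 1
  have hx₀ : MulAction.stabilizer (FreeSquare A) x₀ = Q.unitSubgroup := by
    ext g
    rw [MulAction.mem_stabilizer_iff]
    change QuotientGroup.mk (g * 1) = QuotientGroup.mk 1 ↔ _
    rw [QuotientGroup.eq]
    simp
  have hfree : ∀ (i : Bool) (a : A) (x : X), inj i a • x = x → a = 1 := by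
    intro i a x hax
    by_contra ha
    have hD : Nontrivial ((MulAction.stabilizer (FreeSquare A) x).comap (inj (A := A) i)) :=
      ⟨⟨a, hax⟩, 1, fun h => ha (congrArg Subtype.val h)⟩
    obtain ⟨c, k, u, hk, hper, hu, hc⟩ := exists_conj_altProd hw
    refine no_periodic_walk hQ hx₀ hD (fun j => (altProd u j)⁻¹ • c • x₀) Nat.bodd
      (fun j => (u j)⁻¹) (fun j => Nat.bodd_succ j) (fun j => inv_ne_one.2 (hu j)) ?_
      (n := 2 * k) (by omega) ?_
    · intro j
      rw [altProd, mul_inv_rev, mul_smul, map_inv]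
    · intro j
      have hwx : (altProd u (2 * k))⁻¹ • c • x₀ = c • x₀ := by
        have : w ∈ MulAction.stabilizer (FreeSquare A) x₀ := by
          rw [hx₀]; exact hQ.mem
        rw [inv_smul_eq_iff, ← hc, mul_smul, mul_smul, inv_smul_smul, this]
      rw [add_comm, altProd_add hper, mul_inv_rev, mul_smul, hwx]
  have hKfree : IsFreeGroup Q.unitSubgroup := hx₀ ▸ isFreeGroup_stabilizer hfree x₀
  obtain ⟨z, hz⟩ := IsFreeGroup.exists_zpowers_eq_top (⟨w, hQ.mem⟩ : Q.unitSubgroup) (by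
    intro χ hχ
    let R : Submonoid (FreeSquare A) :=
      { carrier := {g | ∃ h : g ∈ Q.unitSubgroup, 1 ≤ χ ⟨g, h⟩}
        one_mem' := ⟨one_mem _, by
          have : (⟨1, one_mem _⟩ : Q.unitSubgroup) = 1 := rfl
          rw [this, map_one]⟩
        mul_mem' := by
          rintro a b ⟨ha, ha1⟩ ⟨hb, hb1⟩
          refine ⟨mul_mem ha hb, ?_⟩
          have : (⟨a * b, mul_mem ha hb⟩ : Q.unitSubgroup) = ⟨a, ha⟩ * ⟨b, hb⟩ := rfl
          rw [this, map_mul]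
          exact one_le_mul ha1 hb1 }
    have hall := hQ.le_of_total R (fun g h => h.1) (by
      intro g hg
      rcases le_total 1 (χ ⟨g, hg⟩) with h | h
      · exact Or.inl ⟨hg, h⟩
      · refine Or.inr ⟨inv_mem hg, ?_⟩
        have : (⟨g⁻¹, inv_mem hg⟩ : Q.unitSubgroup) = ⟨g, hg⟩⁻¹ := rfl
        rw [this, map_inv]
        exact Left.one_le_inv_iff.2 h) ⟨hQ.mem, hχ.ge⟩ ⟨inv_mem hQ.mem, by
        have : (⟨w⁻¹, inv_mem hQ.mem⟩ : Q.unitSubgroup) = ⟨w, hQ.mem⟩⁻¹ := rfl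
        rw [this, map_inv, hχ, inv_one]⟩
    ext1 g
    obtain ⟨_, h1⟩ := hall g g.2
    obtain ⟨_, h2⟩ := hall _ (g⁻¹).2
    have h3 : 1 ≤ χ g⁻¹ := h2
    rw [map_inv, Left.one_le_inv_iff] at h3
    exact le_antisymm h3 h1)
  have hzK : ∀ g, g ∈ Q.unitSubgroup ↔ g ∈ Subgroup.zpowers (z : FreeSquare A) := by
    intro g
    constructor
    · intro hg
      obtain ⟨n, hn⟩ : (⟨g, hg⟩ : Q.unitSubgroup) ∈ Subgroup.zpowers z := hz ▸ Subgroup.mem_top _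
      exact ⟨n, congrArg Subtype.val hn⟩
    · rintro ⟨n, rfl⟩
      exact zpow_mem z.2 n
  have hztop : Subgroup.normalClosure {(z : FreeSquare A)} = ⊤ := by
    rw [← top_le_iff, ← hw]
    refine Subgroup.normalClosure_le_normal ?_
    rintro _ rfl
    have h1 : Subgroup.zpowers (z : FreeSquare A) ≤ Subgroup.normalClosure {(z : FreeSquare A)} :=
      Subgroup.zpowers_le.2 (Subgroup.subset_normalClosure rfl)
    exact h1 ((hzK _).1 hQ.mem)
  obtain ⟨c, k, u, hk, hper, hu, hc⟩ := exists_conj_altProd hztop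
  refine ⟨k, u, Q.map (MulAut.conj c).toMonoidHom, hk, ?_, ?_, ?_, ?_⟩
  · rw [← top_le_iff, ← hztop]
    refine Subgroup.normalClosure_le_normal ?_
    rintro _ rfl
    have h1 := (Subgroup.normalClosure_normal (s := {altProd u (2 * k)})).conj_mem _
      (Subgroup.subset_normalClosure rfl) c⁻¹
    rw [← hc] at h1 ⊢
    simpa [mul_assoc] using h1
  · intro g
    refine (hQ.total (c⁻¹ * g * c)).imp ?_ ?_ <;> intro h <;> refine ⟨_, h, ?_⟩ <;>
      simp [mul_assoc]
  · intro g
    have h1 : ∀ g, g ∈ Q.map (MulAut.conj c).toMonoidHom ↔ c⁻¹ * g * c ∈ Q := by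
      intro g
      constructor
      · rintro ⟨h, hh, rfl⟩
        simpa [mul_assoc] using hh
      · intro h
        exact ⟨_, h, by simp [mul_assoc]⟩
    have h2 := hzK (c⁻¹ * g * c)
    rw [Submonoid.mem_unitSubgroup] at h2
    rw [h1, h1, ← hc]
    have h3 : (c⁻¹ * g * c)⁻¹ = c⁻¹ * g⁻¹ * c := by group
    rw [h3] at h2
    rw [h2, Subgroup.mem_zpowers_iff, Subgroup.mem_zpowers_iff]
    refine exists_congr fun n => ?_
    rw [conj_zpow]
    constructor <;> intro h
    · rw [h]; group
    · rw [← h]; group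
  · rintro i j hi hij hj ⟨n, hn⟩
    have hinj := altProd_injective hu
    have hmul : ∀ (m : ℕ) (i : ℕ),
        altProd u (2 * k) ^ m * altProd u i = altProd u (2 * k * m + i) := by
      intro m i
      induction m with
      | zero => simp
      | succ m ih =>
        rw [pow_succ', mul_assoc, ih, ← altProd_add hper]
        congr 1; ring
    have hn' : altProd u (2 * k) ^ n * altProd u i = altProd u j := by
      change altProd u (2 * k) ^ n = _ at hn
      rw [hn, inv_mul_cancel_right]
    obtain ⟨m, rfl | rfl⟩ := n.eq_nat_or_neg
    · rw [zpow_natCast, hmul] at hn'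
      have := hinj hn'
      rcases m with _ | m
      · omega
      · rw [mul_add] at this; omega
    · rw [zpow_neg, zpow_natCast, inv_mul_eq_iff_eq_mul, hmul] at hn'
      have := hinj hn'
      omega

section Paths

variable {A : Type} [Group A]

/-- `IsTreePath e ty i g l j h` says that crossing successively the edges `e p` of the Bass-Serre
tree, for `p` in `l`, from an endpoint of type `ty p` leads from the vertex `g A` of type `i` to the
vertex `h A` of type `j`. -/
def IsTreePath {P : Type*} (e : P → FreeSquare A) (ty : P → Bool) :
    Bool → FreeSquare A → List P → Bool → FreeSquare A → Prop
  | i, g, [], j, h => i = j ∧ g⁻¹ * h ∈ (inj (A := A) i).range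
  | i, g, p :: l, j, h =>
    ty p = i ∧ g⁻¹ * e p ∈ (inj (A := A) i).range ∧ IsTreePath e ty (!i) (e p) l j h

namespace IsTreePath

variable {P : Type*} {e : P → FreeSquare A} {ty : P → Bool}

theorem of_mem_range {i j : Bool} {g g' h : FreeSquare A} {l : List P}
    (hg : g⁻¹ * g' ∈ (inj (A := A) i).range) (hl : IsTreePath e ty i g' l j h) :
    IsTreePath e ty i g l j h := by
  cases l with
  | nil =>
    refine ⟨hl.1, ?_⟩
    have := mul_mem hg hl.2
    rwa [mul_assoc, mul_inv_cancel_left] at this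
  | cons p l =>
    refine ⟨hl.1, ?_, hl.2.2⟩
    have := mul_mem hg hl.2.1
    rwa [mul_assoc, mul_inv_cancel_left] at this

theorem append {i j m : Bool} {g g' h : FreeSquare A} {l l' : List P}
    (h1 : IsTreePath e ty i g l j g') (h2 : IsTreePath e ty j g' l' m h) :
    IsTreePath e ty i g (l ++ l') m h := by
  induction l generalizing i g with
  | nil =>
    obtain ⟨rfl, h3⟩ := h1
    exact of_mem_range h3 h2
  | cons p l ih => exact ⟨h1.1, h1.2.1, ih h1.2.2⟩

theorem map {P' : Type*} {e' : P' → FreeSquare A} {ty' : P' → Bool} {i j : Bool}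
    {g h : FreeSquare A} {l : List P} (c : FreeSquare A) (f : P → P')
    (he : ∀ p ∈ l, e' (f p) = c * e p) (ht : ∀ p ∈ l, ty' (f p) = ty p)
    (hl : IsTreePath e ty i g l j h) : IsTreePath e' ty' i (c * g) (l.map f) j (c * h) := by
  induction l generalizing i g with
  | nil =>
    refine ⟨hl.1, ?_⟩
    have : (c * g)⁻¹ * (c * h) = g⁻¹ * h := by group
    rw [this]
    exact hl.2
  | cons p l ih =>
    have h1 := ih (fun q hq => he q (List.mem_cons_of_mem _ hq))
      (fun q hq => ht q (List.mem_cons_of_mem _ hq)) hl.2.2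
    have h2 := he p List.mem_cons_self
    refine ⟨(ht p List.mem_cons_self).trans hl.1, ?_, ?_⟩
    · have : (c * g)⁻¹ * e' (f p) = g⁻¹ * e p := by rw [h2]; group
      rw [this]
      exact hl.2.1
    · rw [h2]
      exact h1

theorem reverse {P' : Type*} {e' : P' → FreeSquare A} {ty' : P' → Bool} {i j : Bool}
    {g h : FreeSquare A} {l : List P} (f : P → P')
    (he : ∀ p ∈ l, e' (f p) = e p) (ht : ∀ p ∈ l, ty' (f p) = !ty p)
    (hl : IsTreePath e ty i g l j h) : IsTreePath e' ty' j h (l.map f).reverse i g := by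
  induction l generalizing i g with
  | nil =>
    obtain ⟨rfl, h1⟩ := hl
    refine ⟨rfl, ?_⟩
    have := inv_mem h1
    rwa [mul_inv_rev, inv_inv] at this
  | cons p l ih =>
    obtain ⟨rfl, h2, h3⟩ := hl
    have h1 := ih (fun q hq => he q (List.mem_cons_of_mem _ hq))
      (fun q hq => ht q (List.mem_cons_of_mem _ hq)) h3
    rw [List.map_cons, List.reverse_cons]
    refine append h1 ⟨ht p List.mem_cons_self, ?_, ?_, ?_⟩
    · rw [he p List.mem_cons_self, inv_mul_cancel]
      exact one_mem _
    · rw [Bool.not_not]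
    · rw [he p List.mem_cons_self, Bool.not_not]
      have := inv_mem h2
      rwa [mul_inv_rev, inv_inv] at this

theorem delete {i j : Bool} {g h : FreeSquare A} {l₁ l₂ : List P} {p q : P} (hpq : e p = e q)
    (hl : IsTreePath e ty i g (l₁ ++ p :: q :: l₂) j h) :
    ty q = !ty p ∧ IsTreePath e ty i g (l₁ ++ l₂) j h := by
  induction l₁ generalizing i g with
  | nil =>
    obtain ⟨rfl, h2, h3, -, h5⟩ := hl
    rw [Bool.not_not] at h5
    exact ⟨h3, of_mem_range (hpq ▸ h2) h5⟩
  | cons r l₁ ih =>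
    obtain ⟨h1, h2, h3⟩ := hl
    obtain ⟨h4, h5⟩ := ih h3
    exact ⟨h4, h1, h2, h5⟩

theorem exists_reduced {i j : Bool} {g h : FreeSquare A} {l : List P}
    (hl : IsTreePath e ty i g l j h) (hc : List.IsChain (· ≠ ·) (g :: l.map e)) :
    ∃ w : List (Bool × A), w.IsChain (fun s t => s.1 ≠ t.1) ∧ (∀ s ∈ w, s.2 ≠ 1) ∧
      (∀ s ∈ w.head?, s.1 = i) ∧ (l ≠ [] → w ≠ []) ∧
      (w.map (fun s => inj s.1 s.2)).prod = g⁻¹ * h := by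
  classical
  induction l generalizing i g with
  | nil =>
    obtain ⟨rfl, a, ha⟩ := hl
    by_cases h1 : a = 1
    · refine ⟨[], by simp, by simp, by simp, by simp, ?_⟩
      rw [← ha, h1]
      simp
    · exact ⟨[(i, a)], by simp, by simpa using h1, by simp, by simp, by simpa using ha⟩
  | cons p l ih =>
    obtain ⟨-, ⟨a, ha⟩, h3⟩ := hl
    rw [List.map_cons, List.isChain_cons_cons] at hc
    obtain ⟨w, hw1, hw2, hw3, -, hw5⟩ := ih h3 hc.2
    have ha1 : a ≠ 1 := by
      rintro rfl
      rw [map_one, eq_comm, inv_mul_eq_one] at ha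
      exact hc.1 ha
    refine ⟨(i, a) :: w, ?_, ?_, by simp, by simp, ?_⟩
    · rw [List.isChain_cons]
      refine ⟨fun s hs h => ?_, hw1⟩
      have := hw3 s hs
      rw [← h] at this
      simp at this
    · intro s hs
      rcases List.mem_cons.1 hs with rfl | hs
      · exact ha1
      · exact hw2 s hs
    · rw [List.map_cons, List.prod_cons, hw5, ha]
      group

theorem exists_adjacent_eq {a : A} {l : List P} (hne : l ≠ [])
    (hl : IsTreePath e ty false 1 l false (inj false a)) :
    ∃ l₁ p q l₂, l = l₁ ++ p :: q :: l₂ ∧ e p = e q := by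
  by_contra! hcon
  match l, hne with
  | p :: l, _ =>
    obtain ⟨-, ⟨b, hb⟩, h3⟩ := hl
    have hchain : List.IsChain (· ≠ ·) ((p :: l).map e) := by
      rw [List.isChain_map, List.isChain_iff_forall_rel_of_append_cons_cons]
      intro p' q' l₁ l₂ h
      exact hcon l₁ p' q' l₂ h
    obtain ⟨w, hw1, hw2, hw3, hw4, hw5⟩ := exists_reduced h3 hchain
    have hl0 : l ≠ [] := by
      rintro rfl
      exact absurd h3.1 (by simp)
    have hw0 := hw4 hl0
    rw [inv_one, one_mul] at hb
    rw [← hb, ← map_inv, ← map_mul] at hw5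
    by_cases h : b⁻¹ * a = 1
    · rw [h, map_one] at hw5
      exact list_prod_ne_one hw0 hw1 hw2 hw5
    · refine list_prod_ne_one (l := (false, (b⁻¹ * a)⁻¹) :: w) (by simp) ?_ ?_ ?_
      · rw [List.isChain_cons]
        refine ⟨fun s hs => ?_, hw1⟩
        rw [hw3 s hs]
        simp
      · intro s hs
        rcases List.mem_cons.1 hs with rfl | hs
        · exact inv_ne_one.2 h
        · exact hw2 s hs
      · rw [List.map_cons, List.prod_cons, hw5, ← map_mul, inv_mul_cancel, map_one]

end IsTreePath

theorem exists_isTreePath (g h : FreeSquare A) (i j : Bool) :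
    ∃ l : List (FreeSquare A × Bool), IsTreePath Prod.fst Prod.snd i h l j (h * g) := by
  induction g using Monoid.CoprodI.induction_left generalizing h i with
  | one =>
    by_cases hij : i = j
    · exact ⟨[], hij, by simp⟩
    · refine ⟨[(h, i)], rfl, by simp, ?_, by simp⟩
      exact (Bool.eq_not_of_ne (Ne.symm hij)).symm
  | @mul t a g ih =>
    by_cases hit : i = t
    · subst hit
      obtain ⟨l, hl⟩ := ih (h * inj i a) i
      refine ⟨l, IsTreePath.of_mem_range (g' := h * inj i a) ⟨a, by group⟩ ?_⟩
      rwa [← mul_assoc]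
    · obtain ⟨l, hl⟩ := ih (h * inj t a) t
      refine ⟨(h, i) :: l, rfl, by simp, ?_⟩
      rw [← Bool.eq_not_of_ne (Ne.symm hit)]
      refine IsTreePath.of_mem_range (g' := h * inj t a) ⟨a, by group⟩ ?_
      rwa [← mul_assoc]

theorem exists_reduced_isTreePath (g : FreeSquare A) : ∃ l : List (FreeSquare A × Bool),
    IsTreePath Prod.fst Prod.snd false 1 l false g ∧ l.IsChain (fun s t => s.1 ≠ t.1) := by
  classical
  have hex : ∃ n, ∃ l : List (FreeSquare A × Bool),
      l.length = n ∧ IsTreePath Prod.fst Prod.snd false 1 l false g := by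
    obtain ⟨l, hl⟩ := exists_isTreePath g 1 false false
    exact ⟨_, l, rfl, by rwa [one_mul] at hl⟩
  obtain ⟨l, hlen, hl⟩ := Nat.find_spec hex
  refine ⟨l, hl, ?_⟩
  rw [List.isChain_iff_forall_rel_of_append_cons_cons]
  rintro p q l₁ l₂ rfl hpq
  have := Nat.find_min' hex ⟨_, rfl, (hl.delete hpq).2⟩
  rw [← hlen] at this
  simp at this

end Paths

section Folding

/-- The list `l` of edges with initial ends `nb` and terminal ends `na` forms a walk from `ν`
to `μ`. -/
def IsNodeWalk {P N : Type*} (nb na : P → N) : N → List P → N → Prop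
  | ν, [], μ => ν = μ
  | ν, p :: l, μ => nb p = ν ∧ IsNodeWalk nb na (na p) l μ

namespace IsNodeWalk

variable {P N : Type*} {nb na : P → N}

theorem append_iff {ν μ : N} {l l' : List P} :
    IsNodeWalk nb na ν (l ++ l') μ ↔ ∃ κ, IsNodeWalk nb na ν l κ ∧ IsNodeWalk nb na κ l' μ := by
  induction l generalizing ν with
  | nil => simp [IsNodeWalk]
  | cons p l ih => simp [IsNodeWalk, ih, and_assoc]

theorem map {N' : Type*} {nb' na' : P → N'} (f : N → N') {ν μ : N} {l : List P}
    (hb : ∀ p ∈ l, nb' p = f (nb p)) (ha : ∀ p ∈ l, na' p = f (na p))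
    (h : IsNodeWalk nb na ν l μ) : IsNodeWalk nb' na' (f ν) l (f μ) := by
  induction l generalizing ν with
  | nil => exact congrArg f h
  | cons p l ih =>
    refine ⟨by rw [hb p List.mem_cons_self, h.1], ?_⟩
    rw [ha p List.mem_cons_self]
    exact ih (fun q hq => hb q (List.mem_cons_of_mem _ hq))
      (fun q hq => ha q (List.mem_cons_of_mem _ hq)) h.2

theorem exists_nodes {ν μ : N} {n : ℕ} {f : Fin n → P}
    (h : IsNodeWalk nb na ν (List.ofFn f) μ) :
    ∃ v : ℕ → N, v 0 = ν ∧ v n = μ ∧ (∀ i : Fin n, nb (f i) = v i) ∧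
      ∀ i : Fin n, na (f i) = v (i + 1) := by
  induction n generalizing ν with
  | zero =>
    rw [List.ofFn_zero] at h
    exact ⟨fun _ => ν, rfl, h, fun i => i.elim0, fun i => i.elim0⟩
  | succ n ih =>
    rw [List.ofFn_succ] at h
    obtain ⟨v, h0, hn, hb, ha⟩ := ih h.2
    refine ⟨fun i => if i = 0 then ν else v (i - 1), by simp, by simp [hn], ?_, ?_⟩
    · intro i
      refine Fin.cases ?_ (fun i => ?_) i
      · simpa using h.1
      · simpa using hb i
    · intro i
      refine Fin.cases ?_ (fun i => ?_) i
      · simp [h0]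
      · simpa using ha i

theorem exists_nodes_flatten {ν μ : N} {n : ℕ} {f : Fin n → List P}
    (h : IsNodeWalk nb na ν (List.ofFn f).flatten μ) :
    ∃ v : ℕ → N, v 0 = ν ∧ v n = μ ∧ ∀ i : Fin n, IsNodeWalk nb na (v i) (f i) (v (i + 1)) := by
  induction n generalizing ν with
  | zero =>
    rw [List.ofFn_zero] at h
    exact ⟨fun _ => ν, rfl, h, fun i => i.elim0⟩
  | succ n ih =>
    rw [List.ofFn_succ, List.flatten_cons, append_iff] at h
    obtain ⟨κ, h1, h2⟩ := h
    obtain ⟨v, h0, hn, hv⟩ := ih h2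
    refine ⟨fun i => if i = 0 then ν else v (i - 1), by simp, by simp [hn], ?_⟩
    intro i
    refine Fin.cases ?_ (fun i => ?_) i
    · simpa [h0] using h1
    · simpa using hv i

end IsNodeWalk

theorem IsTreePath.exists_folding {A : Type} [Group A] {P : Type} {e : P → FreeSquare A}
    {ty : P → Bool} {a : A} {l : List P} (hnd : l.Nodup)
    (hl : IsTreePath e ty false 1 l false (inj false a)) :
    ∃ (π : P → P) (N : Type) (_ : Fintype N) (nb na : P → N) (root : N),
      (∀ p ∈ l, π p ∈ l ∧ π (π p) = p ∧ e (π p) = e p ∧ ty (π p) = !ty p ∧ nb (π p) = na p ∧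
        na (π p) = nb p) ∧
      2 * Fintype.card N = l.length + 2 ∧ IsNodeWalk nb na root l root ∧
      (∀ ν, ν = root ∨ ∃ p ∈ l, na p = ν) ∧
      ∀ J : P → FreeSquare A, (∀ p ∈ l, J (π p) = (J p)⁻¹) → (l.map J).prod = 1 := by
  classical
  induction hlen : l.length using Nat.strong_induction_on generalizing l with
  | _ n ih =>
  subst hlen
  by_cases hne : l = []
  · subst hne
    exact ⟨id, Unit, inferInstance, fun _ => (), fun _ => (), (), by simp, by simp, rfl, by simp,
      by simp⟩
  obtain ⟨l₁, p, q, l₂, rfl, hpq⟩ := hl.exists_adjacent_eq hne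
  obtain ⟨hty, hl'⟩ := hl.delete hpq
  have hnd' : (p :: q :: (l₁ ++ l₂)).Nodup := by
    refine (List.Perm.nodup_iff ?_).1 hnd
    exact List.perm_middle.trans (List.Perm.cons p List.perm_middle)
  have hpq' : p ≠ q := by
    rintro rfl
    simp at hnd'
  have hmem : ∀ x, x ∈ l₁ ++ p :: q :: l₂ ↔ x = p ∨ x = q ∨ x ∈ l₁ ++ l₂ := by
    intro x
    simp only [List.mem_append, List.mem_cons]
    tauto
  have hnd2 : (l₁ ++ l₂).Nodup := (List.nodup_cons.1 (List.nodup_cons.1 hnd').2).2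
  have hp : ∀ x ∈ l₁ ++ l₂, x ≠ p := by
    rintro x hx rfl
    exact (List.nodup_cons.1 hnd').1 (List.mem_cons_of_mem _ hx)
  have hq : ∀ x ∈ l₁ ++ l₂, x ≠ q := by
    rintro x hx rfl
    exact (List.nodup_cons.1 (List.nodup_cons.1 hnd').2).1 hx
  obtain ⟨π, N, _, nb, na, root, hπ, hcard, hwalk, hroot, hJ⟩ :=
    ih (l₁ ++ l₂).length (by simp) hnd2 hl' rfl
  obtain ⟨ν, hν1, hν2⟩ := IsNodeWalk.append_iff.1 hwalk
  let nb' : P → Option N := fun x => if x = p then some ν else if x = q then none else some (nb x)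
  let na' : P → Option N := fun x => if x = p then none else if x = q then some ν else some (na x)
  let π' : P → P := fun x => if x = p then q else if x = q then p else π x
  have hnb' : ∀ x ∈ l₁ ++ l₂, nb' x = some (nb x) := fun x hx => by
    simp [nb', hp x hx, hq x hx]
  have hna' : ∀ x ∈ l₁ ++ l₂, na' x = some (na x) := fun x hx => by
    simp [na', hp x hx, hq x hx]
  have hπ' : ∀ x ∈ l₁ ++ l₂, π' x = π x := fun x hx => by
    simp [π', hp x hx, hq x hx]
  have hπp : π' p = q := by simp [π']
  have hπq : π' q = p := by simp [π', hpq'.symm]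
  have hbp : nb' p = some ν := by simp [nb']
  have hbq : nb' q = none := by simp [nb', hpq'.symm]
  have hap : na' p = none := by simp [na']
  have haq : na' q = some ν := by simp [na', hpq'.symm]
  refine ⟨π', Option N, inferInstance, nb', na', some root, ?_, ?_, ?_, ?_, ?_⟩
  · intro x hx
    rcases (hmem x).1 hx with rfl | rfl | hx
    · rw [hπp, hπq, hbq, haq, hap, hbp]
      exact ⟨by simp, rfl, hpq.symm, hty, rfl, rfl⟩
    · rw [hπq, hπp, hbq, haq, hap, hbp]
      exact ⟨by simp, rfl, hpq, by rw [hty, Bool.not_not], rfl, rfl⟩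
    · obtain ⟨h1, h2, h3, h4, h5, h6⟩ := hπ x hx
      rw [hπ' x hx, hπ' _ h1, hnb' _ h1, hna' _ h1, hnb' _ hx, hna' _ hx, h5, h6]
      exact ⟨(hmem _).2 (Or.inr (Or.inr h1)), h2, h3, h4, rfl, rfl⟩
  · rw [Fintype.card_option]
    simp only [List.length_append, List.length_cons] at hcard ⊢
    omega
  · rw [IsNodeWalk.append_iff]
    refine ⟨some ν, hν1.map some (fun x hx => hnb' x (List.mem_append_left _ hx))
      (fun x hx => hna' x (List.mem_append_left _ hx)), hbp, ?_, ?_⟩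
    · rw [hbq, hap]
    · rw [haq]
      exact hν2.map some (fun x hx => hnb' x (List.mem_append_right _ hx))
        (fun x hx => hna' x (List.mem_append_right _ hx))
  · rintro (_ | κ)
    · exact Or.inr ⟨p, by simp, hap⟩
    · rcases hroot κ with rfl | ⟨x, hx, rfl⟩
      · exact Or.inl rfl
      · exact Or.inr ⟨x, (hmem x).2 (Or.inr (Or.inr hx)), hna' x hx⟩
  · intro J hJ'
    have h1 := hJ J fun x hx => by
      rw [← hπ' x hx]
      exact hJ' x ((hmem x).2 (Or.inr (Or.inr hx)))
    have h2 := hJ' p (by simp)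
    rw [hπp] at h2
    rw [List.map_append, List.prod_append] at h1 ⊢
    simpa [h2] using h1

end Folding

section Opposite

/-- Following alternately a fixed-point-free involution `π` and an involution `τ`, one connects the
fixed points of `τ` in pairs. -/
theorem exists_opposite {P : Type*} [Finite P] {π τ : P → P} (hπ : ∀ p, π (π p) = p)
    (hτ : ∀ p, τ (τ p) = p) {ty : P → Bool} (hty : ∀ p, ty (π p) = !ty p)
    (htyτ : ∀ p, τ p ≠ p → ty (τ p) = !ty p) :
    ∃ opp : P → P, ∀ p, τ p = p → τ (opp p) = opp p ∧ opp p ≠ p ∧ opp (opp p) = p ∧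
      ty (opp p) = (!ty p) ∧
      (∀ M : P → Prop, M (π p) → (∀ y, τ y ≠ y → M y → M (π (τ y))) → M (opp p)) ∧
      ∃ β : Set P, p ∈ β ∧ opp p ∈ β ∧ (∀ y ∈ β, π y ∈ β) ∧ (∀ y ∈ β, τ y ∈ β) ∧
        ∀ y ∈ β, τ y = y → y = p ∨ y = opp p := by
  classical
  let θ : Equiv.Perm P := ⟨fun p => π (τ p), fun p => τ (π p), fun p => by simp [hπ, hτ],
    fun p => by simp [hπ, hτ]⟩
  have hθ : ∀ p, θ p = π (τ p) := fun p => rfl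
  have main : ∀ p, τ p = p → ∃ p', τ p' = p' ∧ p' ≠ p ∧ ty p' = (!ty p) ∧
      (∀ M : P → Prop, M (π p) → (∀ y, τ y ≠ y → M y → M (π (τ y))) → M p') ∧
      ∃ β : Set P, p ∈ β ∧ p' ∈ β ∧ (∀ y ∈ β, π y ∈ β) ∧ (∀ y ∈ β, τ y ∈ β) ∧
        ∀ y ∈ β, τ y = y → y = p ∨ y = p' := by
    intro p hp
    have hex : ∃ m, τ ((θ ^ (m + 1)) p) = (θ ^ (m + 1)) p := by
      refine ⟨orderOf θ - 1, ?_⟩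
      rw [Nat.sub_add_cancel (orderOf_pos θ), pow_orderOf_eq_one]
      exact hp
    set m := Nat.find hex with hm
    have hfix : τ ((θ ^ (m + 1)) p) = (θ ^ (m + 1)) p := Nat.find_spec hex
    have hnot : ∀ i < m, τ ((θ ^ (i + 1)) p) ≠ (θ ^ (i + 1)) p := fun i hi => Nat.find_min hex hi
    have hstep : ∀ i, (θ ^ (i + 1)) p = π (τ ((θ ^ i) p)) := fun i => by
      rw [pow_succ', Equiv.Perm.mul_apply, hθ]
    have hstep' : ∀ i, π ((θ ^ (i + 1)) p) = τ ((θ ^ i) p) := fun i => by rw [hstep, hπ]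
    have hM : ∀ M : P → Prop, M (π p) → (∀ y, τ y ≠ y → M y → M (π (τ y))) →
        ∀ i ≤ m, M ((θ ^ (i + 1)) p) := by
      intro M h0 hs i
      induction i with
      | zero =>
        intro _
        rwa [hstep, pow_zero, Equiv.Perm.one_apply, hp]
      | succ i ih =>
        intro hi
        rw [hstep]
        exact hs _ (hnot i hi) (ih (Nat.le_of_succ_le hi))
    have htyp : ty ((θ ^ (m + 1)) p) = !ty p := by
      refine hM (fun y => ty y = !ty p) (hty p) (fun y hy h => ?_) m le_rfl
      rw [hty, htyτ y hy, h, Bool.not_not]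
    refine ⟨(θ ^ (m + 1)) p, hfix, fun h => ?_, htyp, fun M h0 hs => hM M h0 hs m le_rfl,
      {y | ∃ i ≤ m + 1, y = (θ ^ i) p ∨ y = τ ((θ ^ i) p)}, ⟨0, by omega, Or.inl rfl⟩,
      ⟨m + 1, le_rfl, Or.inl rfl⟩, ?_, ?_, ?_⟩
    · rw [h] at htyp
      simp at htyp
    · have hpow : ∀ i ≤ m + 1, ∃ j ≤ m + 1, π ((θ ^ i) p) = (θ ^ j) p ∨
          π ((θ ^ i) p) = τ ((θ ^ j) p) := by
        rintro (_ | i) hi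
        · exact ⟨1, by omega, Or.inl (by rw [pow_one, hθ, hp]; rfl)⟩
        · exact ⟨i, by omega, Or.inr (hstep' i)⟩
      rintro y ⟨i, hi, rfl | rfl⟩
      · exact hpow i hi
      · rcases Nat.lt_or_ge i (m + 1) with h | h
        · exact ⟨i + 1, h, Or.inl (hstep i).symm⟩
        · obtain rfl : i = m + 1 := by omega
          rw [hfix]
          exact hpow _ hi
    · rintro y ⟨i, hi, rfl | rfl⟩
      · exact ⟨i, hi, Or.inr rfl⟩
      · exact ⟨i, hi, Or.inl (hτ _)⟩
    · have hpow : ∀ i ≤ m + 1, τ ((θ ^ i) p) = (θ ^ i) p →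
          (θ ^ i) p = p ∨ (θ ^ i) p = (θ ^ (m + 1)) p := by
        rintro (_ | i) hi h
        · exact Or.inl rfl
        · right
          by_contra h'
          have : i ≠ m := by
            rintro rfl
            exact h' rfl
          exact hnot i (by omega) h
      rintro y ⟨i, hi, rfl | rfl⟩ h
      · exact hpow i hi h
      · rw [hτ] at h
        rw [← h]
        exact hpow i hi h.symm
  choose! opp h1 h2 h3 h4 β h5 h6 h7 h8 h9 using main
  refine ⟨opp, fun p hp => ⟨h1 p hp, h2 p hp, ?_, h3 p hp, h4 p hp, β p, h5 p hp, h6 p hp, h7 p hp,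
    h8 p hp, h9 p hp⟩⟩
  have hmem : opp (opp p) ∈ β p := h4 (opp p) (h1 p hp) (· ∈ β p) (h7 p hp _ (h6 p hp))
    fun y _ hy => h7 p hp _ (h8 p hp y hy)
  exact (h9 p hp _ hmem (h1 _ (h1 p hp))).resolve_right (h2 _ (h1 p hp))

end Opposite

section Graph

variable {N R G : Type*} [DecidableEq N] [Group G]

/-- A finite graph has at least as many acyclic components as the difference of its numbers of
vertices and of edges, and any labelling of the edges has a potential on these components. -/
theorem exists_acyclic_components [Fintype N] (a b : R → N) (q : R → G) (S : Finset R) :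
    ∃ (F : Finset (Finset N)) (z : N → G),
      (∀ C ∈ F, ∀ C' ∈ F, ∀ ν ∈ C, ν ∈ C' → C = C') ∧ (∀ C ∈ F, C.Nonempty) ∧
      (∀ C ∈ F, ∀ ρ ∈ S, a ρ ∈ C ↔ b ρ ∈ C) ∧
      (∀ C ∈ F, (S.filter fun ρ => a ρ ∈ C).card + 1 = C.card) ∧
      (∀ C ∈ F, ∀ ρ ∈ S, a ρ ∈ C → z (b ρ) * q ρ = z (a ρ)) ∧
      Fintype.card N ≤ F.card + S.card := by
  classical
  induction S using Finset.induction_on with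
  | empty =>
    refine ⟨Finset.univ.image fun ν => {ν}, fun _ => 1, ?_, ?_, by simp, ?_, by simp, ?_⟩
    · simp
    · simp
    · simp
    · rw [Finset.card_image_of_injective _ Finset.singleton_injective]
      simp
  | insert ρ S hρ ih =>
    obtain ⟨F, z, hd, hne, hcl, hc, hz, hcard⟩ := ih
    rw [Finset.card_insert_of_notMem hρ]
    by_cases hmerge : ∃ C ∈ F, ∃ C' ∈ F, C ≠ C' ∧ a ρ ∈ C ∧ b ρ ∈ C'
    · obtain ⟨C, hC, C', hC', hCC', haC, hbC'⟩ := hmerge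
      have hdisj : ∀ ν ∈ C, ν ∉ C' := fun ν h h' => hCC' (hd C hC C' hC' ν h h')
      have hF : ∀ D ∈ (F.erase C).erase C', D ∈ F ∧ D ≠ C ∧ D ≠ C' := fun D hD => by
        simp only [Finset.mem_erase] at hD
        exact ⟨hD.2.2, hD.2.1, hD.1⟩
      have hFC : ∀ D ∈ (F.erase C).erase C', ∀ ν ∈ D, ν ∉ C ∧ ν ∉ C' := fun D hD ν hν =>
        ⟨fun h => (hF D hD).2.1 (hd D (hF D hD).1 C hC ν hν h),
          fun h => (hF D hD).2.2 (hd D (hF D hD).1 C' hC' ν hν h)⟩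
      refine ⟨insert (C ∪ C') ((F.erase C).erase C'),
        fun ν => if ν ∈ C then z (b ρ) * q ρ * (z (a ρ))⁻¹ * z ν else z ν, ?_, ?_, ?_, ?_, ?_, ?_⟩
      · intro D hD D' hD' ν hν hν'
        rcases Finset.mem_insert.1 hD with rfl | hD <;>
          rcases Finset.mem_insert.1 hD' with rfl | hD'
        · rfl
        · rcases Finset.mem_union.1 hν with h | h
          · exact absurd h (hFC D' hD' ν hν').1
          · exact absurd h (hFC D' hD' ν hν').2
        · rcases Finset.mem_union.1 hν' with h | h
          · exact absurd h (hFC D hD ν hν).1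
          · exact absurd h (hFC D hD ν hν).2
        · exact hd D (hF D hD).1 D' (hF D' hD').1 ν hν hν'
      · intro D hD
        rcases Finset.mem_insert.1 hD with rfl | hD
        · exact (hne C hC).inl
        · exact hne D (hF D hD).1
      · intro D hD σ hσ
        rcases Finset.mem_insert.1 hD with rfl | hD <;> rcases Finset.mem_insert.1 hσ with rfl | hσ
        · simp [haC, hbC']
        · simp [hcl C hC σ hσ, hcl C' hC' σ hσ]
        · exact iff_of_false (fun h => (hFC D hD _ h).1 haC) fun h => (hFC D hD _ h).2 hbC'
        · exact hcl D (hF D hD).1 σ hσ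
      · intro D hD
        rcases Finset.mem_insert.1 hD with rfl | hD
        · rw [Finset.filter_insert, if_pos (Finset.mem_union_left _ haC),
            Finset.card_insert_of_notMem (by simp [hρ]),
            Finset.card_union_of_disjoint (Finset.disjoint_left.2 hdisj)]
          have h : (S.filter fun σ => a σ ∈ C ∪ C').card =
              (S.filter fun σ => a σ ∈ C).card + (S.filter fun σ => a σ ∈ C').card := by
            rw [← Finset.card_union_of_disjoint, ← Finset.filter_or]
            · simp
            · rw [Finset.disjoint_filter]
              exact fun σ _ h => hdisj _ h
          rw [h, ← hc C hC, ← hc C' hC']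
          omega
        · rw [Finset.filter_insert, if_neg fun h => (hFC D hD _ h).1 haC]
          exact hc D (hF D hD).1
      · intro D hD σ hσ hσD
        beta_reduce
        rcases Finset.mem_insert.1 hσ with rfl | hσ
        · rw [if_neg fun h => hdisj _ h hbC', if_pos haC]
          group
        · have hab : z (b σ) * q σ = z (a σ) := by
            rcases Finset.mem_insert.1 hD with rfl | hD
            · rcases Finset.mem_union.1 hσD with h | h
              · exact hz C hC σ hσ h
              · exact hz C' hC' σ hσ h
            · exact hz D (hF D hD).1 σ hσ hσD
          by_cases h : a σ ∈ C
          · rw [if_pos h, if_pos ((hcl C hC σ hσ).1 h), ← hab]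
            group
          · rw [if_neg h, if_neg fun h' => h ((hcl C hC σ hσ).2 h'), hab]
      · rw [Finset.card_insert_of_notMem]
        · rw [Finset.card_erase_of_mem, Finset.card_erase_of_mem hC]
          · have : 1 < F.card := Finset.one_lt_card.2 ⟨C, hC, C', hC', hCC'⟩
            omega
          · exact Finset.mem_erase.2 ⟨hCC'.symm, hC'⟩
        · intro h
          exact (hFC _ h _ (Finset.mem_union_left _ haC)).1 haC
    · have hF : ∀ D ∈ F.filter (fun D => a ρ ∉ D ∧ b ρ ∉ D), D ∈ F ∧ a ρ ∉ D ∧ b ρ ∉ D :=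
        fun D hD => Finset.mem_filter.1 hD
      refine ⟨F.filter fun D => a ρ ∉ D ∧ b ρ ∉ D, z, ?_, ?_, ?_, ?_, ?_, ?_⟩
      · exact fun D hD D' hD' => hd D (hF D hD).1 D' (hF D' hD').1
      · exact fun D hD => hne D (hF D hD).1
      · intro D hD σ hσ
        rcases Finset.mem_insert.1 hσ with rfl | hσ
        · exact iff_of_false (hF D hD).2.1 (hF D hD).2.2
        · exact hcl D (hF D hD).1 σ hσ
      · intro D hD
        rw [Finset.filter_insert, if_neg (hF D hD).2.1]
        exact hc D (hF D hD).1
      · intro D hD σ hσ hσD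
        rcases Finset.mem_insert.1 hσ with rfl | hσ
        · exact absurd hσD (hF D hD).2.1
        · exact hz D (hF D hD).1 σ hσ hσD
      · have h1 : (F.filter fun D => ¬(a ρ ∉ D ∧ b ρ ∉ D)).card ≤ 1 := by
          rw [Finset.card_le_one]
          push Not at hmerge
          simp only [Finset.mem_filter, not_and_or, not_not]
          rintro D ⟨hD, h⟩ D' ⟨hD', h'⟩
          by_contra hne
          rcases h with h | h <;> rcases h' with h' | h'
          · exact hne (hd D hD D' hD' _ h h')
          · exact hmerge D hD D' hD' hne h h'
          · exact hmerge D' hD' D hD (Ne.symm hne) h' h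
          · exact hne (hd D hD D' hD' _ h h')
        have h2 := Finset.card_filter_add_card_filter_not (s := F) (fun D => a ρ ∉ D ∧ b ρ ∉ D)
        omega

theorem exists_leaf [Fintype R] {a b : R → N} {C : Finset N} (hcl : ∀ ρ, a ρ ∈ C ↔ b ρ ∈ C)
    (hc : (Finset.univ.filter fun ρ => a ρ ∈ C).card + 1 = C.card) :
    ∃ ν ∈ C, ∀ s t : R ⊕ R, Sum.elim a b s = ν → Sum.elim a b t = ν → s = t := by
  classical
  by_contra! hcon
  have h1 : ∀ ν ∈ C, 2 ≤ (Finset.univ.filter fun s : R ⊕ R => Sum.elim a b s = ν).card := by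
    intro ν hν
    obtain ⟨s, t, hs, ht, hst⟩ := hcon ν hν
    exact Finset.one_lt_card.2 ⟨s, by simp [hs], t, by simp [ht], hst⟩
  have h2 := Finset.card_eq_sum_card_fiberwise (f := Sum.elim a b)
    (s := Finset.univ.filter fun s => Sum.elim a b s ∈ C) (t := C) (fun s hs => by simpa using hs)
  have h3 : ∀ ν ∈ C, ((Finset.univ.filter fun s => Sum.elim a b s ∈ C).filter
      fun s => Sum.elim a b s = ν) = Finset.univ.filter fun s => Sum.elim a b s = ν := by
    intro ν hν
    ext s
    simp only [Finset.mem_filter, Finset.mem_univ, true_and, and_iff_right_iff_imp]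
    rintro rfl
    exact hν
  rw [Finset.sum_congr rfl fun ν hν => congrArg Finset.card (h3 ν hν)] at h2
  have h4 := Finset.sum_le_sum h1
  have h5 : (Finset.univ.filter fun s : R ⊕ R => Sum.elim a b s ∈ C).card =
      (Finset.univ.filter fun ρ => a ρ ∈ C).card + (Finset.univ.filter fun ρ => b ρ ∈ C).card := by
    rw [← Finset.card_disjSum]
    congr 1
    ext (s | s) <;> simp
  simp only [← hcl] at h5
  rw [Finset.sum_const, smul_eq_mul] at h4
  omega

end Graph

section Diagram

variable {A : Type} [Group A]

namespace IsTreePath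

variable {P P' : Type*} {e : P → FreeSquare A} {ty : P → Bool}

theorem of_map_eq {e' : P' → FreeSquare A} {ty' : P' → Bool} {i j : Bool} {g h : FreeSquare A}
    {l : List P} {l' : List P'}
    (hll' : l.map (fun p => (e p, ty p)) = l'.map fun p => (e' p, ty' p))
    (hl : IsTreePath e ty i g l j h) : IsTreePath e' ty' i g l' j h := by
  induction l generalizing i g l' with
  | nil =>
    obtain rfl : l' = [] := by simpa using hll'
    exact hl
  | cons p l ih =>
    cases l' with
    | nil => simp at hll'
    | cons p' l' =>
      simp only [List.map_cons, List.cons.injEq, Prod.mk.injEq] at hll'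
      obtain ⟨⟨h1, h2⟩, h3⟩ := hll'
      obtain ⟨h4, h5, h6⟩ := hl
      rw [h1] at h5 h6
      exact ⟨h2 ▸ h4, h5, ih h3 h6⟩

theorem of_ofFn {n : ℕ} {f : Fin n → P} (τ : ℕ → Bool) (v : ℕ → FreeSquare A)
    (hτ : ∀ i, τ (i + 1) = !τ i) (hf : ∀ i : Fin n, ty (f i) = τ i)
    (hb : ∀ i : Fin n, (v i)⁻¹ * e (f i) ∈ (inj (A := A) (τ i)).range)
    (ha : ∀ i : Fin n, (e (f i))⁻¹ * v (i + 1) ∈ (inj (A := A) (τ (i + 1))).range) :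
    IsTreePath e ty (τ 0) (v 0) (List.ofFn f) (τ n) (v n) := by
  induction n generalizing τ v with
  | zero =>
    rw [List.ofFn_zero]
    refine ⟨rfl, ?_⟩
    rw [inv_mul_cancel]
    exact one_mem _
  | succ n ih =>
    rw [List.ofFn_succ]
    refine ⟨hf 0, hb 0, ?_⟩
    rw [← hτ 0]
    refine of_mem_range (g' := v 1) (ha 0) ?_
    exact ih (fun i => τ (i + 1)) (fun i => v (i + 1)) (fun i => hτ (i + 1))
      (fun i => hf i.succ) (fun i => hb i.succ) (fun i => ha i.succ)

theorem flatten {n : ℕ} {f : Fin n → List P} {i : Bool} (v : ℕ → FreeSquare A)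
    (h : ∀ r : Fin n, IsTreePath e ty i (v r) (f r) i (v (r + 1))) :
    IsTreePath e ty i (v 0) (List.ofFn f).flatten i (v n) := by
  induction n generalizing v with
  | zero =>
    refine ⟨rfl, ?_⟩
    rw [inv_mul_cancel]
    exact one_mem _
  | succ n ih =>
    rw [List.ofFn_succ, List.flatten_cons]
    exact append (h 0) (ih (fun r => v (r + 1)) fun r => h r.succ)

end IsTreePath

/-- The edges on the boundary of a planar bouquet of `n` circles of length `K`, the `r`-th of which
is attached along a stem of length `t r`; each stem is traversed twice. -/
inductive BoundaryEdge {n : ℕ} (t : Fin n → ℕ) (K : ℕ) : Type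
  | left (r : Fin n) (i : Fin (t r)) : BoundaryEdge t K
  | circle (r : Fin n) (j : Fin K) : BoundaryEdge t K
  | right (r : Fin n) (i : Fin (t r)) : BoundaryEdge t K

theorem reverse_ofFn {P : Type*} {n : ℕ} (f : Fin n → P) :
    (List.ofFn f).reverse = List.ofFn fun i => f i.rev := by
  refine List.ext_getElem (by simp) fun i h1 h2 => ?_
  simp only [List.getElem_reverse, List.getElem_ofFn, List.length_ofFn]
  congr 1
  ext
  simp only [Fin.val_rev]
  omega

namespace BoundaryEdge

variable {n : ℕ} {t : Fin n → ℕ} {K : ℕ}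

/-- Exchange the two sides of the stems. -/
def swap : BoundaryEdge t K → BoundaryEdge t K
  | left r i => right r i
  | circle r j => circle r j
  | right r i => left r i

/-- The boundary path around the `r`-th circle. -/
def loop (t : Fin n → ℕ) (K : ℕ) (r : Fin n) : List (BoundaryEdge t K) :=
  List.ofFn (left r) ++ (List.ofFn (circle r) ++ List.ofFn fun i => right r i.rev)

theorem mem_flatten_loop (p : BoundaryEdge t K) : p ∈ (List.ofFn (loop t K)).flatten := by
  simp only [List.mem_flatten, List.mem_ofFn, exists_exists_eq_and, loop, List.mem_append]
  match p with
  | left r i => exact ⟨r, Or.inl ⟨i, rfl⟩⟩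
  | circle r j => exact ⟨r, Or.inr (Or.inl ⟨j, rfl⟩)⟩
  | right r i => exact ⟨r, Or.inr (Or.inr ⟨i.rev, by rw [Fin.rev_rev]⟩)⟩

theorem nodup_flatten_loop : (List.ofFn (loop t K)).flatten.Nodup := by
  rw [List.nodup_flatten]
  constructor
  · intro l hl
    obtain ⟨r, rfl⟩ := List.mem_ofFn.1 hl
    simp only [loop, List.nodup_append, List.nodup_ofFn, List.mem_ofFn, List.mem_append]
    refine ⟨fun i j h => by simpa using h, ⟨fun i j h => by simpa using h,
      fun i j h => by simpa using h, ?_⟩, ?_⟩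
    · rintro _ ⟨i, rfl⟩ _ ⟨j, rfl⟩
      simp
    · rintro _ ⟨i, rfl⟩ _ (⟨j, rfl⟩ | ⟨j, rfl⟩) <;> simp
  · rw [List.pairwise_ofFn]
    intro r s hrs
    rw [List.disjoint_left]
    simp only [loop, List.mem_append, List.mem_ofFn]
    rintro _ (⟨i, rfl⟩ | ⟨i, rfl⟩ | ⟨i, rfl⟩) (⟨j, h⟩ | ⟨j, h⟩ | ⟨j, h⟩) <;>
      simp at h <;> exact hrs.ne' h.1

theorem length_flatten_loop :
    (List.ofFn (loop t K)).flatten.length = ∑ r, (2 * t r + K) := by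
  rw [List.length_flatten, List.map_ofFn, List.sum_ofFn]
  refine Finset.sum_congr rfl fun r _ => ?_
  simp [loop]
  ring

instance : Finite (BoundaryEdge t K) :=
  Set.finite_univ_iff.1 ((List.finite_toSet (List.ofFn (loop t K)).flatten).subset
    fun p _ => mem_flatten_loop p)

end BoundaryEdge

open BoundaryEdge

/-- The position, in the cyclic word `altProd x K`, of the `j`-th edge of a circle read in the
direction `ε`. -/
def circlePos (K : ℕ) (ε : Bool) (j : ℕ) : ℕ := bif ε then j + 1 else K - j

/-- A disc diagram over the Bass-Serre tree of `FreeSquare A`, which has a face labelled by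
`altProd x (2 * k)` for each of the given conjugates `q r` of it or of its inverse. Its edges are
identified in pairs by `π`, in such a way that the boundary path becomes the path around a tree with
set of nodes `N`. -/
structure DiscDiagram (x : ℕ → A) (k : ℕ) {n : ℕ} (q : Fin n → FreeSquare A) where
  t : Fin n → ℕ
  N : Type
  [fintype : Fintype N]
  π : BoundaryEdge t (2 * k) → BoundaryEdge t (2 * k)
  nb : BoundaryEdge t (2 * k) → N
  na : BoundaryEdge t (2 * k) → N
  e : BoundaryEdge t (2 * k) → FreeSquare A
  ty : BoundaryEdge t (2 * k) → Bool
  y : Fin n → FreeSquare A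
  ε : Fin n → Bool
  lv : Fin n → ℕ → N
  cv : Fin n → ℕ → N
  rv : Fin n → ℕ → N
  root : N
  q_eq : ∀ r, q r = y r * (bif ε r then altProd x (2 * k) else (altProd x (2 * k))⁻¹) * (y r)⁻¹
  π_π : ∀ p, π (π p) = p
  e_π : ∀ p, e (π p) = e p
  ty_π : ∀ p, ty (π p) = !ty p
  nb_π : ∀ p, nb (π p) = na p
  na_π : ∀ p, na (π p) = nb p
  card_N : Fintype.card N = ∑ r, (t r + k) + 1
  eq_root_or : ∀ ν, ν = root ∨ ∃ p, na p = ν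
  prod_eq_one : ∀ J : BoundaryEdge t (2 * k) → FreeSquare A, (∀ p, J (π p) = (J p)⁻¹) →
    (List.ofFn fun r => ((loop t (2 * k) r).map J).prod).prod = 1
  e_right : ∀ r i, e (right r i) = q r * e (left r i)
  ty_right : ∀ r i, ty (right r i) = !ty (left r i)
  e_circle : ∀ r j, e (circle r j) = y r * altProd x (circlePos (2 * k) (ε r) j)
  ty_circle : ∀ r j, ty (circle r j) = (j : ℕ).bodd
  e_left_ne : ∀ r (i j : Fin (t r)), (i : ℕ) + 1 = j → e (left r i) ≠ e (left r j)
  nb_left : ∀ r i, nb (left r i) = lv r i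
  na_left : ∀ r i, na (left r i) = lv r (i + 1)
  nb_circle : ∀ r j, nb (circle r j) = cv r j
  na_circle : ∀ r j, na (circle r j) = cv r (j + 1)
  nb_right : ∀ r i, nb (right r i) = rv r (i + 1)
  na_right : ∀ r i, na (right r i) = rv r i
  lv_t : ∀ r, lv r (t r) = cv r 0
  rv_t : ∀ r, rv r (t r) = cv r (2 * k)
  lv_zero : ∀ r : Fin n, (r : ℕ) = 0 → lv r 0 = root
  rv_zero : ∀ r : Fin n, (r : ℕ) + 1 = n → rv r 0 = root

theorem isTreePath_circle {P : Type*} {e : P → FreeSquare A} {ty : P → Bool} (x : ℕ → A) (k : ℕ)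
    (ε : Bool) (y : FreeSquare A) (f : Fin (2 * k) → P)
    (he : ∀ j, e (f j) = y * altProd x (circlePos (2 * k) ε j))
    (ht : ∀ j, ty (f j) = (j : ℕ).bodd) :
    IsTreePath e ty false (y * bif ε then 1 else altProd x (2 * k)) (List.ofFn f) false
      (y * bif ε then altProd x (2 * k) else 1) := by
  cases ε with
  | true =>
    have := IsTreePath.of_ofFn (e := e) (ty := ty) (f := f) Nat.bodd (fun i => y * altProd x i)
      (fun i => Nat.bodd_succ i) ht (fun i => ?_) fun i => ?_
    · simpa [altProd] using this
    · rw [he]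
      exact ⟨x i, by simp [circlePos, altProd, mul_assoc]⟩
    · rw [he]
      exact ⟨1, by simp [circlePos]⟩
  | false =>
    have := IsTreePath.of_ofFn (e := e) (ty := ty) (f := f) Nat.bodd
      (fun i => y * altProd x (2 * k - i))
      (fun i => Nat.bodd_succ i) ht (fun i => ?_) fun i => ?_
    · simpa [altProd] using this
    · rw [he]
      exact ⟨1, by simp [circlePos]⟩
    · rw [he]
      obtain ⟨m, hm⟩ : ∃ m, 2 * k - i = m + 1 := ⟨2 * k - i - 1, by omega⟩
      have h1 : 2 * k - (i + 1) = m := by omega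
      have h2 : m.bodd = Nat.bodd (i + 1) := by
        have h3 : m + (i + 1) = 2 * k := by omega
        have h4 := congrArg Nat.bodd h3
        rw [Nat.bodd_add, Nat.bodd_mul] at h4
        rw [Nat.bodd_succ]
        revert h4
        cases m.bodd <;> cases hi : Nat.bodd i <;> simp [hi]
      refine ⟨(x m)⁻¹, ?_⟩
      simp only [circlePos, cond_false, hm, h1, altProd]
      rw [h2, map_inv]
      group

theorem exists_discDiagram {x : ℕ → A} {k n : ℕ} (h : Fin n → FreeSquare A) (ε : Fin n → Bool)
    {q : Fin n → FreeSquare A} {a : A}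
    (hq : ∀ r, q r = h r * (bif ε r then altProd x (2 * k) else (altProd x (2 * k))⁻¹) * (h r)⁻¹)
    (ha : (List.ofFn q).reverse.prod = inj false a) : Nonempty (DiscDiagram x k q) := by
  obtain ⟨u, hu0, hun, hu⟩ : ∃ u : ℕ → FreeSquare A, u 0 = 1 ∧ u n = inj false a ∧
      ∀ r : Fin n, u (r + 1) = q r * u r := by
    refine ⟨fun m => ((List.ofFn q).take m).reverse.prod, by simp, ?_, fun r => ?_⟩
    · rw [← ha]
      beta_reduce
      rw [List.take_of_length_le (by simp)]
    · have : (List.ofFn q).take (r + 1) = (List.ofFn q).take r ++ [q r] := by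
        rw [List.take_succ_eq_append_getElem (by simp)]
        simp
      simp only [this, List.reverse_append, List.prod_append]
      simp
  let z := altProd x (2 * k)
  let y : Fin n → FreeSquare A := fun r => h r * bif ε r then 1 else z⁻¹
  have hy1 : ∀ r, y r * (bif ε r then 1 else z) = h r := fun r => by
    simp only [y]
    cases ε r <;> simp
  have hy2 : ∀ r, y r * (bif ε r then z else 1) = q r * h r := fun r => by
    rw [hq]
    simp only [y]
    cases ε r <;> simp [z]
  choose S hS hSred using fun r : Fin n => exists_reduced_isTreePath ((u r)⁻¹ * h r)
  let t : Fin n → ℕ := fun r => (S r).length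
  let e : BoundaryEdge t (2 * k) → FreeSquare A
    | left r i => u r * (S r)[i].1
    | circle r j => y r * altProd x (circlePos (2 * k) (ε r) j)
    | right r i => q r * (u r * (S r)[i].1)
  let ty : BoundaryEdge t (2 * k) → Bool
    | left r i => (S r)[i].2
    | circle r j => (j : ℕ).bodd
    | right r i => !(S r)[i].2
  have hleft : ∀ r : Fin n, IsTreePath e ty false (u r) (List.ofFn (left r)) false (h r) := by
    intro r
    have h1 := (hS r).map (e' := fun p : FreeSquare A × Bool => u r * p.1) (ty' := Prod.snd) (u r)
      id (fun _ _ => rfl) fun _ _ => rfl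
    rw [mul_one, mul_inv_cancel_left, List.map_id] at h1
    refine h1.of_map_eq ?_
    rw [List.map_ofFn]
    conv_lhs => rw [← List.ofFn_getElem (xs := S r), List.map_ofFn]
    rfl
  have hright : ∀ r : Fin n, IsTreePath e ty false (q r * h r)
      (List.ofFn fun i => right r i.rev) false
      (u (r + 1)) := by
    intro r
    have h1 := (hleft r).map (e' := fun p => e p.swap) (ty' := ty) (q r) id
      (fun p hp => by
        obtain ⟨i, rfl⟩ := List.mem_ofFn.1 hp
        rfl) fun _ _ => rfl
    have h2 := h1.reverse (e' := e) (ty' := ty) swap (fun p hp => rfl) fun p hp => by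
      rw [List.map_id] at hp
      obtain ⟨i, rfl⟩ := List.mem_ofFn.1 hp
      rfl
    rw [List.map_id, List.map_ofFn, ← hu] at h2
    have h3 : (List.ofFn (swap ∘ left r : Fin (t r) → BoundaryEdge t (2 * k))).reverse =
        List.ofFn fun i => right r i.rev := by
      rw [reverse_ofFn]
      rfl
    rwa [h3] at h2
  have hloop : ∀ r : Fin n, IsTreePath e ty false (u r) (loop t (2 * k) r) false (u (r + 1)) := by
    intro r
    have h1 := isTreePath_circle (e := e) (ty := ty) x k (ε r) (y r) (circle r) (fun _ => rfl)
      fun _ => rfl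
    rw [hy1, hy2] at h1
    exact (hleft r).append (h1.append (hright r))
  have hpath := IsTreePath.flatten u hloop
  rw [hu0, hun] at hpath
  obtain ⟨π, N, hN, nb, na, root, hπ, hcard, hwalk, hroot, hJ⟩ :=
    hpath.exists_folding nodup_flatten_loop
  obtain ⟨v, hv0, hvn, hv⟩ := hwalk.exists_nodes_flatten
  simp only [loop, IsNodeWalk.append_iff] at hv
  choose v1 hv1 v2 hv2 hv3 using hv
  choose lv hl0 hlt hlb hla using fun r => (hv1 r).exists_nodes
  choose cv hc0 hct hcb hca using fun r => (hv2 r).exists_nodes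
  choose rv hr0 hrt hrb hra using fun r => (hv3 r).exists_nodes
  simp only [mem_flatten_loop, true_and, forall_const] at hπ hroot hJ
  refine ⟨{
    t := t, N := N, fintype := hN, π := π, nb := nb, na := na, e := e, ty := ty, y := y, ε := ε
    lv := lv, cv := cv, rv := fun r i => rv r (t r - i), root := root
    q_eq := ?_
    π_π := fun p => (hπ p).1
    e_π := fun p => (hπ p).2.1
    ty_π := fun p => (hπ p).2.2.1
    nb_π := fun p => (hπ p).2.2.2.1
    na_π := fun p => (hπ p).2.2.2.2
    card_N := ?_
    eq_root_or := hroot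
    prod_eq_one := ?_
    e_right := fun _ _ => rfl
    ty_right := fun _ _ => rfl
    e_circle := fun _ _ => rfl
    ty_circle := fun _ _ => rfl
    e_left_ne := ?_
    nb_left := hlb
    na_left := hla
    nb_circle := hcb
    na_circle := hca
    nb_right := ?_
    na_right := ?_
    lv_t := fun r => (hlt r).trans (hc0 r).symm
    rv_t := ?_
    lv_zero := ?_
    rv_zero := ?_ }⟩
  · intro r
    rw [hq]
    simp only [y]
    cases ε r <;> simp [z, mul_assoc]
  · rw [length_flatten_loop] at hcard
    have : ∑ r, (2 * t r + 2 * k) = 2 * ∑ r, (t r + k) := by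
      rw [Finset.mul_sum]
      exact Finset.sum_congr rfl fun r _ => by ring
    omega
  · intro J h
    have := hJ J h
    rwa [List.map_flatten, List.prod_flatten, List.map_ofFn, List.map_ofFn] at this
  · rintro r ⟨i, hi⟩ ⟨j, hj⟩ rfl h
    exact List.isChain_iff_getElem.1 (hSred r) i hj (mul_left_cancel h)
  · intro r i
    have := hrb r i.rev
    rwa [Fin.rev_rev, Fin.val_rev] at this
  · intro r i
    have := hra r i.rev
    rw [Fin.rev_rev, Fin.val_rev] at this
    rw [this]
    congr 1
    omega
  · intro r
    rw [Nat.sub_self, hr0, hct]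
  · intro r hr
    rw [hl0, hr, hv0]
  · intro r hr
    rw [Nat.sub_zero, hrt, hr, hvn]

end Diagram

section Products

variable {G : Type*} [Group G]

theorem exists_prod_conj {n : ℕ} (d q : Fin n → G) : ∃ h : Fin n → G,
    (List.ofFn fun r => d r * (q r)⁻¹).prod =
      (List.ofFn fun r => h r * d r * (h r)⁻¹).prod * ((List.ofFn q).reverse.prod)⁻¹ := by
  induction n with
  | zero => exact ⟨fun _ => 1, by simp⟩
  | succ n ih =>
    obtain ⟨h, hh⟩ := ih (fun r => d r.succ) fun r => q r.succ
    refine ⟨Fin.cons 1 fun r => (q 0)⁻¹ * h r, ?_⟩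
    have h1 : (List.ofFn fun r => (q 0)⁻¹ * h r * d r.succ * ((q 0)⁻¹ * h r)⁻¹).prod =
        (q 0)⁻¹ * (List.ofFn fun r => h r * d r.succ * (h r)⁻¹).prod * q 0 := by
      have h2 := map_list_prod (MulAut.conj (q 0)⁻¹) (List.ofFn fun r => h r * d r.succ * (h r)⁻¹)
      rw [List.map_ofFn] at h2
      simp only [MulAut.conj_apply, inv_inv] at h2
      rw [h2]
      congr 2
      funext r
      simp [mul_assoc]
    simp only [List.ofFn_succ, List.prod_cons, Fin.cons_zero, Fin.cons_succ, hh, h1]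
    simp [mul_assoc]

theorem prod_ofFn_conj_inv_rev {n : ℕ} (q : G) (f : Fin n → G) :
    (List.ofFn fun i => q * (f i.rev)⁻¹ * q⁻¹).prod = q * ((List.ofFn f).prod)⁻¹ * q⁻¹ := by
  have h := map_list_prod (MulAut.conj q) (List.ofFn fun i => (f i.rev)⁻¹)
  rw [List.map_ofFn, ← reverse_ofFn (fun i => (f i)⁻¹)] at h
  rw [List.prod_inv_reverse, List.map_ofFn]
  exact h.symm

theorem prod_ofFn_eq {n : ℕ} {f : Fin n → G} (j : Fin n) (h : ∀ i, i ≠ j → f i = 1) :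
    (List.ofFn f).prod = f j := by
  induction n with
  | zero => exact j.elim0
  | succ n ih =>
    rw [List.ofFn_succ, List.prod_cons]
    refine Fin.cases ?_ (fun j => ?_) j (motive := fun j => (∀ i, i ≠ j → f i = 1) →
      f 0 * (List.ofFn fun i => f i.succ).prod = f j) h
    · intro h
      rw [List.prod_eq_one, mul_one]
      intro g hg
      obtain ⟨i, rfl⟩ := List.mem_ofFn.1 hg
      exact h _ (Fin.succ_ne_zero i)
    · intro h
      rw [h 0 (Fin.succ_ne_zero j).symm, one_mul]
      exact ih j fun i hi => h _ fun h' => hi (Fin.succ_injective _ h')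

end Products

section Ties

variable {A : Type} [Group A]

open BoundaryEdge

theorem circlePos_injective {K : ℕ} (ε : Bool) :
    Function.Injective fun j : Fin K => circlePos K ε j := by
  intro i j h
  cases ε <;> simp [circlePos] at h <;> ext <;> omega

theorem DiscDiagram.not_closed_of_minimal {x : ℕ → A} {k n : ℕ} {q : Fin n → FreeSquare A}
    (D : DiscDiagram x k q)
    (hmin : ∀ l : List (FreeSquare A), (∀ g ∈ l, ∃ (h : FreeSquare A) (s : Bool),
      g = h * (bif s then altProd x (2 * k) else (altProd x (2 * k))⁻¹) * h⁻¹) →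
      l.prod = (List.ofFn q).reverse.prod → n ≤ l.length)
    {β : Set (BoundaryEdge D.t (2 * k))} (hπ : ∀ p ∈ β, D.π p ∈ β) (hτ : ∀ p ∈ β, p.swap ∈ β)
    {m : ℕ} (hm : ∀ r j, circle r j ∈ β → circlePos (2 * k) (D.ε r) j = m)
    {r₀ : Fin n} {j₀ : Fin (2 * k)} (h₀ : circle r₀ j₀ ∈ β) : False := by
  classical
  obtain ⟨m, rfl⟩ : ∃ m', m = m' + 1 := by
    refine ⟨m - 1, ?_⟩
    have h1 := hm _ _ h₀
    have h2 := j₀.2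
    revert h1
    cases D.ε r₀ <;> simp only [circlePos, cond_true, cond_false] <;> omega
  let z := altProd x (2 * k)
  let c : BoundaryEdge D.t (2 * k) → FreeSquare A := fun p => D.e p * (altProd x (m + 1))⁻¹
  let J : BoundaryEdge D.t (2 * k) → FreeSquare A := fun p =>
    if p ∈ β then c p * (bif D.ty p == m.bodd then z⁻¹ else z) * (c p)⁻¹ else 1
  have hJπ : ∀ p, J (D.π p) = (J p)⁻¹ := by
    intro p
    have h1 : D.π p ∈ β ↔ p ∈ β := ⟨fun h => D.π_π p ▸ hπ _ h, hπ p⟩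
    by_cases hp : p ∈ β
    · simp only [J, c, if_pos hp, if_pos (h1.2 hp), D.e_π, D.ty_π]
      cases D.ty p <;> cases m.bodd <;> simp [mul_assoc]
    · simp only [J, if_neg hp, if_neg fun h => hp (h1.1 h), inv_one]
  have hJτ : ∀ r i, J (right r i) = q r * (J (left r i))⁻¹ * (q r)⁻¹ := by
    intro r i
    have h1 : right r i ∈ β ↔ left r i ∈ β := ⟨fun h => hτ _ h, fun h => hτ _ h⟩
    by_cases hp : left r i ∈ β
    · simp only [J, c, if_pos hp, if_pos (h1.2 hp), D.e_right, D.ty_right]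
      cases D.ty (left r i) <;> cases m.bodd <;> simp [mul_assoc]
    · simp only [J, if_neg hp, if_neg fun h => hp (h1.1 h), inv_one, mul_one, mul_inv_cancel]
  have hJc : ∀ r j, circle r j ∈ β → J (circle r j) = (q r)⁻¹ := by
    intro r j hp
    have h1 := hm _ _ hp
    simp only [J, c, if_pos hp, D.e_circle, h1, mul_inv_cancel_right, D.ty_circle]
    rw [D.q_eq]
    revert h1
    cases D.ε r with
    | true =>
      intro h1
      obtain rfl : (j : ℕ) = m := by simpa [circlePos] using h1
      simp [z, mul_assoc]
    | false =>
      intro h1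
      have h2 : (j : ℕ) + (m + 1) = 2 * k := by
        simp [circlePos] at h1
        omega
      have h3 := congrArg Nat.bodd h2
      have h4 : Nat.bodd j = !m.bodd := by
        rw [Nat.bodd_add, Nat.bodd_mul, Nat.bodd_succ] at h3
        revert h3
        cases Nat.bodd j <;> cases m.bodd <;> simp
      rw [h4]
      cases m.bodd <;> simp [z, mul_assoc]
  let Y : Fin n → FreeSquare A := fun r => (List.ofFn fun j => J (circle r j)).prod
  have hYβ : ∀ r j, circle r j ∈ β → Y r = (q r)⁻¹ := by
    intro r j hp
    rw [← hJc r j hp]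
    refine prod_ofFn_eq j fun i hi => if_neg fun hp' => hi ?_
    exact circlePos_injective (D.ε r) ((hm _ _ hp').trans (hm _ _ hp).symm)
  have hY1 : ∀ r, (∀ j, circle r j ∉ β) → Y r = 1 := by
    intro r hr
    refine List.prod_eq_one fun g hg => ?_
    obtain ⟨j, rfl⟩ := List.mem_ofFn.1 hg
    exact if_neg (hr j)
  let d : Fin n → FreeSquare A := fun r => (List.ofFn fun i => J (left r i)).prod * (Y r * q r) *
    ((List.ofFn fun i => J (left r i)).prod)⁻¹
  have hloop : ∀ r, ((loop D.t (2 * k) r).map J).prod = d r * (q r)⁻¹ := by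
    intro r
    rw [loop, List.map_append, List.map_append, List.prod_append, List.prod_append, List.map_ofFn,
      List.map_ofFn, List.map_ofFn]
    have h1 : (List.ofFn (J ∘ fun i => right r i.rev)).prod = _ :=
      (congrArg (fun f => (List.ofFn f).prod) (funext fun i => hJτ r i.rev)).trans
        (prod_ofFn_conj_inv_rev (q r) fun i => J (left r i))
    rw [h1]
    simp only [d, Y, mul_assoc]
    rfl
  have hprod := D.prod_eq_one J hJπ
  simp only [hloop] at hprod
  obtain ⟨h, hh⟩ := exists_prod_conj d q
  rw [hprod, eq_comm, mul_inv_eq_one] at hh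
  have hd0 : d r₀ = 1 := by simp only [d, hYβ r₀ j₀ h₀, inv_mul_cancel, mul_one, mul_inv_cancel]
  have hlen := hmin ((List.ofFn fun r => h r * d r * (h r)⁻¹).filter fun g => g != 1) ?_ ?_
  · have : ((List.ofFn fun r => h r * d r * (h r)⁻¹).filter fun g => g != 1).length <
        (List.ofFn fun r => h r * d r * (h r)⁻¹).length := by
      rw [List.length_filter_lt_length_iff_exists]
      exact ⟨_, List.mem_ofFn.2 ⟨r₀, rfl⟩, by simp [hd0]⟩
    rw [List.length_ofFn] at this
    omega
  · intro g hg
    obtain ⟨hg1, hg2⟩ := List.mem_filter.1 hg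
    obtain ⟨r, rfl⟩ := List.mem_ofFn.1 hg1
    have hr : ∀ j, circle r j ∉ β := by
      intro j hj
      simp [d, hYβ r j hj] at hg2
    refine ⟨h r * (List.ofFn fun i => J (left r i)).prod * D.y r, D.ε r, ?_⟩
    simp only [d]
    rw [hY1 r hr, one_mul]
    conv_lhs => rw [D.q_eq r]
    simp only [mul_inv_rev, mul_assoc]
  · rw [← hh]
    exact List.prod_filter_bne_one _

end Ties

section Corners

variable {A : Type} [Group A]

open BoundaryEdge

namespace DiscDiagram

variable {x : ℕ → A} {k n : ℕ} {q : Fin n → FreeSquare A}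

instance (D : DiscDiagram x k q) : Fintype D.N := D.fintype

/-- The position of an edge of a circle in the word `altProd x (2 * k)`. -/
def pos (D : DiscDiagram x k q) (p : Fin n × Fin (2 * k)) : ℕ := circlePos (2 * k) (D.ε p.1) p.2

theorem pos_mem (D : DiscDiagram x k q) (p : Fin n × Fin (2 * k)) :
    1 ≤ D.pos p ∧ D.pos p ≤ 2 * k := by
  have := p.2.2
  simp only [pos, circlePos]
  cases D.ε p.1 <;> simp only [cond_true, cond_false] <;> omega

theorem exists_pos_eq (D : DiscDiagram x k q) (r : Fin n) {m : ℕ} (h1 : 1 ≤ m) (h2 : m ≤ 2 * k) :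
    ∃ j, D.pos (r, j) = m := by
  cases h : D.ε r with
  | true => exact ⟨⟨m - 1, by omega⟩, by simp only [pos, circlePos, h, cond_true]; omega⟩
  | false => exact ⟨⟨2 * k - m, by omega⟩, by simp only [pos, circlePos, h, cond_false]; omega⟩

theorem exists_opposite (D : DiscDiagram x k q)
    (hmin : ∀ l : List (FreeSquare A), (∀ g ∈ l, ∃ (h : FreeSquare A) (s : Bool),
      g = h * (bif s then altProd x (2 * k) else (altProd x (2 * k))⁻¹) * h⁻¹) →
      l.prod = (List.ofFn q).reverse.prod → n ≤ l.length) :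
    ∃ o : Fin n × Fin (2 * k) → Fin n × Fin (2 * k), ∀ p, o (o p) = p ∧ D.pos (o p) ≠ D.pos p ∧
      ∀ M : BoundaryEdge D.t (2 * k) → Prop, M (D.π (circle p.1 p.2)) →
        (∀ y, swap y ≠ y → M y → M (D.π (swap y))) → M (circle (o p).1 (o p).2) := by
  obtain ⟨opp, hopp⟩ := _root_.exists_opposite (τ := swap) (ty := D.ty) D.π_π
    (fun p => by cases p <;> rfl) D.ty_π (fun p hp => by
      cases p with
      | left r i => exact D.ty_right r i
      | circle r j => exact absurd rfl hp
      | right r i => simp [swap, D.ty_right])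
  have hC : ∀ p : BoundaryEdge D.t (2 * k), p.swap = p → ∃ c : Fin n × Fin (2 * k),
      p = circle c.1 c.2 := by
    intro p hp
    cases p with
    | left r i => simp [swap] at hp
    | circle r j => exact ⟨(r, j), rfl⟩
    | right r i => simp [swap] at hp
  choose o ho using fun c : Fin n × Fin (2 * k) => hC _ (hopp (circle c.1 c.2) rfl).1
  refine ⟨o, fun p => ?_⟩
  obtain ⟨-, h2, h3, -, h5, β, h6, h7, h8, h9, h10⟩ := hopp (circle p.1 p.2) rfl
  refine ⟨?_, fun hpos => ?_, fun M => ?_⟩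
  · rw [ho p, ho (o p)] at h3
    simp only [circle.injEq] at h3
    exact Prod.ext h3.1 h3.2
  · refine D.not_closed_of_minimal hmin h8 h9 (m := D.pos p) ?_ h6
    intro r j hrj
    rcases h10 _ hrj rfl with h | h
    · simp only [circle.injEq] at h
      rw [h.1, h.2]
      rfl
    · rw [ho p] at h
      simp only [circle.injEq] at h
      rw [h.1, h.2, ← hpos]
      rfl
  · rw [← ho p]
    exact h5 M

/-- The terminal node of an edge if `s` is true, its initial node otherwise. -/
def node (D : DiscDiagram x k q) (p : BoundaryEdge D.t (2 * k)) (s : Bool) : D.N :=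
  bif s then D.na p else D.nb p

theorem node_π (D : DiscDiagram x k q) (p : BoundaryEdge D.t (2 * k)) (s : Bool) :
    D.node (D.π p) s = D.node p !s := by
  cases s
  · exact D.nb_π p
  · exact D.na_π p

/-- The nodes on the two sides of the stems. -/
def stemNode (D : DiscDiagram x k q) :
    (Σ r, Fin (D.t r + 1)) ⊕ (Σ r, Fin (D.t r + 1)) → D.N :=
  Sum.elim (fun ρ => D.lv ρ.1 ρ.2) fun ρ => D.rv ρ.1 ρ.2

/-- An acyclic component `C` of the graph joining corresponding nodes of the two sides of the stems,
with a potential `z`. -/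
structure IsComponent (D : DiscDiagram x k q) (C : Finset D.N) (z : D.N → FreeSquare A) :
    Prop where
  nonempty : C.Nonempty
  mem_iff : ∀ r i, i ≤ D.t r → (D.lv r i ∈ C ↔ D.rv r i ∈ C)
  z_eq : ∀ r i, i ≤ D.t r → D.lv r i ∈ C → z (D.rv r i) * q r = z (D.lv r i)
  exists_leaf : ∃ ν ∈ C, ∀ s t, D.stemNode s = ν → D.stemNode t = ν → s = t

theorem exists_components (D : DiscDiagram x k q) : ∃ (F : Finset (Finset D.N))
    (z : D.N → FreeSquare A), (∀ C ∈ F, ∀ C' ∈ F, ∀ ν ∈ C, ν ∈ C' → C = C') ∧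
      (∀ C ∈ F, D.IsComponent C z) ∧ k * n + 1 ≤ F.card + n := by
  classical
  obtain ⟨F, z, h1, h2, h3, h4, h5, h6⟩ := exists_acyclic_components
    (fun ρ : Σ r, Fin (D.t r + 1) => D.lv ρ.1 ρ.2) (fun ρ => D.rv ρ.1 ρ.2) (fun ρ => q ρ.1)
    Finset.univ
  refine ⟨F, z, h1, fun C hC => ⟨h2 C hC, fun r i hi => ?_, fun r i hi => ?_, ?_⟩, ?_⟩
  · exact h3 C hC ⟨r, ⟨i, Nat.lt_succ_of_le hi⟩⟩ (Finset.mem_univ _)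
  · exact h5 C hC ⟨r, ⟨i, Nat.lt_succ_of_le hi⟩⟩ (Finset.mem_univ _)
  · exact _root_.exists_leaf (fun ρ => h3 C hC ρ (Finset.mem_univ _)) (h4 C hC)
  · rw [D.card_N, Finset.card_univ, Fintype.card_sigma] at h6
    simp only [Fintype.card_fin, Finset.sum_add_distrib, Finset.sum_const, Finset.card_univ,
      smul_eq_mul, mul_one] at h6
    rw [mul_comm n k] at h6
    omega

namespace IsComponent

variable {D : DiscDiagram x k q} {C : Finset D.N} {z : D.N → FreeSquare A}

theorem exists_circle (hC : D.IsComponent C z) (hn : 0 < n) :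
    ∃ r j s, D.node (circle r j) s ∈ C := by
  by_contra! hcon
  obtain ⟨ν, hν, hleaf⟩ := hC.exists_leaf
  have hl : ∀ r i, D.na (left r i) = ν → ∀ s, D.stemNode s = ν → s = Sum.inl ⟨r, i.succ⟩ :=
    fun r i h s hs =>
    hleaf _ _ hs (by rw [← h, D.na_left]; rfl)
  have hr : ∀ r i, D.na (right r i) = ν → ∀ s, D.stemNode s = ν → s = Sum.inr ⟨r, i.castSucc⟩ :=
    fun r i h s hs =>
    hleaf _ _ hs (by rw [← h, D.na_right]; rfl)
  rcases D.eq_root_or ν with rfl | ⟨p, hp⟩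
  · have h1 := hleaf (Sum.inl ⟨⟨0, hn⟩, 0⟩) (Sum.inr ⟨⟨n - 1, by omega⟩, 0⟩) (D.lv_zero _ rfl)
      (D.rv_zero _ (by simp only; omega))
    simp at h1
  · have hp' : D.nb (D.π p) = ν := by rw [D.nb_π, hp]
    have he := D.e_π p
    generalize D.π p = p' at hp' he
    cases p with
    | circle r j => exact hcon r j true (show D.na (circle r j) ∈ C from hp ▸ hν)
    | left r i =>
      cases p' with
      | circle r' j => exact hcon r' j false (show D.nb (circle r' j) ∈ C from hp' ▸ hν)
      | left r' i' =>
        have h1 := hl r i hp (Sum.inl ⟨r', i'.castSucc⟩) (by rw [← hp', D.nb_left]; rfl)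
        simp only [Sum.inl.injEq, Sigma.mk.injEq] at h1
        obtain ⟨rfl, h1⟩ := h1
        refine D.e_left_ne r' i i' ?_ he.symm
        have := congrArg Fin.val (eq_of_heq h1)
        simpa using this.symm
      | right r' i' =>
        have h1 := hl r i hp (Sum.inr ⟨r', i'.succ⟩) (by rw [← hp', D.nb_right]; rfl)
        simp at h1
    | right r i =>
      cases p' with
      | circle r' j => exact hcon r' j false (show D.nb (circle r' j) ∈ C from hp' ▸ hν)
      | left r' i' =>
        have h1 := hr r i hp (Sum.inl ⟨r', i'.castSucc⟩) (by rw [← hp', D.nb_left]; rfl)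
        simp at h1
      | right r' i' =>
        have h1 := hr r i hp (Sum.inr ⟨r', i'.succ⟩) (by rw [← hp', D.nb_right]; rfl)
        simp only [Sum.inr.injEq, Sigma.mk.injEq] at h1
        obtain ⟨rfl, h1⟩ := h1
        rw [D.e_right, D.e_right] at he
        refine D.e_left_ne r' i' i ?_ (mul_left_cancel he)
        have := congrArg Fin.val (eq_of_heq h1)
        simpa using this

theorem swap_mem (hC : D.IsComponent C z) {p : BoundaryEdge D.t (2 * k)} {s : Bool}
    (hp : p.swap ≠ p) (h : D.node p s ∈ C) :
    D.node p.swap (!s) ∈ C ∧ z (D.node p.swap !s) * D.e p.swap = z (D.node p s) * D.e p := by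
  cases p with
  | circle r j => exact absurd rfl hp
  | left r i =>
    cases s
    · simp only [node, cond_false, D.nb_left] at h
      simp only [node, swap, Bool.not_false, cond_true, cond_false, D.nb_left, D.na_right,
        D.e_right, ← hC.z_eq r i i.2.le h, ← mul_assoc, and_true]
      exact (hC.mem_iff r i i.2.le).1 h
    · simp only [node, cond_true, D.na_left] at h
      simp only [node, swap, Bool.not_true, cond_true, cond_false, D.na_left, D.nb_right,
        D.e_right, ← hC.z_eq r (i + 1) i.2 h, ← mul_assoc, and_true]
      exact (hC.mem_iff r _ i.2).1 h
  | right r i =>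
    cases s
    · simp only [node, cond_false, D.nb_right] at h
      have h' := (hC.mem_iff r _ i.2).2 h
      simp only [node, swap, Bool.not_false, cond_true, cond_false, D.na_left, D.nb_right,
        D.e_right, ← hC.z_eq r (i + 1) i.2 h', ← mul_assoc, and_true]
      exact h'
    · simp only [node, cond_true, D.na_right] at h
      have h' := (hC.mem_iff r _ i.2.le).2 h
      simp only [node, swap, Bool.not_true, cond_true, cond_false, D.nb_left, D.na_right,
        D.e_right, ← hC.z_eq r i i.2.le h', ← mul_assoc, and_true]
      exact h'

end IsComponent

/-- The edge following the `j`-th one on a circle. -/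
def next (j : Fin (2 * k)) : Fin (2 * k) := ⟨(j + 1) % (2 * k), Nat.mod_lt _ j.pos⟩

theorem exists_next_eq (j : Fin (2 * k)) : ∃ i, next i = j := by
  have hj := j.2
  rcases Nat.eq_zero_or_pos (j : ℕ) with h | h
  · refine ⟨⟨2 * k - 1, by omega⟩, Fin.ext ?_⟩
    simp only [next]
    rw [Nat.sub_add_cancel (by omega), Nat.mod_self, h]
  · refine ⟨⟨j - 1, by omega⟩, Fin.ext ?_⟩
    simp only [next]
    rw [Nat.sub_add_cancel h, Nat.mod_eq_of_lt hj]

theorem exists_and_not_next {f : Fin (2 * k) → Prop} (h1 : ∃ j, f j) (h2 : ∃ j, ¬f j) :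
    ∃ j, f j ∧ ¬f (next j) := by
  by_contra! hcon
  obtain ⟨a, ha⟩ := h1
  obtain ⟨b, hb⟩ := h2
  have hpos := a.pos
  have key : ∀ i : ℕ, f ⟨(a + i) % (2 * k), Nat.mod_lt _ hpos⟩ := by
    intro i
    induction i with
    | zero =>
      have h3 : (⟨(a + 0) % (2 * k), Nat.mod_lt _ hpos⟩ : Fin (2 * k)) = a :=
        Fin.ext (Nat.mod_eq_of_lt a.2)
      rwa [h3]
    | succ i ih =>
      have h3 := hcon _ ih
      simp only [next, Nat.mod_add_mod, add_assoc] at h3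
      exact h3
  have h3 : (⟨(a + (2 * k - a + b)) % (2 * k), Nat.mod_lt _ hpos⟩ : Fin (2 * k)) = b := by
    have h4 : (a : ℕ) + (2 * k - a + b) = 2 * k + b := by omega
    simp only [h4, Nat.add_mod_left, Nat.mod_eq_of_lt b.2]
  exact hb (h3 ▸ key (2 * k - a + b))

end DiscDiagram

end Corners

theorem Finset.exists_forall_rel {ι : Type*} {r : ι → ι → Prop} (htot : ∀ s t, r s t ∨ r t s)
    (htrans : ∀ s t u, r s t → r t u → r s u) {S : Finset ι} (hS : S.Nonempty) :
    ∃ s ∈ S, ∀ t ∈ S, r t s := by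
  classical
  induction hS using Finset.Nonempty.cons_induction with
  | singleton a => exact ⟨a, by simp, by simpa using htot a a⟩
  | cons a S ha hS ih =>
    obtain ⟨s, hs, h⟩ := ih
    rcases htot a s with has | hsa
    · refine ⟨s, Finset.mem_cons_of_mem hs, fun t ht => ?_⟩
      rcases Finset.mem_cons.1 ht with rfl | ht
      · exact has
      · exact h t ht
    · refine ⟨a, Finset.mem_cons_self a S, fun t ht => ?_⟩
      rcases Finset.mem_cons.1 ht with rfl | ht
      · simpa using htot t t
      · exact htrans _ _ _ (h t ht) hsa

section Counting

variable {A : Type} [Group A]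

open BoundaryEdge

namespace DiscDiagram

variable {x : ℕ → A} {k n : ℕ} {q : Fin n → FreeSquare A} {D : DiscDiagram x k q}
  {C : Finset D.N} {z : D.N → FreeSquare A}

namespace IsComponent

theorem opposite_mem (hC : D.IsComponent C z) {p p' : Fin n × Fin (2 * k)} {s : Bool}
    (hp' : ∀ M : BoundaryEdge D.t (2 * k) → Prop, M (D.π (circle p.1 p.2)) →
      (∀ y, swap y ≠ y → M y → M (D.π (swap y))) → M (circle p'.1 p'.2))
    (h : D.node (circle p.1 p.2) s ∈ C) : D.node (circle p'.1 p'.2) (!s) ∈ C ∧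
      z (D.node (circle p'.1 p'.2) !s) * D.e (circle p'.1 p'.2) =
        z (D.node (circle p.1 p.2) s) * D.e (circle p.1 p.2) := by
  refine hp' (fun y => D.node y (!s) ∈ C ∧ z (D.node y !s) * D.e y =
    z (D.node (circle p.1 p.2) s) * D.e (circle p.1 p.2)) ?_ ?_
  · rw [D.node_π, Bool.not_not, D.e_π]
    exact ⟨h, rfl⟩
  · rintro y hy ⟨h1, h2⟩
    obtain ⟨h3, h4⟩ := hC.swap_mem hy h1
    rw [D.node_π, D.e_π]
    exact ⟨h3, h4.trans h2⟩

theorem corner (hC : D.IsComponent C z) (r : Fin n) (j : Fin (2 * k)) :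
    (D.node (circle r j) true ∈ C ↔ D.node (circle r (next j)) false ∈ C) ∧
      (D.node (circle r j) true ∈ C →
        (z (D.node (circle r j) true) * D.y r)⁻¹ * (z (D.node (circle r (next j)) false) * D.y r) ∈
          Subgroup.zpowers (altProd x (2 * k))) := by
  simp only [node, cond_true, cond_false, D.na_circle, D.nb_circle, next]
  rcases Nat.lt_or_ge (j + 1) (2 * k) with h | h
  · rw [Nat.mod_eq_of_lt h, inv_mul_cancel]
    exact ⟨Iff.rfl, fun _ => one_mem _⟩
  · have h1 : (j : ℕ) + 1 = 2 * k := by omega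
    rw [h1, Nat.mod_self, ← D.lv_t, ← D.rv_t]
    have h2 := hC.mem_iff r _ le_rfl
    refine ⟨h2.symm, fun h3 => ?_⟩
    rw [← hC.z_eq r _ le_rfl (h2.2 h3)]
    have h4 : (z (D.rv r (D.t r)) * D.y r)⁻¹ * (z (D.rv r (D.t r)) * q r * D.y r) =
        (D.y r)⁻¹ * q r * D.y r := by group
    have h5 : (D.y r)⁻¹ * q r * D.y r =
        bif D.ε r then altProd x (2 * k) else (altProd x (2 * k))⁻¹ := by
      conv_lhs => rw [D.q_eq r]
      group
    rw [h4, h5]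
    cases D.ε r
    · exact inv_mem (Subgroup.mem_zpowers _)
    · exact Subgroup.mem_zpowers _

theorem exists_corner (hC : D.IsComponent C z) (hn : 0 < n)
    {o : Fin n × Fin (2 * k) → Fin n × Fin (2 * k)}
    (ho : ∀ p, ∀ M : BoundaryEdge D.t (2 * k) → Prop, M (D.π (circle p.1 p.2)) →
      (∀ y, swap y ≠ y → M y → M (D.π (swap y))) → M (circle (o p).1 (o p).2))
    {Q : Submonoid (FreeSquare A)} (hQ : Q.IsTotal)
    (hzQ : ∀ g ∈ Subgroup.zpowers (altProd x (2 * k)), g ∈ Q) :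
    ∃ p : Fin n × Fin (2 * k), D.node (circle p.1 p.2) true ∈ C ∧
      altProd x (D.pos (o p)) * (altProd x (D.pos p))⁻¹ ∈ Q ∧
      altProd x (D.pos (o (p.1, next p.2))) * (altProd x (D.pos (p.1, next p.2)))⁻¹ ∈ Q := by
  classical
  let ht : (Fin n × Fin (2 * k)) × Bool → FreeSquare A := fun f =>
    z (D.node (circle f.1.1 f.1.2) f.2) * D.y f.1.1
  have hht : ∀ f, ht f = z (D.node (circle f.1.1 f.1.2) f.2) * D.e (circle f.1.1 f.1.2) *
      (altProd x (D.pos f.1))⁻¹ := by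
    intro f
    simp only [ht, D.e_circle, pos]
    group
  let S : Finset ((Fin n × Fin (2 * k)) × Bool) :=
    Finset.univ.filter fun f => D.node (circle f.1.1 f.1.2) f.2 ∈ C
  have hS : ∀ f, f ∈ S ↔ D.node (circle f.1.1 f.1.2) f.2 ∈ C := fun f => by simp [S]
  have htrans : ∀ a b c : FreeSquare A, a⁻¹ * b ∈ Q → b⁻¹ * c ∈ Q → a⁻¹ * c ∈ Q := by
    intro a b c h1 h2
    have := mul_mem h1 h2
    rwa [mul_assoc, mul_inv_cancel_left] at this
  have htot : ∀ a b : FreeSquare A, a⁻¹ * b ∈ Q ∨ b⁻¹ * a ∈ Q := by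
    intro a b
    have := hQ (a⁻¹ * b)
    rwa [mul_inv_rev, inv_inv] at this
  obtain ⟨r, j, s, hrjs⟩ := hC.exists_circle hn
  obtain ⟨f, hfS, hf⟩ := Finset.exists_forall_rel (r := fun f g => (ht f)⁻¹ * ht g ∈ Q)
    (fun f g => htot _ _)
    (fun f g h => htrans _ _ _) (S := S) ⟨((r, j), s), (hS _).2 hrjs⟩
  have hplus : ∀ g ∈ S, (∀ g' ∈ S, (ht g')⁻¹ * ht g ∈ Q) →
      altProd x (D.pos (o g.1)) * (altProd x (D.pos g.1))⁻¹ ∈ Q := by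
    intro g hg hmax
    obtain ⟨h1, h2⟩ := hC.opposite_mem (ho g.1) ((hS g).1 hg)
    have h3 := hmax (o g.1, !g.2) ((hS _).2 h1)
    rw [hht, hht, h2] at h3
    convert h3 using 1
    group
  obtain ⟨p, hp⟩ : ∃ p : Fin n × Fin (2 * k), f = (p, true) ∨ f = ((p.1, next p.2), false) := by
    obtain ⟨⟨r, j⟩, s⟩ := f
    cases s
    · obtain ⟨i, rfl⟩ := exists_next_eq j
      exact ⟨(r, i), Or.inr rfl⟩
    · exact ⟨(r, j), Or.inl rfl⟩
  obtain ⟨h1, h2⟩ := hC.corner p.1 p.2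
  have hmem : D.node (circle p.1 p.2) true ∈ C := by
    rcases hp with rfl | rfl
    · exact (hS _).1 hfS
    · exact h1.2 ((hS _).1 hfS)
  have hK := h2 hmem
  have hK' := inv_mem hK
  rw [mul_inv_rev, inv_inv] at hK'
  refine ⟨p, hmem, hplus (p, true) ((hS _).2 hmem) fun g hg => ?_,
    hplus ((p.1, next p.2), false) ((hS _).2 (h1.1 hmem)) fun g hg => ?_⟩
  · rcases hp with rfl | rfl
    · exact hf g hg
    · exact htrans _ _ _ (hf g hg) (hzQ _ hK')
  · rcases hp with rfl | rfl
    · exact htrans _ _ _ (hf g hg) (hzQ _ hK)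
    · exact hf g hg

end IsComponent

theorem not_minimal (D : DiscDiagram x k q) (hn : 0 < n) (hk : 0 < k)
    {Q : Submonoid (FreeSquare A)} (hQ : Q.IsTotal)
    (hQK : ∀ g, g ∈ Q ∧ g⁻¹ ∈ Q ↔ g ∈ Subgroup.zpowers (altProd x (2 * k)))
    (hdist : ∀ i j, 1 ≤ i → i < j → j ≤ 2 * k →
      altProd x j * (altProd x i)⁻¹ ∉ Subgroup.zpowers (altProd x (2 * k))) :
    ∃ l : List (FreeSquare A), (∀ g ∈ l, ∃ (h : FreeSquare A) (s : Bool),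
      g = h * (bif s then altProd x (2 * k) else (altProd x (2 * k))⁻¹) * h⁻¹) ∧
      l.prod = (List.ofFn q).reverse.prod ∧ l.length < n := by
  classical
  by_contra! hmin
  obtain ⟨o, ho⟩ := D.exists_opposite hmin
  obtain ⟨F, z, hF1, hF2, hF3⟩ := D.exists_components
  have hKQ : ∀ g ∈ Subgroup.zpowers (altProd x (2 * k)), g ∈ Q := fun g hg => ((hQK g).2 hg).1
  let plus : Fin n × Fin (2 * k) → Prop := fun p =>
    altProd x (D.pos (o p)) * (altProd x (D.pos p))⁻¹ ∈ Q
  have hne : ∀ p p', D.pos p' ≠ D.pos p → altProd x (D.pos p') * (altProd x (D.pos p))⁻¹ ∈ Q →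
      altProd x (D.pos p) * (altProd x (D.pos p'))⁻¹ ∉ Q := by
    intro p p' hpp h1 h2
    obtain ⟨h3, h4⟩ := D.pos_mem p
    obtain ⟨h5, h6⟩ := D.pos_mem p'
    rcases Nat.lt_or_gt_of_ne hpp with h | h
    · exact hdist _ _ h5 h h4 ((hQK _).1 ⟨h2, by rwa [mul_inv_rev, inv_inv]⟩)
    · exact hdist _ _ h3 h h6 ((hQK _).1 ⟨h1, by rwa [mul_inv_rev, inv_inv]⟩)
  have htot : ∀ p p', altProd x (D.pos p') * (altProd x (D.pos p))⁻¹ ∈ Q ∨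
      altProd x (D.pos p) * (altProd x (D.pos p'))⁻¹ ∈ Q := by
    intro p p'
    have := hQ (altProd x (D.pos p') * (altProd x (D.pos p))⁻¹)
    rwa [mul_inv_rev, inv_inv] at this
  have htrans : ∀ p p' p'', altProd x (D.pos p) * (altProd x (D.pos p'))⁻¹ ∈ Q →
      altProd x (D.pos p') * (altProd x (D.pos p''))⁻¹ ∈ Q →
      altProd x (D.pos p) * (altProd x (D.pos p''))⁻¹ ∈ Q := by
    intro p p' p'' h1 h2
    have := mul_mem h1 h2
    rwa [mul_assoc, inv_mul_cancel_left] at this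
  have hplus : ∀ p, plus (o p) ↔ ¬plus p := by
    intro p
    simp only [plus, (ho p).1]
    exact ⟨fun h h' => hne _ _ (ho p).2.1 h' h, fun h => (htot _ _).resolve_left h⟩
  have hcard : (Finset.univ.filter plus).card = k * n := by
    have h1 : (Finset.univ.filter plus).card = (Finset.univ.filter fun p => ¬plus p).card := by
      refine Finset.card_nbij' o o ?_ ?_ (fun p _ => (ho p).1) fun p _ => (ho p).1
      · intro p hp
        simp only [Finset.coe_filter, Finset.mem_univ, true_and, Set.mem_ofPred_eq] at hp ⊢
        exact fun h => (hplus p).1 h hp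
      · intro p hp
        simp only [Finset.coe_filter, Finset.mem_univ, true_and, Set.mem_ofPred_eq] at hp ⊢
        exact (hplus p).2 hp
    have h2 := Finset.card_filter_add_card_filter_not (s := Finset.univ) plus
    rw [← h1, Finset.card_univ, Fintype.card_prod, Fintype.card_fin, Fintype.card_fin] at h2
    have : n * (2 * k) = 2 * (k * n) := by ring
    omega
  have hcell : ∀ r, ∃ j, plus (r, j) ∧ ¬plus (r, next j) := by
    intro r
    have hne' : (Finset.univ : Finset (Fin (2 * k))).Nonempty := ⟨⟨0, by omega⟩, Finset.mem_univ _⟩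
    have hsurj : ∀ p, ∃ j, D.pos (r, j) = D.pos (o p) := fun p =>
      D.exists_pos_eq r (D.pos_mem _).1 (D.pos_mem _).2
    refine exists_and_not_next ?_ ?_
    · obtain ⟨j, -, hj⟩ := Finset.exists_forall_rel (r := fun i j => altProd x (D.pos (r, i)) *
        (altProd x (D.pos (r, j)))⁻¹ ∈ Q) (fun i j => htot _ _) (fun i j l => htrans _ _ _) hne'
      obtain ⟨i, hi⟩ := hsurj (r, j)
      refine ⟨j, ?_⟩
      simp only [plus, ← hi]
      exact hj i (Finset.mem_univ i)
    · obtain ⟨j, -, hj⟩ := Finset.exists_forall_rel (r := fun j i => altProd x (D.pos (r, i)) *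
        (altProd x (D.pos (r, j)))⁻¹ ∈ Q) (fun i j => htot _ _)
        (fun i j l h1 h2 => htrans _ _ _ h2 h1) hne'
      obtain ⟨i, hi⟩ := hsurj (r, j)
      refine ⟨j, hne _ _ (ho (r, j)).2.1.symm ?_⟩
      rw [← hi]
      exact hj i (Finset.mem_univ i)
  choose j hj1 hj2 using hcell
  have : Nonempty (Fin n × Fin (2 * k)) := ⟨⟨⟨0, hn⟩, ⟨0, by omega⟩⟩⟩
  choose! c hc1 hc2 hc3 using fun C hC => (hF2 C hC).exists_corner hn (fun p => (ho p).2.2) hQ hKQ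
  have h1 : F.card ≤ (Finset.univ.filter fun p => plus p ∧ plus (p.1, next p.2)).card := by
    refine Finset.card_le_card_of_injOn c (fun C hC => ?_) fun C hC C' hC' h => ?_
    · simpa using ⟨hc2 C hC, hc3 C hC⟩
    · refine hF1 C hC C' hC' _ (hc1 C hC) ?_
      rw [h]
      exact hc1 C' hC'
  have h2 : n ≤ (Finset.univ.filter fun p => plus p ∧ ¬plus (p.1, next p.2)).card := by
    have := Finset.card_le_card_of_injOn (s := Finset.univ) (fun r : Fin n => (r, j r))
      (t := Finset.univ.filter fun p => plus p ∧ ¬plus (p.1, next p.2))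
      (fun r _ => by simpa using ⟨hj1 r, hj2 r⟩) fun r _ s _ h => (Prod.ext_iff.1 h).1
    rwa [Finset.card_univ, Fintype.card_fin] at this
  have h3 := Finset.card_filter_add_card_filter_not (s := Finset.univ.filter plus)
    fun p => plus (p.1, next p.2)
  rw [Finset.filter_filter, Finset.filter_filter, hcard] at h3
  omega

end DiscDiagram

end Counting

theorem FreeSquare.normalClosure_singleton_ne_top {A : Type} [Group A] [LinearOrder A]
    [MulLeftMono A] [Countable A] [Nontrivial A] (w : FreeSquare A) :
    Subgroup.normalClosure {w} ≠ ⊤ := by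
  classical
  intro hw
  obtain ⟨k, x, Q, hk, hz, hQ, hQK, hdist⟩ := exists_isTotal_zpowers hw
  obtain ⟨a, ha⟩ := exists_ne (1 : A)
  let IsConj : FreeSquare A → Prop := fun g => ∃ (h : FreeSquare A) (s : Bool),
    g = h * (bif s then altProd x (2 * k) else (altProd x (2 * k))⁻¹) * h⁻¹
  have hex : ∃ n, ∃ l : List (FreeSquare A), (∀ g ∈ l, IsConj g) ∧
      l.prod = inj false a ∧ l.length = n := by
    have h1 : inj false a ∈ Subgroup.normalClosure {altProd x (2 * k)} := by
      rw [hz]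
      exact Subgroup.mem_top _
    rw [Subgroup.normalClosure, ← Subgroup.mem_toSubmonoid, Subgroup.closure_toSubmonoid] at h1
    obtain ⟨l, hl, hla⟩ := Submonoid.exists_list_of_mem_closure h1
    refine ⟨_, l, fun g hg => ?_, hla, rfl⟩
    rcases hl g hg with h | h
    · obtain ⟨y, rfl, hy⟩ := Group.mem_conjugatesOfSet_iff.1 h
      obtain ⟨c, rfl⟩ := isConj_iff.1 hy
      exact ⟨c, true, rfl⟩
    · obtain ⟨y, rfl, hy⟩ := Group.mem_conjugatesOfSet_iff.1 h
      obtain ⟨c, hc⟩ := isConj_iff.1 hy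
      refine ⟨c, false, ?_⟩
      rw [← inv_inv g, ← hc]
      simp only [cond_false]
      group
  obtain ⟨l, hl, hla, hlen⟩ := Nat.find_spec hex
  have hn : 0 < l.length := by
    rw [List.length_pos_iff]
    rintro rfl
    rw [List.prod_nil, eq_comm] at hla
    exact ha (Monoid.CoprodI.of_injective (M := fun _ : Bool => A) false
      (hla.trans (map_one _).symm))
  have hl' : ∀ r : Fin l.reverse.length, IsConj (l.reverse.get r) := fun r =>
    hl _ (List.mem_reverse.1 (List.get_mem _ _))
  choose h ε hq using hl'
  have hprod : (List.ofFn l.reverse.get).reverse.prod = inj false a := by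
    rw [List.ofFn_get, List.reverse_reverse, hla]
  obtain ⟨D⟩ := exists_discDiagram h ε hq hprod
  obtain ⟨l', hl1, hl2, hl3⟩ := D.not_minimal (by rwa [List.length_reverse]) hk hQ hQK hdist
  rw [hprod] at hl2
  rw [List.length_reverse, hlen] at hl3
  exact Nat.find_min hex hl3 ⟨l', hl1, hl2, rfl⟩

theorem FreeSquare.range_sup_range (A : Type) [Group A] :
    (inj (A := A) false).range ⊔ (inj (A := A) true).range = ⊤ := by
  rw [eq_top_iff]
  intro g _
  induction g using Monoid.CoprodI.induction_on with
  | one => exact one_mem _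
  | of i a =>
    cases i
    · exact Subgroup.mem_sup_left ⟨a, rfl⟩
    · exact Subgroup.mem_sup_right ⟨a, rfl⟩
  | mul g h hg hh => exact mul_mem (hg trivial) (hh trivial)

theorem FreeSquare.fg {A : Type} [Group A] (hA : Group.FG A) : Group.FG (FreeSquare A) := by
  rw [Group.fg_def, ← range_sup_range]
  have h : ∀ i, (inj (A := A) i).range.FG := fun i =>
    (Group.fg_iff_subgroup_fg _).1 (Group.fg_range (inj (A := A) i))
  exact (h false).sup (h true)

theorem FreeSquare.commutator_eq_top {A : Type} [Group A] (hA : commutator A = ⊤) :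
    commutator (FreeSquare A) = ⊤ := by
  have h : ∀ i, (inj (A := A) i).range ≤ commutator (FreeSquare A) := by
    intro i
    rw [MonoidHom.range_eq_map, ← hA, commutator_def, commutator_def, Subgroup.map_commutator]
    exact Subgroup.commutator_mono le_top le_top
  rw [eq_top_iff, ← range_sup_range]
  exact sup_le (h false) (h true)

/-- **Wiegold problem.** There exists a finitely generated perfect group whose
normal rank is greater than one: no single element normally generates it. -/
theorem exists_fg_perfect_group_normal_rank_gt_one :
    ∃ (G : Type) (_ : Group G), Group.FG G ∧ commutator G = ⊤ ∧
      ∀ w : G, Subgroup.normalClosure {w} ≠ ⊤ := by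
  obtain ⟨A, _, _, _, hfg, hperf, _, hmul⟩ := exists_perfect_leftOrdered
  have : MulLeftMono A := ⟨fun c _ _ h => hmul _ _ c h⟩
  exact ⟨FreeSquare A, inferInstance, FreeSquare.fg hfg, FreeSquare.commutator_eq_top hperf,
    FreeSquare.normalClosure_singleton_ne_top⟩
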